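/- Let n ≥ 2, 1 < p < ∞ and β > 0. Let Ω ⊂ ℝⁿ be a bounded, open, convex set and let Ω* be the ball centered at the origin with P(Ω*) = P(Ω). Then λ_{p,β}(Ω*) ≤ λ_{p,β}(Ω). -/

import Mathlib

open MeasureTheory Metric Set Bornology
open scoped NNReal ENNReal Pointwise symmDiff

noncomputable section

/-- The perimeter of a (convex) set: the `(n-1)`-dimensional Hausdorff measure of its
topological boundary. -/
def perim (n : ℕ) (Ω : Set (EuclideanSpace ℝ (Fin n))) : ℝ :=
  (μH[(n : ℝ) - 1] (frontier Ω)).toReal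

/-- The Rayleigh quotient of `u` on `Ω` with boundary parameter `β`. -/
def rayleigh (n : ℕ) (p β : ℝ) (Ω : Set (EuclideanSpace ℝ (Fin n)))
    (u : EuclideanSpace ℝ (Fin n) → ℝ) : ℝ :=
  ((∫ x in Ω, ‖fderiv ℝ u x‖ ^ p) +
      β * ∫ x in frontier Ω, |u x| ^ p ∂(μH[(n : ℝ) - 1])) /
    ∫ x in Ω, |u x| ^ p

/-- The first Robin eigenvalue of the `p`-Laplacian on `Ω` with boundary parameter `β`. -/
def robinEig (n : ℕ) (p β : ℝ) (Ω : Set (EuclideanSpace ℝ (Fin n))) : ℝ :=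
  sInf { r : ℝ | ∃ u : EuclideanSpace ℝ (Fin n) → ℝ,
    (∃ K : ℝ≥0, LipschitzOnWith K u (closure Ω)) ∧
    (0 < ∫ x in Ω, |u x| ^ p) ∧ r = rayleigh n p β Ω u }

/-- `v` is a first eigenfunction for the Robin `p`-Laplacian on `Ω`: a positive radial
Lipschitz function on the closure of `Ω` whose Rayleigh quotient equals `λ_{p,β}(Ω)`. -/
def IsFirstEigenfunction (n : ℕ) (p β : ℝ) (Ω : Set (EuclideanSpace ℝ (Fin n)))
    (v : EuclideanSpace ℝ (Fin n) → ℝ) : Prop :=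
  (∃ K : ℝ≥0, LipschitzOnWith K v (closure Ω)) ∧
  (∀ x ∈ closure Ω, 0 < v x) ∧
  (∃ h : ℝ → ℝ, ∀ x ∈ closure Ω, v x = h ‖x‖) ∧
  (0 < ∫ x in Ω, |v x| ^ p) ∧
  rayleigh n p β Ω v = robinEig n p β Ω

/-- `ω_n`, the Lebesgue measure of the unit ball of `ℝⁿ`. -/
def unitBallVol (n : ℕ) : ℝ :=
  (volume (ball (0 : EuclideanSpace ℝ (Fin n)) 1)).toReal

open scoped RealInnerProductSpace

/-- One-dimensional Brunn–Minkowski inequality. -/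
theorem volume_add_le_of_add_subset {A B C : Set ℝ} (hA : MeasurableSet A) (hB : MeasurableSet B)
    (hAn : A.Nonempty) (hBn : B.Nonempty) (h : A + B ⊆ C) :
    volume A + volume B ≤ volume C := by
  have key : ∀ K L : Set ℝ, IsCompact K → IsCompact L → K.Nonempty → L.Nonempty → K ⊆ A → L ⊆ B →
      volume K + volume L ≤ volume C := by
    intro K L hK hL hKn hLn hKA hLB
    obtain ⟨a, haK, ha⟩ := hK.exists_isGreatest hKn
    obtain ⟨b, hbL, hb⟩ := hL.exists_isLeast hLn
    have h1 : (fun x => x + b) '' K ∪ (fun y => a + y) '' L ⊆ C := by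
      rintro z (⟨x, hx, rfl⟩ | ⟨y, hy, rfl⟩)
      · exact h (add_mem_add (hKA hx) (hLB hbL))
      · exact h (add_mem_add (hKA haK) (hLB hy))
    have h2 : AEDisjoint volume ((fun x => x + b) '' K) ((fun y => a + y) '' L) := by
      have : ((fun x => x + b) '' K) ∩ ((fun y => a + y) '' L) ⊆ {a + b} := by
        rintro z ⟨⟨x, hx, rfl⟩, ⟨y, hy, hxy⟩⟩
        have := ha hx
        have := hb hy
        simp only [mem_singleton_iff] at *
        linarith
      exact measure_mono_null this (by simp)
    calc volume K + volume L
        = volume ((fun x => x + b) '' K) + volume ((fun y => a + y) '' L) := by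
          simp [image_add_right, image_add_left, measure_preimage_add, measure_preimage_add_right]
      _ = volume ((fun x => x + b) '' K ∪ (fun y => a + y) '' L) := by
          rw [measure_union₀ ((hL.image (by fun_prop)).measurableSet.nullMeasurableSet) h2]
      _ ≤ volume C := measure_mono h1
  have key2 : ∀ K L : Set ℝ, IsCompact K → IsCompact L → K ⊆ A → L ⊆ B →
      volume K + volume L ≤ volume C := by
    intro K L hK hL hKA hLB
    obtain ⟨a, ha⟩ := hAn
    obtain ⟨b, hb⟩ := hBn
    refine le_trans (add_le_add (measure_mono (subset_insert a K))
      (measure_mono (subset_insert b L))) ?_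
    exact key _ _ (hK.insert a) (hL.insert b) (insert_nonempty _ _) (insert_nonempty _ _)
      (insert_subset ha hKA) (insert_subset hb hLB)
  rw [hA.measure_eq_iSup_isCompact, hB.measure_eq_iSup_isCompact]
  simp_rw [iSup_and']
  refine ENNReal.biSup_add_biSup_le' ⟨∅, empty_subset _, isCompact_empty⟩
    ⟨∅, empty_subset _, isCompact_empty⟩ ?_
  rintro K ⟨hKA, hK⟩ L ⟨hLB, hL⟩
  exact key2 K L hK hL hKA hLB

theorem ENNReal.rpow_mul_rpow_le_weighted_add {a b : ℝ} (ha : 0 < a) (hb : 0 < b) (hab : a + b = 1)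
    (x y : ℝ≥0∞) : x ^ a * y ^ b ≤ ENNReal.ofReal a * x + ENNReal.ofReal b * y := by
  have hpq : (a⁻¹).HolderConjugate b⁻¹ :=
    Real.holderConjugate_iff.2 ⟨(one_lt_inv₀ ha).2 (by linarith), by simpa using hab⟩
  have := ENNReal.young_inequality (x ^ a) (y ^ b) hpq
  rw [← ENNReal.rpow_mul, ← ENNReal.rpow_mul, mul_inv_cancel₀ ha.ne', mul_inv_cancel₀ hb.ne',
    ENNReal.rpow_one, ENNReal.rpow_one, ENNReal.ofReal_inv_of_pos ha, ENNReal.ofReal_inv_of_pos hb,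
    div_eq_mul_inv, div_eq_mul_inv, inv_inv, inv_inv] at this
  rwa [mul_comm x, mul_comm y] at this

theorem lintegral_eq_lintegral_meas_lt_Ioo {f : ℝ → ℝ} (hf : Measurable f) (h0 : ∀ x, 0 ≤ f x)
    (h1 : ∀ x, f x ≤ 1) :
    ∫⁻ x, ENNReal.ofReal (f x) = ∫⁻ t in Ioo (0 : ℝ) 1, volume {x | t < f x} := by
  rw [lintegral_eq_lintegral_meas_lt _ (ae_of_all _ h0) hf.aemeasurable]
  have : Ioi (0 : ℝ) = Ioo 0 1 ∪ Ici 1 := (Ioo_union_Ici_eq_Ioi one_pos).symm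
  rw [this, lintegral_union measurableSet_Ici (by
    rw [disjoint_left]; intro x hx hx'; exact absurd hx.2 (not_lt.2 hx'))]
  rw [setLIntegral_congr_fun (g := fun _ => 0) measurableSet_Ici]
  · simp
  · intro t ht
    have : {x | t < f x} = ∅ := by
      ext x; simp only [mem_ofPred_eq, mem_empty_iff_false, iff_false, not_lt]
      exact (h1 x).trans ht
    simp [this]

theorem prekopa_leindler_real_normalized {f g h : ℝ → ℝ} {a b : ℝ} (ha : 0 < a) (hb : 0 < b)
    (hab : a + b = 1)
    (hf : Measurable f) (hg : Measurable g) (hh : Measurable h) (hf0 : ∀ x, 0 ≤ f x)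
    (hg0 : ∀ x, 0 ≤ g x) (hh0 : ∀ x, 0 ≤ h x) (hf1 : ∀ x, f x ≤ 1) (hg1 : ∀ x, g x ≤ 1)
    (hfs : ∀ t < 1, ∃ x, t < f x) (hgs : ∀ t < 1, ∃ x, t < g x)
    (H : ∀ x y, f x ^ a * g y ^ b ≤ h (a * x + b * y)) :
    ENNReal.ofReal a * (∫⁻ x, ENNReal.ofReal (f x)) +
      ENNReal.ofReal b * (∫⁻ x, ENNReal.ofReal (g x)) ≤ ∫⁻ x, ENNReal.ofReal (h x) := by
  rw [lintegral_eq_lintegral_meas_lt_Ioo hf hf0 hf1, lintegral_eq_lintegral_meas_lt_Ioo hg hg0 hg1,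
    lintegral_eq_lintegral_meas_lt _ (ae_of_all _ hh0) hh.aemeasurable]
  refine le_trans ?_ (lintegral_mono_set (s := Ioo (0 : ℝ) 1) (fun x hx => hx.1))
  have hm : Measurable fun t : ℝ => volume {x | t < f x} :=
    Antitone.measurable fun s t hst => measure_mono fun x (hx : t < f x) => hst.trans_lt hx
  have hm' : Measurable fun t : ℝ => volume {x | t < g x} :=
    Antitone.measurable fun s t hst => measure_mono fun x (hx : t < g x) => hst.trans_lt hx
  rw [← lintegral_const_mul _ hm, ← lintegral_const_mul _ hm',
    ← lintegral_add_left (hm.const_mul _)]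
  refine setLIntegral_mono' measurableSet_Ioo fun t ht => ?_
  have e1 : ENNReal.ofReal a * volume {x | t < f x} = volume (a • {x | t < f x}) := by
    rw [Measure.addHaar_smul]; simp [abs_of_pos ha]
  have e2 : ENNReal.ofReal b * volume {x | t < g x} = volume (b • {x | t < g x}) := by
    rw [Measure.addHaar_smul]; simp [abs_of_pos hb]
  rw [e1, e2]
  refine volume_add_le_of_add_subset ((measurableSet_lt measurable_const hf).const_smul₀ a)
    ((measurableSet_lt measurable_const hg).const_smul₀ b) ?_ ?_ ?_
  · exact Set.Nonempty.smul_set (hfs t ht.2)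
  · exact Set.Nonempty.smul_set (hgs t ht.2)
  · rintro _ ⟨_, ⟨x, hx, rfl⟩, _, ⟨y, hy, rfl⟩, rfl⟩
    simp only [mem_ofPred_eq, smul_eq_mul] at *
    refine lt_of_lt_of_le ?_ (H x y)
    calc t = t ^ a * t ^ b := by rw [← Real.rpow_add ht.1, hab, Real.rpow_one]
      _ < f x ^ a * g y ^ b := by
        apply mul_lt_mul'' (Real.rpow_lt_rpow ht.1.le hx ha) (Real.rpow_lt_rpow ht.1.le hy hb)
          (Real.rpow_nonneg ht.1.le _) (Real.rpow_nonneg ht.1.le _)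

theorem prekopa_leindler_real_bounded {f g h : ℝ → ℝ} {a b M : ℝ} (ha : 0 < a) (hb : 0 < b)
    (hab : a + b = 1)
    (hf : Measurable f) (hg : Measurable g) (hh : Measurable h) (hf0 : ∀ x, 0 ≤ f x)
    (hg0 : ∀ x, 0 ≤ g x) (hh0 : ∀ x, 0 ≤ h x) (hfM : ∀ x, f x ≤ M) (hgM : ∀ x, g x ≤ M)
    (H : ∀ x y, f x ^ a * g y ^ b ≤ h (a * x + b * y)) :
    (∫⁻ x, ENNReal.ofReal (f x)) ^ a * (∫⁻ x, ENNReal.ofReal (g x)) ^ b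
      ≤ ∫⁻ x, ENNReal.ofReal (h x) := by
  have hbf : BddAbove (range f) := ⟨M, by rintro _ ⟨x, rfl⟩; exact hfM x⟩
  have hbg : BddAbove (range g) := ⟨M, by rintro _ ⟨x, rfl⟩; exact hgM x⟩
  have hfA : ∀ x, f x ≤ ⨆ x, f x := le_ciSup hbf
  have hgA : ∀ x, g x ≤ ⨆ x, g x := le_ciSup hbg
  set A := ⨆ x, f x with hA
  set B := ⨆ x, g x with hB
  rcases (hf0 0 |>.trans (hfA 0)).eq_or_lt with hA0 | hA0
  · have : ∀ x, f x = 0 := fun x => le_antisymm (hA0 ▸ hfA x) (hf0 x)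
    simp [this, ha]
  rcases (hg0 0 |>.trans (hgA 0)).eq_or_lt with hB0 | hB0
  · have : ∀ x, g x = 0 := fun x => le_antisymm (hB0 ▸ hgA x) (hg0 x)
    simp [this, hb]
  set c := A ^ a * B ^ b with hc
  have hc0 : 0 < c := by positivity
  have key := prekopa_leindler_real_normalized (f := fun x => f x / A) (g := fun x => g x / B)
    (h := fun x => h x / c) ha hb hab (hf.div_const _) (hg.div_const _) (hh.div_const _)
    (fun x => div_nonneg (hf0 x) hA0.le) (fun x => div_nonneg (hg0 x) hB0.le)
    (fun x => div_nonneg (hh0 x) hc0.le) (fun x => (div_le_one hA0).2 (hfA x))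
    (fun x => (div_le_one hB0).2 (hgA x)) ?_ ?_ ?_
  · have ef : ∫⁻ x, ENNReal.ofReal (f x) = ENNReal.ofReal A * ∫⁻ x, ENNReal.ofReal (f x / A) := by
      rw [← lintegral_const_mul _ (hf.div_const _).ennreal_ofReal]
      congr with x
      rw [← ENNReal.ofReal_mul hA0.le, mul_div_cancel₀ _ hA0.ne']
    have eg : ∫⁻ x, ENNReal.ofReal (g x) = ENNReal.ofReal B * ∫⁻ x, ENNReal.ofReal (g x / B) := by
      rw [← lintegral_const_mul _ (hg.div_const _).ennreal_ofReal]
      congr with x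
      rw [← ENNReal.ofReal_mul hB0.le, mul_div_cancel₀ _ hB0.ne']
    have eh : ∫⁻ x, ENNReal.ofReal (h x) = ENNReal.ofReal c * ∫⁻ x, ENNReal.ofReal (h x / c) := by
      rw [← lintegral_const_mul _ (hh.div_const _).ennreal_ofReal]
      congr with x
      rw [← ENNReal.ofReal_mul hc0.le, mul_div_cancel₀ _ hc0.ne']
    rw [ef, eg, eh, ENNReal.mul_rpow_of_nonneg _ _ ha.le, ENNReal.mul_rpow_of_nonneg _ _ hb.le,
      mul_mul_mul_comm, ENNReal.ofReal_rpow_of_pos hA0, ENNReal.ofReal_rpow_of_pos hB0,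
      ← ENNReal.ofReal_mul (by positivity)]
    gcongr
    exact (ENNReal.rpow_mul_rpow_le_weighted_add ha hb hab _ _).trans key
  · intro t ht
    obtain ⟨x, hx⟩ := exists_lt_of_lt_ciSup (show t * A < A by nlinarith)
    exact ⟨x, (lt_div_iff₀ hA0).2 hx⟩
  · intro t ht
    obtain ⟨x, hx⟩ := exists_lt_of_lt_ciSup (show t * B < B by nlinarith)
    exact ⟨x, (lt_div_iff₀ hB0).2 hx⟩
  · intro x y
    rw [Real.div_rpow (hf0 x) hA0.le, Real.div_rpow (hg0 y) hB0.le, div_mul_div_comm]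
    gcongr
    exact H x y

/-- One-dimensional Prékopa–Leindler inequality. -/
theorem prekopa_leindler_one {f g h : ℝ → ℝ≥0∞} {a b : ℝ} (ha : 0 < a) (hb : 0 < b)
    (hab : a + b = 1) (hf : Measurable f) (hg : Measurable g) (hh : Measurable h)
    (H : ∀ x y, f x ^ a * g y ^ b ≤ h (a * x + b * y)) :
    (∫⁻ x, f x) ^ a * (∫⁻ x, g x) ^ b ≤ ∫⁻ x, h x := by
  by_cases hf0 : ∫⁻ x, f x = 0
  · simp [hf0, ha]
  by_cases hg0 : ∫⁻ x, g x = 0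
  · simp [hg0, hb]
  have trunc : ∀ k : ℕ, (∫⁻ x, min (f x) k) ^ a * (∫⁻ x, min (g x) k) ^ b ≤ ∫⁻ x, h x := by
    intro k
    have htop : ∀ u : ℝ≥0∞, min u k ≠ ∞ := fun u =>
      ((min_le_right _ _).trans_lt (ENNReal.natCast_lt_top k)).ne
    have e : ∀ u : ℝ → ℝ≥0∞, ∫⁻ x, min (u x) k = ∫⁻ x, ENNReal.ofReal (min (u x) k).toReal :=
      fun u => lintegral_congr fun x => (ENNReal.ofReal_toReal (htop _)).symm
    have hle : ∀ u : ℝ≥0∞, (min u k).toReal ≤ k := fun u =>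
      ENNReal.toReal_le_of_le_ofReal (by positivity) (by simp)
    have key := prekopa_leindler_real_bounded (f := fun x => (min (f x) k).toReal)
      (g := fun x => (min (g x) k).toReal) (h := fun x => (min (h x) k).toReal) (M := k) ha hb hab
      (by fun_prop) (by fun_prop) (by fun_prop)
      (fun _ => ENNReal.toReal_nonneg) (fun _ => ENNReal.toReal_nonneg)
      (fun _ => ENNReal.toReal_nonneg) (fun _ => hle _) (fun _ => hle _) ?_
    · rw [e, e]
      refine key.trans ?_
      rw [← e]
      exact lintegral_mono fun x => min_le_left _ _
    · intro x y
      rw [ENNReal.toReal_rpow, ENNReal.toReal_rpow, ← ENNReal.toReal_mul]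
      refine ENNReal.toReal_mono (htop _) (le_min ?_ ?_)
      · refine le_trans ?_ (H x y)
        gcongr <;> exact min_le_left _ _
      · calc min (f x) k ^ a * min (g y) k ^ b ≤ (k : ℝ≥0∞) ^ a * (k : ℝ≥0∞) ^ b := by
              gcongr <;> exact min_le_right _ _
          _ = k := by rw [← ENNReal.rpow_add_of_nonneg _ _ ha.le hb.le, hab, ENNReal.rpow_one]
  have lim : ∀ u : ℝ → ℝ≥0∞, Measurable u →
      Filter.Tendsto (fun k : ℕ => ∫⁻ x, min (u x) k) Filter.atTop (nhds (∫⁻ x, u x)) := by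
    intro u hu
    refine lintegral_tendsto_of_tendsto_of_monotone (fun k => by fun_prop)
      (ae_of_all _ fun x i j hij => by dsimp only; gcongr) (ae_of_all _ fun x => ?_)
    have : Filter.Tendsto (fun k : ℕ => min (u x) (k : ℝ≥0∞)) Filter.atTop (nhds (min (u x) ∞)) :=
      tendsto_const_nhds.min ENNReal.tendsto_nat_nhds_top
    simpa using this
  refine le_of_tendsto' (ENNReal.Tendsto.mul ((ENNReal.continuous_rpow_const.tendsto _).comp
    (lim f hf)) (Or.inl ?_) ((ENNReal.continuous_rpow_const.tendsto _).comp (lim g hg))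
    (Or.inl ?_)) trunc
  · simp [hf0, ENNReal.rpow_eq_zero_iff, ha.le]
  · simp [hg0, ENNReal.rpow_eq_zero_iff, hb.le]

/-- Prékopa–Leindler inequality. -/
theorem prekopa_leindler {n : ℕ} {f g h : (Fin n → ℝ) → ℝ≥0∞} {a b : ℝ} (ha : 0 < a) (hb : 0 < b)
    (hab : a + b = 1) (hf : Measurable f) (hg : Measurable g) (hh : Measurable h)
    (H : ∀ x y, f x ^ a * g y ^ b ≤ h (a • x + b • y)) :
    (∫⁻ x, f x) ^ a * (∫⁻ x, g x) ^ b ≤ ∫⁻ x, h x := by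
  induction n with
  | zero =>
    have H0 : ∀ x y z, f x ^ a * g y ^ b ≤ h z := fun x y z => by
      have := H x y
      rwa [Subsingleton.elim (a • x + b • y) z] at this
    simp only [lintegral_unique]
    have : (volume : Measure (Fin 0 → ℝ)) univ = 1 := by simp [volume_pi]
    simp only [this, mul_one]
    exact H0 _ _ _
  | succ n ih =>
    have e : ∀ u : (Fin (n + 1) → ℝ) → ℝ≥0∞, Measurable u →
        ∫⁻ x, u x = ∫⁻ t : ℝ, ∫⁻ y : Fin n → ℝ, u (Fin.cons t y) := by
      intro u hu
      have mp := (volume_preserving_piFinSuccAbove (fun _ : Fin (n + 1) => ℝ) 0).symm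
      rw [← mp.lintegral_comp hu, Measure.volume_eq_prod,
        lintegral_prod
        (fun z => u ((MeasurableEquiv.piFinSuccAbove (fun _ : Fin (n + 1) => ℝ) 0).symm z))
        (hu.comp mp.measurable).aemeasurable]
      simp [MeasurableEquiv.piFinSuccAbove, Fin.insertNthEquiv]
    have hcons : Measurable fun z : ℝ × (Fin n → ℝ) => (Fin.cons z.1 z.2 : Fin (n + 1) → ℝ) := by
      have mp := (volume_preserving_piFinSuccAbove (fun _ : Fin (n + 1) => ℝ) 0).symm
      have := mp.measurable
      simpa [MeasurableEquiv.piFinSuccAbove, Fin.insertNthEquiv, Fin.insertNth_zero] using this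
    have hm : ∀ u : (Fin (n + 1) → ℝ) → ℝ≥0∞, Measurable u →
        Measurable fun t : ℝ => ∫⁻ y : Fin n → ℝ, u (Fin.cons t y) := fun u hu =>
      (hu.comp hcons).lintegral_prod_right'
    rw [e f hf, e g hg, e h hh]
    refine prekopa_leindler_one ha hb hab (hm f hf) (hm g hg) (hm h hh) fun x y => ?_
    refine ih (hf.comp (hcons.comp measurable_prodMk_left))
      (hg.comp (hcons.comp measurable_prodMk_left)) (hh.comp (hcons.comp measurable_prodMk_left))
      fun v w => ?_
    have := H (Fin.cons x v) (Fin.cons y w)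
    convert this using 2
    ext i
    refine Fin.cases ?_ (fun j => ?_) i <;> simp

theorem prekopa_leindler_euclidean {n : ℕ} {f g h : EuclideanSpace ℝ (Fin n) → ℝ≥0∞} {a b : ℝ}
    (ha : 0 < a) (hb : 0 < b)
    (hab : a + b = 1) (hf : Measurable f) (hg : Measurable g) (hh : Measurable h)
    (H : ∀ x y, f x ^ a * g y ^ b ≤ h (a • x + b • y)) :
    (∫⁻ x, f x) ^ a * (∫⁻ x, g x) ^ b ≤ ∫⁻ x, h x := by
  have mp := PiLp.volume_preserving_toLp (Fin n)
  rw [← mp.lintegral_comp hf, ← mp.lintegral_comp hg, ← mp.lintegral_comp hh]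
  refine prekopa_leindler ha hb hab (hf.comp mp.measurable) (hg.comp mp.measurable)
    (hh.comp mp.measurable) fun x y => ?_
  simpa using H (WithLp.toLp 2 x) (WithLp.toLp 2 y)

/-- Brunn–Minkowski inequality for the sum of a set and a ball. -/
theorem volume_ball_add_le_volume_thickening {n : ℕ} {A : Set (EuclideanSpace ℝ (Fin n))}
    (hA : MeasurableSet A) {r ε : ℝ} (hr : 0 < r) (hε : 0 < ε)
    (h : volume A = volume (ball (0 : EuclideanSpace ℝ (Fin n)) r)) :
    volume (ball (0 : EuclideanSpace ℝ (Fin n)) (r + ε)) ≤ volume (thickening ε A) := by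
  have hre : 0 < r + ε := by positivity
  set a := r / (r + ε) with ha_def
  set b := ε / (r + ε) with hb_def
  have ha : 0 < a := by positivity
  have hb : 0 < b := by positivity
  have hab : a + b = 1 := by rw [ha_def, hb_def]; field_simp
  have hA' : MeasurableSet (a⁻¹ • A) := hA.const_smul₀ _
  have key := prekopa_leindler_euclidean (f := (a⁻¹ • A).indicator 1)
    (g := (ball (0 : EuclideanSpace ℝ (Fin n)) (r + ε)).indicator 1)
    (h := (thickening ε A).indicator 1) ha hb hab (measurable_one.indicator hA')
    (measurable_one.indicator measurableSet_ball)
    (measurable_one.indicator isOpen_thickening.measurableSet) ?_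
  · rw [lintegral_indicator_one hA', lintegral_indicator_one measurableSet_ball,
      lintegral_indicator_one isOpen_thickening.measurableSet, Measure.addHaar_smul, h,
      ← Measure.addHaar_smul, _root_.smul_ball (inv_ne_zero ha.ne'), smul_zero, Real.norm_eq_abs,
      abs_of_pos (inv_pos.2 ha)] at key
    have e : a⁻¹ * r = r + ε := by rw [ha_def]; field_simp
    rwa [e, ← ENNReal.rpow_add_of_nonneg _ _ ha.le hb.le, hab, ENNReal.rpow_one] at key
  · intro x y
    by_cases hx : x ∈ a⁻¹ • A
    · by_cases hy : y ∈ ball (0 : EuclideanSpace ℝ (Fin n)) (r + ε)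
      · have : a • x + b • y ∈ thickening ε A := by
          rw [mem_thickening_iff]
          refine ⟨a • x, by rwa [mem_inv_smul_set_iff₀ ha.ne'] at hx, ?_⟩
          rw [mem_ball_zero_iff] at hy
          rw [dist_eq_norm, add_sub_cancel_left, norm_smul, Real.norm_eq_abs, abs_of_pos hb,
            hb_def, div_mul_eq_mul_div, div_lt_iff₀ hre]
          gcongr
        simp [hx, hy, this]
      · simp [hy, hb]
    · simp [hx, ha]

/-- Orthonormal coordinates on `ℝᵐ⁺¹` adapted to a unit vector `v`: an isometric
parametrization `lift` of the hyperplane orthogonal to `v` and the projection `proj` onto it. -/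
structure HyperplaneFrame {m : ℕ} (v : EuclideanSpace ℝ (Fin (m + 1))) where
  lift : EuclideanSpace ℝ (Fin m) →ₗᵢ[ℝ] EuclideanSpace ℝ (Fin (m + 1))
  proj : EuclideanSpace ℝ (Fin (m + 1)) →L[ℝ] EuclideanSpace ℝ (Fin m)
  inner_lift : ∀ y, ⟪lift y, v⟫ = 0
  proj_lift : ∀ y, proj (lift y) = y
  proj_self : proj v = 0
  lift_proj_add : ∀ x, lift (proj x) + ⟪x, v⟫ • v = x

namespace HyperplaneFrame

variable {m : ℕ} {v : EuclideanSpace ℝ (Fin (m + 1))}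

theorem nonempty (hv : ‖v‖ = 1) : Nonempty (HyperplaneFrame v) := by
  have hv0 : v ≠ 0 := by rintro rfl; simp at hv
  have : Fact (Module.finrank ℝ (EuclideanSpace ℝ (Fin (m + 1))) = m + 1) := ⟨by simp⟩
  set b := (OrthonormalBasis.fromOrthogonalSpanSingleton (𝕜 := ℝ) m hv0).repr with hb
  have hadd : ∀ x : EuclideanSpace ℝ (Fin (m + 1)),
      (((ℝ ∙ v)ᗮ).orthogonalProjectionOnto x : EuclideanSpace ℝ (Fin (m + 1))) +
        ⟪x, v⟫ • v = x := by
    intro x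
    have h1 := Submodule.starProjection_add_starProjection_orthogonal (K := ℝ ∙ v) x
    rw [Submodule.starProjection_unit_singleton ℝ hv, real_inner_comm] at h1
    exact (add_comm _ _).trans h1
  refine ⟨⟨(Submodule.subtypeₗᵢ _).comp b.symm.toLinearIsometry,
    (b.toContinuousLinearEquiv : _ →L[ℝ] _) ∘L ((ℝ ∙ v)ᗮ).orthogonalProjectionOnto, ?_, ?_, ?_, ?_⟩⟩
  · intro y
    exact (Submodule.mem_orthogonal_singleton_iff_inner_left).1 (b.symm y).2
  · intro y
    simp
  · have : ((ℝ ∙ v)ᗮ).orthogonalProjectionOnto v = 0 := by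
      rw [Submodule.orthogonalProjectionOnto_orthogonal_apply_eq_zero]
      exact Submodule.mem_span_singleton_self v
    simp [this]
  · intro x
    simpa using hadd x

variable (A : HyperplaneFrame v)

theorem norm_lift_add_sq (hv : ‖v‖ = 1) (y : EuclideanSpace ℝ (Fin m)) (s : ℝ) :
    ‖A.lift y + s • v‖ ^ 2 = ‖y‖ ^ 2 + s ^ 2 := by
  have := norm_add_sq_real (A.lift y) (s • v)
  rw [this, inner_smul_right, A.inner_lift, A.lift.norm_map, norm_smul, hv]
  simp

theorem norm_sq_eq (hv : ‖v‖ = 1) (x : EuclideanSpace ℝ (Fin (m + 1))) :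
    ‖x‖ ^ 2 = ‖A.proj x‖ ^ 2 + ⟪x, v⟫ ^ 2 := by
  rw [← A.norm_lift_add_sq hv, A.lift_proj_add]

theorem norm_proj_le (hv : ‖v‖ = 1) (x : EuclideanSpace ℝ (Fin (m + 1))) :
    ‖A.proj x‖ ≤ ‖x‖ := by
  refine abs_le_of_sq_le_sq' ?_ (norm_nonneg _) |>.2
  rw [A.norm_sq_eq hv x]
  nlinarith [sq_nonneg ⟪x, v⟫]

theorem lipschitzWith_proj (hv : ‖v‖ = 1) : LipschitzWith 1 A.proj :=
  LipschitzWith.of_dist_le_mul fun x y => by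
    rw [dist_eq_norm, dist_eq_norm, ← map_sub, NNReal.coe_one, one_mul]
    exact A.norm_proj_le hv _

/-- The coordinates `(y, s)` of the point `lift y + s • v`. -/
def homeomorph (hv : ‖v‖ = 1) :
    EuclideanSpace ℝ (Fin m) × ℝ ≃ₜ EuclideanSpace ℝ (Fin (m + 1)) where
  toFun z := A.lift z.1 + z.2 • v
  invFun x := (A.proj x, ⟪x, v⟫)
  left_inv z := by
    ext1
    · simp [A.proj_lift, A.proj_self]
    · simp [inner_add_left, A.inner_lift, inner_smul_left, hv]
  right_inv x := A.lift_proj_add x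
  continuous_toFun := by
    have := A.lift.continuous
    fun_prop
  continuous_invFun := by
    have := A.proj.continuous
    fun_prop

theorem measurePreserving_homeomorph (hv : ‖v‖ = 1) :
    MeasurePreserving (A.homeomorph hv) := by
  let L : WithLp 2 (EuclideanSpace ℝ (Fin m) × ℝ) →ₗᵢ[ℝ] EuclideanSpace ℝ (Fin (m + 1)) :=
    { toFun := fun z => A.lift z.fst + z.snd • v
      map_add' := fun x y => by simp [add_smul]; abel
      map_smul' := fun c x => by simp [smul_smul]
      norm_map' := fun z => by
        refine (sq_eq_sq₀ (norm_nonneg _) (norm_nonneg _)).1 ?_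
        rw [WithLp.prod_norm_sq_eq_of_L2]
        simp only [LinearMap.coe_mk, AddHom.coe_mk]
        rw [A.norm_lift_add_sq hv]
        simp }
  have hf : Module.finrank ℝ (WithLp 2 (EuclideanSpace ℝ (Fin m) × ℝ)) =
      Module.finrank ℝ (EuclideanSpace ℝ (Fin (m + 1))) := by
    rw [(WithLp.linearEquiv 2 ℝ (EuclideanSpace ℝ (Fin m) × ℝ)).finrank_eq]
    simp
  exact (L.toLinearIsometryEquiv hf).measurePreserving.comp
    (WithLp.volume_preserving_toLp (EuclideanSpace ℝ (Fin m)) ℝ)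

theorem volume_eq_lintegral (hv : ‖v‖ = 1) {X : Set (EuclideanSpace ℝ (Fin (m + 1)))}
    (hX : MeasurableSet X) :
    volume X = ∫⁻ y : EuclideanSpace ℝ (Fin m), volume {s : ℝ | A.lift y + s • v ∈ X} := by
  have mp := A.measurePreserving_homeomorph hv
  rw [← mp.measure_preimage hX.nullMeasurableSet, Measure.volume_eq_prod,
    Measure.prod_apply ((A.homeomorph hv).continuous.measurable hX)]
  rfl

theorem volume_le_of_diam_fiber_le (hv : ‖v‖ = 1) {X : Set (EuclideanSpace ℝ (Fin (m + 1)))}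
    (hX : MeasurableSet X) {Y : Set (EuclideanSpace ℝ (Fin m))} (hY : MeasurableSet Y)
    (hXY : ∀ x ∈ X, A.proj x ∈ Y) {c : ℝ}
    (hc : ∀ y s t, A.lift y + s • v ∈ X → A.lift y + t • v ∈ X → s - t ≤ c) :
    volume X ≤ ENNReal.ofReal c * volume Y := by
  rw [A.volume_eq_lintegral hv hX]
  calc _ ≤ ∫⁻ y, Y.indicator (fun _ => ENNReal.ofReal c) y := lintegral_mono fun y => ?_
    _ = _ := lintegral_indicator_const hY _
  by_cases hy : y ∈ Y
  · simp only [indicator_of_mem hy]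
    refine (Real.volume_le_diam _).trans (ediam_le fun s hs t ht => ?_)
    rw [edist_dist, Real.dist_eq]
    exact ENNReal.ofReal_le_ofReal (abs_sub_le_iff.2 ⟨hc y s t hs ht, hc y t s ht hs⟩)
  · have : {s : ℝ | A.lift y + s • v ∈ X} = ∅ := by
      ext s
      simp only [mem_ofPred_eq, mem_empty_iff_false, iff_false]
      intro h
      have := hXY _ h
      rw [map_add, A.proj_lift, map_smul, A.proj_self, smul_zero, add_zero] at this
      exact hy this
    simp [this]

theorem volume_image_prod (hv : ‖v‖ = 1) (Y : Set (EuclideanSpace ℝ (Fin m))) (a b : ℝ) :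
    volume (A.homeomorph hv '' (Y ×ˢ Icc a b)) = volume Y * ENNReal.ofReal (b - a) := by
  rw [← (A.homeomorph hv).toMeasurableEquiv_coe, MeasurableEquiv.image_eq_preimage_symm,
    ((A.measurePreserving_homeomorph hv).symm
      (A.homeomorph hv).toMeasurableEquiv).measure_preimage_equiv,
    Measure.volume_eq_prod, Measure.prod_prod, Real.volume_Icc]

end HyperplaneFrame

theorem LipschitzOnWith.euclideanHausdorffMeasure_image_le {X Y : Type*} [EMetricSpace X]
    [EMetricSpace Y] [MeasurableSpace X] [BorelSpace X] [MeasurableSpace Y] [BorelSpace Y]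
    {K : ℝ≥0} {f : X → Y} {s : Set X} (h : LipschitzOnWith K f s) (d : ℕ) :
    (μHE[d] : Measure Y) (f '' s) ≤ (K : ℝ≥0∞) ^ d * (μHE[d] : Measure X) s := by
  have := h.hausdorffMeasure_image_le (Nat.cast_nonneg d)
  rw [Measure.euclideanHausdorffMeasure_def, Measure.euclideanHausdorffMeasure_def,
    Measure.smul_apply, Measure.smul_apply, ENNReal.smul_def, ENNReal.smul_def, smul_eq_mul,
    smul_eq_mul, mul_left_comm]
  gcongr
  simpa using this

theorem euclideanHausdorffMeasure_le_image {X Y : Type*} [MetricSpace X]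
    [MetricSpace Y] [MeasurableSpace X] [BorelSpace X] [MeasurableSpace Y] [BorelSpace Y]
    {K : ℝ≥0} {f : X → Y} {s : Set X} (h : ∀ x ∈ s, ∀ y ∈ s, dist x y ≤ K * dist (f x) (f y))
    (d : ℕ) :
    (μHE[d] : Measure X) s ≤ (K : ℝ≥0∞) ^ d * (μHE[d] : Measure Y) (f '' s) := by
  rcases s.eq_empty_or_nonempty with rfl | ⟨x₀, hx₀⟩
  · simp
  have : Nonempty X := ⟨x₀⟩
  have inj : InjOn f s := fun x hx y hy hxy => by
    have := h x hx y hy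
    rw [hxy, dist_self, mul_zero] at this
    exact dist_le_zero.1 this
  have hg : LipschitzOnWith K (Function.invFunOn f s) (f '' s) := by
    refine LipschitzOnWith.of_dist_le_mul ?_
    rintro _ ⟨x, hx, rfl⟩ _ ⟨y, hy, rfl⟩
    rw [inj.leftInvOn_invFunOn hx, inj.leftInvOn_invFunOn hy]
    exact h x hx y hy
  have := hg.euclideanHausdorffMeasure_image_le d
  rwa [inj.invFunOn_image subset_rfl] at this

theorem exists_unit_net (m : ℕ) {c : ℝ} (hc : c < 1) :
    ∃ (N : ℕ) (v : ℕ → EuclideanSpace ℝ (Fin (m + 1))), (∀ i, ‖v i‖ = 1) ∧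
      ∀ u : EuclideanSpace ℝ (Fin (m + 1)), ‖u‖ = 1 → ∃ i < N, c < ⟪u, v i⟫ := by
  have hne : Nonempty (sphere (0 : EuclideanSpace ℝ (Fin (m + 1))) 1) :=
    (NormedSpace.sphere_nonempty.2 zero_le_one).to_subtype
  let v : ℕ → EuclideanSpace ℝ (Fin (m + 1)) := fun i => (TopologicalSpace.denseSeq
    (sphere (0 : EuclideanSpace ℝ (Fin (m + 1))) 1) i : EuclideanSpace ℝ (Fin (m + 1)))
  have hv : ∀ i, ‖v i‖ = 1 := fun i => mem_sphere_zero_iff_norm.1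
    (TopologicalSpace.denseSeq (sphere (0 : EuclideanSpace ℝ (Fin (m + 1))) 1) i).2
  have ho : ∀ i, IsOpen {u : EuclideanSpace ℝ (Fin (m + 1)) | c < ⟪u, v i⟫} := fun i =>
    isOpen_lt continuous_const (by fun_prop)
  obtain ⟨t, ht⟩ := (isCompact_sphere (0 : EuclideanSpace ℝ (Fin (m + 1))) 1).elim_finite_subcover
    _ ho (by
      intro u hu
      have hu1 : ‖u‖ = 1 := by simpa using hu
      let U : Set (sphere (0 : EuclideanSpace ℝ (Fin (m + 1))) 1) := {w | c < ⟪u, (w : _)⟫}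
      have hU : IsOpen U := isOpen_lt continuous_const (by fun_prop)
      obtain ⟨w, hw, i, rfl⟩ := (TopologicalSpace.denseRange_denseSeq
        (sphere (0 : EuclideanSpace ℝ (Fin (m + 1))) 1)).inter_open_nonempty U hU
        ⟨⟨u, hu⟩, by simp [U, hu1, hc]⟩
      exact mem_iUnion.2 ⟨i, hw⟩)
  refine ⟨t.sup id + 1, v, hv, fun u hu => ?_⟩
  have := ht (show u ∈ sphere (0 : EuclideanSpace ℝ (Fin (m + 1))) 1 by simpa using hu)
  simp only [mem_iUnion, exists_prop] at this
  obtain ⟨i, hi, h⟩ := this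
  exact ⟨i, Nat.lt_succ_of_le (Finset.le_sup (f := id) hi), h⟩

theorem euclideanHausdorffMeasure_cap_le {m : ℕ} {v : EuclideanSpace ℝ (Fin (m + 1))}
    (hv : ‖v‖ = 1) {D : Set (EuclideanSpace ℝ (Fin (m + 1)))} (hD : ∀ x ∈ D, ‖x‖ = 1) {c : ℝ}
    (hc : 0 < c) (hDc : ∀ x ∈ D, c < ⟪x, v⟫) (ε : ℝ) :
    (μHE[m] : Measure (EuclideanSpace ℝ (Fin (m + 1)))) D * ENNReal.ofReal ε ≤
      ENNReal.ofReal c⁻¹ ^ m * volume {x : EuclideanSpace ℝ (Fin (m + 1)) |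
        1 ≤ ‖x‖ ∧ ‖x‖ ≤ 1 + ε ∧ ‖x‖⁻¹ • x ∈ D} := by
  obtain ⟨A⟩ := HyperplaneFrame.nonempty hv
  have h1 : (μHE[m] : Measure (EuclideanSpace ℝ (Fin (m + 1)))) D ≤
      ENNReal.ofReal c⁻¹ ^ m * volume (A.proj '' D) := by
    rw [← EuclideanSpace.euclideanHausdorffMeasure_eq_volume]
    refine euclideanHausdorffMeasure_le_image (K := c⁻¹.toNNReal) ?_ m
    intro x hx y hy
    rw [Real.coe_toNNReal _ (by positivity), inv_mul_eq_div, le_div_iff₀ hc, mul_comm,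
      dist_eq_norm, dist_eq_norm, ← map_sub]
    refine abs_le_of_sq_le_sq' ?_ (norm_nonneg _) |>.2
    have e := A.norm_sq_eq hv (x - y)
    have ex := A.norm_sq_eq hv x
    have ey := A.norm_sq_eq hv y
    rw [hD x hx] at ex
    rw [hD y hy] at ey
    rw [inner_sub_left] at e
    have sx := hDc x hx
    have sy := hDc y hy
    have hd := abs_norm_sub_norm_le (A.proj x) (A.proj y)
    rw [← map_sub] at hd
    set s := ⟪x, v⟫
    set t := ⟪y, v⟫
    set a := ‖A.proj x‖
    set b := ‖A.proj y‖
    set d := ‖A.proj (x - y)‖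
    have hab : (a - b) ^ 2 ≤ d ^ 2 := by
      rw [← sq_abs (a - b)]
      exact pow_le_pow_left₀ (abs_nonneg _) hd 2
    have k1 : (s + t) ^ 2 * (s - t) ^ 2 = (a - b) ^ 2 * (a + b) ^ 2 := by
      have : (s + t) * (s - t) = -((a - b) * (a + b)) := by nlinarith
      rw [← mul_pow, ← mul_pow, this, neg_sq]
    have k2 : (a + b) ^ 2 ≤ 4 * (1 - c ^ 2) := by nlinarith [sq_nonneg (a - b)]
    have k3 : 4 * c ^ 2 ≤ (s + t) ^ 2 := by nlinarith
    have k4 : 4 * c ^ 2 * (s - t) ^ 2 ≤ d ^ 2 * (4 * (1 - c ^ 2)) := by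
      calc _ ≤ (s + t) ^ 2 * (s - t) ^ 2 := by gcongr
        _ = (a - b) ^ 2 * (a + b) ^ 2 := k1
        _ ≤ _ := by gcongr
    rw [mul_pow, e]
    nlinarith
  have h2 : volume (A.proj '' D) * ENNReal.ofReal ε ≤
      volume {x : EuclideanSpace ℝ (Fin (m + 1)) |
        1 ≤ ‖x‖ ∧ ‖x‖ ≤ 1 + ε ∧ ‖x‖⁻¹ • x ∈ D} := by
    have hl : LipschitzOnWith 1 (fun x : EuclideanSpace ℝ (Fin (m + 1)) =>
        A.homeomorph hv (A.proj (‖x‖⁻¹ • x), ‖x‖ - 1))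
        {x | 1 ≤ ‖x‖ ∧ ‖x‖ ≤ 1 + ε ∧ ‖x‖⁻¹ • x ∈ D} := by
      refine LipschitzOnWith.of_dist_le_mul ?_
      rintro x ⟨hx, -, -⟩ y ⟨hy, -, -⟩
      have ex : ‖(‖x‖⁻¹ • x)‖ = 1 := by
        rw [norm_smul, norm_inv, norm_norm, inv_mul_cancel₀ (by positivity)]
      have ey : ‖(‖y‖⁻¹ • y)‖ = 1 := by
        rw [norm_smul, norm_inv, norm_norm, inv_mul_cancel₀ (by positivity)]
      have fx : x = ‖x‖ • (‖x‖⁻¹ • x) := by rw [smul_inv_smul₀ (by positivity)]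
      have fy : y = ‖y‖ • (‖y‖⁻¹ • y) := by rw [smul_inv_smul₀ (by positivity)]
      rw [NNReal.coe_one, one_mul, dist_eq_norm, dist_eq_norm]
      generalize ‖x‖⁻¹ • x = u at *
      generalize ‖y‖⁻¹ • y = w at *
      generalize ‖x‖ = r at *
      generalize ‖y‖ = r' at *
      refine abs_le_of_sq_le_sq' ?_ (norm_nonneg _) |>.2
      have e1 : A.homeomorph hv (A.proj u, r - 1) - A.homeomorph hv (A.proj w, r' - 1) =
          A.lift (A.proj (u - w)) + (r - r') • v := by
        simp only [HyperplaneFrame.homeomorph, Homeomorph.homeomorph_mk_coe, Equiv.coe_fn_mk,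
          map_sub, sub_smul]
        abel
      have e2 := A.norm_proj_le hv (u - w)
      have e3 : ‖u - w‖ ^ 2 = 2 - 2 * ⟪u, w⟫ := by
        rw [norm_sub_sq_real, ex, ey]; ring
      have e4 : ‖x - y‖ ^ 2 = r ^ 2 + r' ^ 2 - 2 * (r * r') * ⟪u, w⟫ := by
        rw [fx, fy, norm_sub_sq_real, norm_smul, norm_smul, ex, ey, inner_smul_left,
          inner_smul_right]
        simp
        ring
      rw [e1, A.norm_lift_add_sq hv, e4]
      have e5 : ‖A.proj (u - w)‖ ^ 2 ≤ 2 - 2 * ⟪u, w⟫ := by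
        rw [← e3]; gcongr
      have e6 : 0 ≤ 2 - 2 * ⟪u, w⟫ := by rw [← e3]; positivity
      nlinarith [mul_nonneg (sub_nonneg.2 (one_le_mul_of_one_le_of_one_le hx hy)) e6]
    have h3 := hl.euclideanHausdorffMeasure_image_le (m + 1)
    rw [EuclideanSpace.euclideanHausdorffMeasure_eq_volume, ENNReal.coe_one, one_pow,
      one_mul] at h3
    refine le_trans ?_ h3
    have h4 := A.volume_image_prod hv (A.proj '' D) 0 ε
    rw [sub_zero] at h4
    rw [← h4]
    refine measure_mono ?_
    rintro _ ⟨⟨_, s⟩, ⟨⟨x, hx, rfl⟩, hs⟩, rfl⟩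
    have h1s : 0 < 1 + s := by linarith [hs.1]
    have hn : ‖(1 + s) • x‖ = 1 + s := by
      rw [norm_smul, hD x hx, Real.norm_eq_abs, abs_of_pos h1s, mul_one]
    have hi : (1 + s)⁻¹ • (1 + s) • x = x := inv_smul_smul₀ h1s.ne' x
    refine ⟨(1 + s) • x, ⟨?_, ?_, ?_⟩, ?_⟩
    · rw [hn]; linarith [hs.1]
    · rw [hn]; linarith [hs.2]
    · rwa [hn, hi]
    · simp only [hn, hi, add_sub_cancel_left]
  calc _ ≤ ENNReal.ofReal c⁻¹ ^ m * volume (A.proj '' D) * ENNReal.ofReal ε := by gcongr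
    _ ≤ _ := by rw [mul_assoc]; gcongr

theorem euclideanHausdorffMeasure_sphere_mul_le (m : ℕ) {ε : ℝ} (hε : 0 < ε) :
    (μHE[m] : Measure (EuclideanSpace ℝ (Fin (m + 1)))) (sphere 0 1) * ENNReal.ofReal ε ≤
      ENNReal.ofReal (1 + ε) ^ m * (ENNReal.ofReal ((1 + ε) ^ (m + 1) - 1) *
        volume (ball (0 : EuclideanSpace ℝ (Fin (m + 1))) 1)) := by
  set E := EuclideanSpace ℝ (Fin (m + 1))
  obtain ⟨N, v, hv, hN⟩ := exists_unit_net m (c := (1 + ε)⁻¹) (inv_lt_one_of_one_lt₀ (by linarith))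
  let V : ℕ → Set E := fun i => {u | (1 + ε)⁻¹ < ⟪u, v i⟫}
  have hV : ∀ i, MeasurableSet (V i) := fun i =>
    (isOpen_lt continuous_const (by fun_prop)).measurableSet
  let D : ℕ → Set E := fun i => sphere 0 1 ∩ disjointed V i
  have hDm : ∀ i, MeasurableSet (D i) := fun i =>
    isClosed_sphere.measurableSet.inter (MeasurableSet.disjointed hV i)
  have hDu : ⋃ i, D i = sphere (0 : E) 1 := by
    rw [← inter_iUnion, iUnion_disjointed, inter_eq_left]
    intro u hu
    obtain ⟨i, -, hi⟩ := hN u (by simpa using hu)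
    exact mem_iUnion.2 ⟨i, hi⟩
  have hDd : Pairwise (Function.onFun Disjoint D) := fun i j hij =>
    (disjoint_disjointed V hij).mono inter_subset_right inter_subset_right
  let X : ℕ → Set E := fun i => {x | 1 ≤ ‖x‖ ∧ ‖x‖ ≤ 1 + ε ∧ ‖x‖⁻¹ • x ∈ D i}
  have hXm : ∀ i, MeasurableSet (X i) := fun i => by
    refine (measurableSet_le measurable_const measurable_norm).inter
      ((measurableSet_le measurable_norm measurable_const).inter ?_)
    have : Measurable fun x : E => ‖x‖⁻¹ • x := by fun_prop
    exact this (hDm i)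
  have hXd : Pairwise (Function.onFun Disjoint X) := fun i j hij => by
    refine disjoint_left.2 fun x hx hx' => disjoint_left.1 (hDd hij) hx.2.2 hx'.2.2
  have hXu : volume (⋃ i, X i) ≤ ENNReal.ofReal ((1 + ε) ^ (m + 1) - 1) *
        volume (ball (0 : E) 1) := by
    have hsub : ⋃ i, X i ⊆ closedBall (0 : E) (1 + ε) \ ball 0 1 := by
      intro x hx
      obtain ⟨i, h1, h2, -⟩ := mem_iUnion.1 hx
      exact ⟨by simpa using h2, by simpa using h1⟩
    refine (measure_mono hsub).trans ?_
    rw [measure_sdiff (ball_subset_closedBall.trans (closedBall_subset_closedBall (by linarith)))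
      measurableSet_ball.nullMeasurableSet measure_ball_lt_top.ne,
      Measure.addHaar_closedBall _ _ (by positivity)]
    rw [show Module.finrank ℝ E = m + 1 by simp [E]]
    rw [ENNReal.ofReal_sub _ zero_le_one, ENNReal.ofReal_one, ENNReal.sub_mul, one_mul]
    exact fun _ _ => measure_ball_lt_top.ne
  calc _ = (∑' i, (μHE[m] : Measure E) (D i)) * ENNReal.ofReal ε := by
        rw [← measure_iUnion hDd hDm, hDu]
    _ = ∑' i, (μHE[m] : Measure E) (D i) * ENNReal.ofReal ε := ENNReal.tsum_mul_right.symm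
    _ ≤ ∑' i, ENNReal.ofReal (1 + ε) ^ m * volume (X i) := by
        refine ENNReal.tsum_le_tsum fun i => ?_
        have := euclideanHausdorffMeasure_cap_le (hv i) (D := D i)
          (fun x hx => by simpa using hx.1) (c := (1 + ε)⁻¹) (by positivity)
          (fun x hx => disjointed_subset V i hx.2) ε
        rwa [inv_inv] at this
    _ = ENNReal.ofReal (1 + ε) ^ m * volume (⋃ i, X i) := by
        rw [ENNReal.tsum_mul_left, measure_iUnion hXd hXm]
    _ ≤ _ := by gcongr

/-- The area of the unit sphere is at most `n` times the volume of the unit ball. -/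
theorem euclideanHausdorffMeasure_sphere_le (m : ℕ) :
    (μHE[m] : Measure (EuclideanSpace ℝ (Fin (m + 1)))) (sphere 0 1) ≤
      (m + 1) * volume (ball (0 : EuclideanSpace ℝ (Fin (m + 1))) 1) := by
  have key : ∀ ε : ℝ, 0 < ε →
      (μHE[m] : Measure (EuclideanSpace ℝ (Fin (m + 1)))) (sphere 0 1) ≤
      ENNReal.ofReal ((1 + ε) ^ m * (ε⁻¹ * ((1 + ε) ^ (m + 1) - 1))) *
        volume (ball (0 : EuclideanSpace ℝ (Fin (m + 1))) 1) := by
    intro ε hε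
    have h := euclideanHausdorffMeasure_sphere_mul_le m hε
    have h1 : 0 ≤ (1 + ε) ^ (m + 1) - 1 := sub_nonneg.2 (one_le_pow₀ (by linarith))
    rw [ENNReal.ofReal_mul (by positivity), ENNReal.ofReal_mul (by positivity),
      ENNReal.ofReal_pow (by positivity), ENNReal.ofReal_inv_of_pos hε]
    rw [← ENNReal.le_div_iff_mul_le (Or.inl (by simpa using hε)) (Or.inl ENNReal.ofReal_ne_top)]
      at h
    refine h.trans (le_of_eq ?_)
    rw [div_eq_mul_inv]
    ring
  have hd : HasDerivAt (fun x : ℝ => (1 + x) ^ (m + 1)) (m + 1) 0 := by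
    have := ((hasDerivAt_id (0 : ℝ)).const_add 1).fun_pow (m + 1)
    simpa using this
  have ht := (hasDerivAt_iff_tendsto_slope_zero.1 hd).mono_left
    (nhdsWithin_mono (0 : ℝ) (fun x (hx : 0 < x) => hx.ne' : Ioi (0 : ℝ) ⊆ {0}ᶜ))
  have ht2 : Filter.Tendsto (fun x : ℝ => (1 + x) ^ m) (nhdsWithin 0 (Ioi 0)) (nhds 1) := by
    have : ContinuousAt (fun x : ℝ => (1 + x) ^ m) 0 := by fun_prop
    simpa [ContinuousAt] using this.mono_left (nhdsWithin_le_nhds (s := Ioi 0))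
  have ht3 := (ENNReal.continuous_ofReal.tendsto _).comp (ht2.mul ht)
  have ht4 := ENNReal.Tendsto.mul_const (b := volume (ball (0 : EuclideanSpace ℝ (Fin (m + 1))) 1))
    ht3 (Or.inr measure_ball_lt_top.ne)
  have e : ENNReal.ofReal (1 * ((m : ℝ) + 1)) = (m : ℝ≥0∞) + 1 := by
    rw [one_mul, ENNReal.ofReal_add (by positivity) zero_le_one]
    simp
  rw [e] at ht4
  refine ge_of_tendsto ht4 ?_
  filter_upwards [self_mem_nhdsWithin] with ε hε
  have := key ε hε
  simpa using this

theorem euclideanHausdorffMeasure_sphere_radius_le (m : ℕ) {R : ℝ} (hR : 0 < R) :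
    (μHE[m] : Measure (EuclideanSpace ℝ (Fin (m + 1)))) (sphere 0 R) ≤
      ENNReal.ofReal (R ^ m) *
        ((m + 1) * volume (ball (0 : EuclideanSpace ℝ (Fin (m + 1))) 1)) := by
  have e : sphere (0 : EuclideanSpace ℝ (Fin (m + 1))) R = R • sphere 0 1 := by
    rw [_root_.smul_sphere]
    simp [abs_of_pos hR]
    exact zero_le_one
  rw [e, Measure.euclideanHausdorffMeasure_smul₀ _ hR.ne', ENNReal.smul_def, smul_eq_mul]
  refine mul_le_mul ?_ (euclideanHausdorffMeasure_sphere_le m) zero_le zero_le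
  rw [ENNReal.ofReal, ENNReal.coe_le_coe, Real.toNNReal_pow hR.le]
  refine le_of_eq ?_
  congr 1
  ext
  simp [abs_of_pos hR, hR.le]

/-- The unit outer normals to `K` at `z`. -/
def unitNormals {E : Type*} [NormedAddCommGroup E] [InnerProductSpace ℝ E] (K : Set E) (z : E) :
    Set E :=
  {ν | ‖ν‖ = 1 ∧ ∀ w ∈ K, ⟪ν, w - z⟫ ≤ 0}

/-- Projecting out the last coordinate, the points of a compact set at which it has two distinct
supporting graphs form a null set. -/
theorem volume_two_supports_eq_zero {m : ℕ} {C : Set (EuclideanSpace ℝ (Fin m) × ℝ)}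
    (hC : IsCompact C) (k : ℝ≥0) :
    volume {y : EuclideanSpace ℝ (Fin m) | ∃ s, (y, s) ∈ C ∧ ∃ q₁ q₂ : EuclideanSpace ℝ (Fin m),
      q₁ ≠ q₂ ∧ ‖q₁‖ ≤ k ∧ ‖q₂‖ ≤ k ∧ (∀ w ∈ C, w.2 ≤ s + ⟪q₁, w.1 - y⟫) ∧
      (∀ w ∈ C, w.2 ≤ s + ⟪q₂, w.1 - y⟫)} = 0 := by
  rcases C.eq_empty_or_nonempty with rfl | hne
  · simp
  let f : EuclideanSpace ℝ (Fin m) → ℝ := fun y => sSup ((fun w => w.2 - k * ‖y - w.1‖) '' C)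
  have hbdd : ∀ y, BddAbove ((fun w => w.2 - k * ‖y - w.1‖) '' C) := fun y =>
    (hC.image (by fun_prop)).bddAbove
  have hle : ∀ y, ∀ w ∈ C, w.2 - k * ‖y - w.1‖ ≤ f y := fun y w hw =>
    le_csSup (hbdd y) ⟨w, hw, rfl⟩
  have hf : LipschitzWith k f := by
    refine LipschitzWith.of_le_add_mul k fun y z => ?_
    refine csSup_le (hne.image _) ?_
    rintro _ ⟨w, hw, rfl⟩
    have h1 := hle z w hw
    have h2 : ‖z - w.1‖ ≤ ‖y - w.1‖ + dist y z := by
      rw [← dist_eq_norm, ← dist_eq_norm, add_comm, dist_comm y z]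
      exact dist_triangle _ _ _
    have h3 := mul_le_mul_of_nonneg_left h2 k.2
    have : (k : ℝ) * ‖z - w.1‖ ≤ k * (‖y - w.1‖ + dist y z) := h3
    dsimp only
    linarith
  have hae := hf.ae_differentiableAt (μ := volume)
  refine measure_mono_null ?_ hae
  rintro y ⟨s, hs, q₁, q₂, hq, h1, h2, hs1, hs2⟩ hd
  have hfy : ∀ q : EuclideanSpace ℝ (Fin m), ‖q‖ ≤ k → (∀ w ∈ C, w.2 ≤ s + ⟪q, w.1 - y⟫) →
      ∀ z, f z ≤ s + ⟪q, z - y⟫ := by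
    intro q hqk hqs z
    refine csSup_le (hne.image _) ?_
    rintro _ ⟨w, hw, rfl⟩
    have h3 := hqs w hw
    have h4 : ⟪q, w.1 - z⟫ ≤ k * ‖z - w.1‖ := by
      refine (real_inner_le_norm _ _).trans ?_
      rw [norm_sub_rev]
      gcongr
    have h5 : ⟪q, w.1 - y⟫ = ⟪q, w.1 - z⟫ + ⟪q, z - y⟫ := by
      rw [← inner_add_right]; congr 1; abel
    dsimp only
    linarith
  have hys : f y = s := by
    refine le_antisymm (by simpa using hfy q₁ h1 hs1 y) (by simpa using hle y _ hs)
  have hder : ∀ q : EuclideanSpace ℝ (Fin m), ‖q‖ ≤ k → (∀ w ∈ C, w.2 ≤ s + ⟪q, w.1 - y⟫) →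
      fderiv ℝ f y = innerSL ℝ q := by
    intro q hqk hqs
    have hmax : IsLocalMax (fun z => f z - innerSL ℝ q z) y := by
      refine Filter.Eventually.of_forall fun z => ?_
      have := hfy q hqk hqs z
      rw [inner_sub_right] at this
      simp only [innerSL_apply_apply]
      linarith
    have := hmax.hasFDerivAt_eq_zero (hd.hasFDerivAt.sub (innerSL ℝ q).hasFDerivAt)
    exact sub_eq_zero.1 this
  have := (hder q₁ h1 hs1).symm.trans (hder q₂ h2 hs2)
  refine hq (sub_eq_zero.1 ?_)
  have h0 : innerSL ℝ (q₁ - q₂) = 0 := by rw [map_sub, this, sub_self]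
  have h1 : innerSL ℝ (q₁ - q₂) (q₁ - q₂) = 0 := by rw [h0]; rfl
  rwa [innerSL_apply_apply, inner_self_eq_zero] at h1

/-- The singular boundary points of a convex body facing a direction project to a null set. -/
theorem volume_proj_two_normals_eq_zero {m : ℕ} {v : EuclideanSpace ℝ (Fin (m + 1))}
    (hv : ‖v‖ = 1) (A : HyperplaneFrame v) {K : Set (EuclideanSpace ℝ (Fin (m + 1)))}
    (hK : IsCompact K) (hKi : (interior K).Nonempty) :
    volume (A.proj '' {z ∈ K | ∃ ν₁ ∈ unitNormals K z, ∃ ν₂ ∈ unitNormals K z, ν₁ ≠ ν₂ ∧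
      0 < ⟪ν₁, v⟫}) = 0 := by
  set C := A.homeomorph hv ⁻¹' K with hC_def
  have hC : IsCompact C := (A.homeomorph hv).isCompact_preimage.2 hK
  refine measure_mono_null ?_ (measure_iUnion_null fun k : ℕ =>
    volume_two_supports_eq_zero hC (k : ℝ≥0))
  rintro _ ⟨z, ⟨hz, ν₁, ⟨hn1, h1⟩, ν₂, ⟨hn2, h2⟩, hne, ha⟩, rfl⟩
  have key : ∀ ν : EuclideanSpace ℝ (Fin (m + 1)), 0 < ⟪ν, v⟫ → (∀ w ∈ K, ⟪ν, w - z⟫ ≤ 0) →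
      ∀ w ∈ C, w.2 ≤ ⟪z, v⟫ + ⟪-(⟪ν, v⟫⁻¹ • A.proj ν), w.1 - A.proj z⟫ := by
    rintro ν hpos hν ⟨y, s⟩ hw
    have h3 := hν _ hw
    have h4 : A.homeomorph hv (y, s) - z = A.lift (y - A.proj z) + (s - ⟪z, v⟫) • v := by
      conv_lhs => rw [← A.lift_proj_add z]
      simp only [HyperplaneFrame.homeomorph, Homeomorph.homeomorph_mk_coe, Equiv.coe_fn_mk,
        map_sub, sub_smul]
      abel
    have h5 : ⟪ν, A.lift (y - A.proj z)⟫ = ⟪A.proj ν, y - A.proj z⟫ := by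
      conv_lhs => rw [← A.lift_proj_add ν]
      rw [inner_add_left, inner_smul_left, real_inner_comm _ v, A.inner_lift, A.lift.inner_map_map]
      simp
    rw [h4, inner_add_right, h5, inner_smul_right] at h3
    rw [inner_neg_left, inner_smul_left]
    simp only [conj_trivial]
    have h6 : s - ⟪z, v⟫ ≤ -(⟪ν, v⟫⁻¹ * ⟪A.proj ν, y - A.proj z⟫) := by
      rw [inv_mul_eq_div, ← neg_div, le_div_iff₀ hpos]
      linarith
    linarith
  obtain ⟨t, ht, hta⟩ : ∃ t : ℝ, 0 < t ∧ 0 < ⟪ν₁ + t • ν₂, v⟫ := by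
    simp only [inner_add_left, inner_smul_left, conj_trivial]
    refine ⟨⟪ν₁, v⟫ / (2 * (|⟪ν₂, v⟫| + 1)), by positivity, ?_⟩
    have h3 := neg_abs_le ⟪ν₂, v⟫
    have h4 : ⟪ν₁, v⟫ / (2 * (|⟪ν₂, v⟫| + 1)) * |⟪ν₂, v⟫| ≤ ⟪ν₁, v⟫ / 2 := by
      rw [div_mul_eq_mul_div, div_le_div_iff₀ (by positivity) (by positivity)]
      nlinarith [abs_nonneg ⟪ν₂, v⟫]
    have h5 : 0 ≤ ⟪ν₁, v⟫ / (2 * (|⟪ν₂, v⟫| + 1)) := by positivity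
    nlinarith
  set q₁ := -(⟪ν₁, v⟫⁻¹ • A.proj ν₁)
  set q₂ := -(⟪ν₁ + t • ν₂, v⟫⁻¹ • A.proj (ν₁ + t • ν₂))
  obtain ⟨k, hk⟩ := exists_nat_ge (max ‖q₁‖ ‖q₂‖)
  refine mem_iUnion.2 ⟨k, ⟪z, v⟫, ?_, q₁, q₂, ?_, ?_, ?_, key ν₁ ha h1, key _ hta ?_⟩
  · change A.lift _ + ⟪z, v⟫ • v ∈ K
    rwa [A.lift_proj_add]
  · intro hq
    have hq' : ⟪ν₁, v⟫⁻¹ • A.proj ν₁ = ⟪ν₁ + t • ν₂, v⟫⁻¹ • A.proj (ν₁ + t • ν₂) := neg_inj.1 hq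
    set a := ⟪ν₁, v⟫ with ha_def
    set b := ⟪ν₂, v⟫ with hb_def
    have hab : ⟪ν₁ + t • ν₂, v⟫ = a + t * b := by simp [inner_add_left, inner_smul_left, a, b]
    rw [hab] at hq' hta
    have e1 : (a + t * b) • A.proj ν₁ = a • A.proj (ν₁ + t • ν₂) := by
      have := congrArg (fun q => (a * (a + t * b)) • q) hq'
      simp only [smul_smul] at this
      rwa [mul_right_comm, mul_inv_cancel₀ ha.ne', one_mul, mul_assoc,
        mul_inv_cancel₀ hta.ne', mul_one] at this
    have e2 : b • A.proj ν₁ = a • A.proj ν₂ := by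
      rw [map_add, map_smul, add_smul, smul_add, mul_smul, smul_comm a t] at e1
      exact smul_right_injective _ ht.ne' (add_left_cancel e1)
    have e3 : b • ν₁ = a • ν₂ := by
      calc b • ν₁ = A.lift (b • A.proj ν₁) + b • a • v := by
            rw [map_smul, ← smul_add, ha_def, A.lift_proj_add]
        _ = A.lift (a • A.proj ν₂) + a • b • v := by rw [e2, smul_comm a b]
        _ = a • ν₂ := by rw [map_smul, ← smul_add, hb_def, A.lift_proj_add]
    have e4 : |b| = a := by
      have := congrArg norm e3
      rwa [norm_smul, norm_smul, hn1, hn2, mul_one, mul_one, Real.norm_eq_abs, Real.norm_eq_abs,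
        abs_of_pos ha] at this
    rcases abs_eq ha.le |>.1 e4 with h | h
    · rw [h] at e3
      exact hne (smul_right_injective _ ha.ne' e3)
    · rw [h, neg_smul, ← smul_neg] at e3
      have e5 : -ν₁ = ν₂ := smul_right_injective _ ha.ne' e3
      obtain ⟨w, hw⟩ := hKi
      obtain ⟨δ, hδ, hball⟩ := Metric.isOpen_iff.1 isOpen_interior w hw
      have hw2 : w + (δ / 2) • ν₁ ∈ K := interior_subset (hball (by
        rw [mem_ball, dist_eq_norm, add_sub_cancel_left, norm_smul, hn1, Real.norm_eq_abs,
          abs_of_pos (by positivity)]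
        linarith))
      have f1 := h1 _ hw2
      have f2 := h2 _ (interior_subset hw)
      rw [← e5, inner_neg_left] at f2
      rw [add_sub_right_comm, inner_add_right, inner_smul_right, real_inner_self_eq_norm_sq,
        hn1] at f1
      linarith
  · exact_mod_cast (le_max_left _ _).trans hk
  · exact_mod_cast (le_max_right _ _).trans hk
  · intro w hw
    rw [inner_add_left, inner_smul_left]
    have := mul_nonneg_of_nonpos_of_nonpos (h2 w hw) (neg_nonpos.2 ht.le)
    simp only [conj_trivial]
    linarith [h1 w hw]

/-- `π` is the nearest-point projection onto the convex set `K`. -/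
def IsMetricProj {E : Type*} [NormedAddCommGroup E] [InnerProductSpace ℝ E] (K : Set E)
    (π : E → E) : Prop :=
  (∀ x, π x ∈ K) ∧ ∀ x, ∀ w ∈ K, ⟪x - π x, w - π x⟫ ≤ 0

namespace IsMetricProj

variable {E : Type*} [NormedAddCommGroup E] [InnerProductSpace ℝ E] {K : Set E} {π : E → E}

theorem exists_of_isCompact (hK : IsCompact K) (hc : Convex ℝ K) (hne : K.Nonempty) :
    ∃ π, IsMetricProj K π := by
  have : ∀ u : E, ∃ z ∈ K, ∀ w ∈ K, ⟪u - z, w - z⟫ ≤ 0 := fun u => by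
    obtain ⟨z, hz, h⟩ := exists_norm_eq_iInf_of_complete_convex hne hK.isComplete hc u
    exact ⟨z, hz, (norm_eq_iInf_iff_real_inner_le_zero hc hz).1 h⟩
  choose π h1 h2 using this
  exact ⟨π, h1, h2⟩

theorem lipschitzWith (h : IsMetricProj K π) : LipschitzWith 1 π := by
  refine LipschitzWith.of_dist_le_mul fun x y => ?_
  rw [NNReal.coe_one, one_mul, dist_eq_norm, dist_eq_norm]
  have h1 := h.2 x (π y) (h.1 y)
  have h2 := h.2 y (π x) (h.1 x)
  have h3 : ‖π x - π y‖ ^ 2 ≤ ⟪x - y, π x - π y⟫ := by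
    rw [← real_inner_self_eq_norm_sq]
    simp only [inner_sub_left, inner_sub_right] at *
    linarith
  have h4 := h3.trans (real_inner_le_norm _ _)
  by_contra! hlt
  nlinarith [norm_nonneg (x - y)]

theorem norm_sub_le (h : IsMetricProj K π) (x : E) {w : E} (hw : w ∈ K) :
    ‖x - π x‖ ≤ ‖x - w‖ := by
  have h1 := h.2 x w hw
  have h2 : ‖x - π x‖ ^ 2 ≤ ⟪x - π x, x - w⟫ := by
    rw [← real_inner_self_eq_norm_sq]
    simp only [inner_sub_left, inner_sub_right] at *
    linarith
  have h4 := h2.trans (real_inner_le_norm _ _)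
  by_contra! hlt
  nlinarith [norm_nonneg (x - w)]

theorem eq_self (h : IsMetricProj K π) {x : E} (hx : x ∈ K) : π x = x := by
  have := h.norm_sub_le x hx
  rw [sub_self, norm_zero, norm_le_zero_iff, sub_eq_zero] at this
  exact this.symm

theorem norm_sub_pos_iff (h : IsMetricProj K π) {x : E} : 0 < ‖x - π x‖ ↔ x ∉ K := by
  rw [norm_pos_iff, sub_ne_zero]
  exact ⟨fun hx hxK => hx (h.eq_self hxK).symm, fun hx hxx => hx (hxx ▸ h.1 x)⟩

theorem normalize_mem_unitNormals (h : IsMetricProj K π) {x : E} (hx : 0 < ‖x - π x‖) :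
    ‖x - π x‖⁻¹ • (x - π x) ∈ unitNormals K (π x) := by
  refine ⟨by rw [norm_smul, norm_inv, norm_norm, inv_mul_cancel₀ hx.ne'], fun w hw => ?_⟩
  rw [inner_smul_left]
  exact mul_nonpos_of_nonneg_of_nonpos (by simp) (h.2 x w hw)

theorem mem_frontier (h : IsMetricProj K π) {x : E} (hx : x ∉ K) : π x ∈ frontier K := by
  refine ⟨subset_closure (h.1 x), fun hi => ?_⟩
  have hpos := h.norm_sub_pos_iff.2 hx
  obtain ⟨hn1, hn2⟩ := h.normalize_mem_unitNormals hpos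
  set ν := ‖x - π x‖⁻¹ • (x - π x)
  obtain ⟨δ, hδ, hball⟩ := Metric.isOpen_iff.1 isOpen_interior _ hi
  have hw : π x + (δ / 2) • ν ∈ K := interior_subset (hball (by
    rw [mem_ball, dist_eq_norm, add_sub_cancel_left, norm_smul, hn1, Real.norm_eq_abs,
      abs_of_pos (by positivity)]
    linarith))
  have := hn2 _ hw
  rw [add_sub_cancel_left, inner_smul_right, real_inner_self_eq_norm_sq, hn1] at this
  linarith

end IsMetricProj

theorem isClosed_forall_imp {X Y : Type*} [TopologicalSpace X] {P : X → Y → Prop}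
    {Q : Y → Prop} (h : ∀ w, Q w → IsClosed {x | P x w}) : IsClosed {x | ∀ w, Q w → P x w} := by
  have : {x | ∀ w, Q w → P x w} = ⋂ w, ⋂ (_ : Q w), {x | P x w} := by ext; simp
  rw [this]
  exact isClosed_iInter fun w => isClosed_iInter fun hw => h w hw

theorem isCompact_exists_unitNormals {E : Type*} [NormedAddCommGroup E] [InnerProductSpace ℝ E]
    [ProperSpace E] (K : Set E) {B D : Set E} (hB : IsCompact B) (hD : IsClosed D) :
    IsCompact {z ∈ B | ∃ ν ∈ unitNormals K z, ν ∈ D} := by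
  have hc : IsClosed {q : E × E | (∀ w ∈ K, ⟪q.2, w - q.1⟫ ≤ 0) ∧ q.2 ∈ D} := by
    exact (isClosed_forall_imp fun w _ => isClosed_le (by fun_prop) continuous_const).and
      (hD.preimage continuous_snd)
  have := ((hB.prod (isCompact_sphere (0 : E) 1)).inter_right hc).image continuous_fst
  convert this using 1
  ext z
  simp only [mem_ofPred_eq, mem_image, mem_inter_iff, mem_prod, mem_sphere_zero_iff_norm,
    Prod.exists, exists_and_right, exists_eq_right, unitNormals]
  constructor
  · rintro ⟨h1, ν, ⟨h2, h3⟩, h4⟩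
    exact ⟨ν, ⟨h1, h2⟩, h3, h4⟩
  · rintro ⟨ν, ⟨h1, h2⟩, h3, h4⟩
    exact ⟨h1, ν, ⟨h2, h3⟩, h4⟩

theorem measurableSet_exists_unitNormals_lt {E : Type*} [NormedAddCommGroup E]
    [InnerProductSpace ℝ E] [ProperSpace E] [MeasurableSpace E] [BorelSpace E] (K : Set E)
    {B : Set E} (hB : IsCompact B) (v : E) (c : ℝ) :
    MeasurableSet {z ∈ B | ∃ ν ∈ unitNormals K z, c < ⟪ν, v⟫} := by
  have : {z ∈ B | ∃ ν ∈ unitNormals K z, c < ⟪ν, v⟫} =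
      ⋃ k : ℕ, {z ∈ B | ∃ ν ∈ unitNormals K z, ν ∈ {ν | c + 1 / (k + 1) ≤ ⟪ν, v⟫}} := by
    ext z
    simp only [mem_ofPred_eq, mem_iUnion]
    constructor
    · rintro ⟨h1, ν, h2, h3⟩
      obtain ⟨k, hk⟩ := exists_nat_one_div_lt (sub_pos.2 h3)
      exact ⟨k, h1, ν, h2, by linarith⟩
    · rintro ⟨k, h1, ν, h2, h3⟩
      have : (0 : ℝ) < 1 / (k + 1) := by positivity
      exact ⟨h1, ν, h2, by linarith⟩
  rw [this]
  exact MeasurableSet.iUnion fun k => (isCompact_exists_unitNormals K hB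
    (isClosed_le continuous_const (by fun_prop))).measurableSet

theorem exists_measure_level_unitNormals_eq_zero {E : Type*} [NormedAddCommGroup E]
    [InnerProductSpace ℝ E] [ProperSpace E] [MeasurableSpace E] [BorelSpace E] (K : Set E)
    {B : Set E} (hB : IsCompact B) {μ : Measure E} (hμ : μ B ≠ ∞) (v : ℕ → E) {a b : ℝ}
    (hab : a < b) :
    ∃ c ∈ Ioo a b, ∀ j, μ ({z ∈ B | ∃ ν ∈ unitNormals K z, c ≤ ⟪ν, v j⟫} \
      {z ∈ B | ∃ ν ∈ unitNormals K z, c < ⟪ν, v j⟫}) = 0 := by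
  have hfin : IsFiniteMeasure (μ.restrict B) := ⟨by simpa using hμ.lt_top⟩
  let Z : ℕ → ℝ → Set E := fun j c => {z ∈ B | ∃ ν ∈ unitNormals K z, c ≤ ⟪ν, v j⟫} \
      {z ∈ B | ∃ ν ∈ unitNormals K z, c < ⟪ν, v j⟫}
  have hZ : ∀ j c, MeasurableSet (Z j c) := fun j c =>
    (isCompact_exists_unitNormals K hB (D := {ν | c ≤ ⟪ν, v j⟫})
      (isClosed_le continuous_const (by fun_prop))).measurableSet.diff
      (measurableSet_exists_unitNormals_lt K hB (v j) c)
  have hlt : ∀ j c c', c < c' → Disjoint (Z j c) (Z j c') := fun j c c' h =>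
    disjoint_left.2 fun z hz hz' => hz.2
      ⟨hz.1.1, hz'.1.2.imp fun ν hν => ⟨hν.1, h.trans_le hν.2⟩⟩
  have hcount : (⋃ j, {c | 0 < μ.restrict B (Z j c)}).Countable :=
    countable_iUnion fun j => Measure.countable_meas_pos_of_disjoint_iUnion (hZ j)
      fun c c' hcc' => (lt_or_gt_of_ne hcc').elim (hlt j c c') fun h => (hlt j c' c h).symm
  obtain ⟨c, hc, hc'⟩ := (hcount.dense_compl ℝ).exists_mem_open isOpen_Ioo (nonempty_Ioo.2 hab)
  refine ⟨c, hc', fun j => ?_⟩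
  have : μ.restrict B (Z j c) = 0 := by
    by_contra h
    exact hc (mem_iUnion.2 ⟨j, pos_iff_ne_zero.2 h⟩)
  rwa [Measure.restrict_apply (hZ j c), inter_eq_left.2 fun z hz => hz.1.1] at this

theorem volume_layer_cap_le {m : ℕ} {v : EuclideanSpace ℝ (Fin (m + 1))} (hv : ‖v‖ = 1)
    (A : HyperplaneFrame v) {K : Set (EuclideanSpace ℝ (Fin (m + 1)))}
    {π : EuclideanSpace ℝ (Fin (m + 1)) → EuclideanSpace ℝ (Fin (m + 1))} (hπ : IsMetricProj K π)
    {B D : Set (EuclideanSpace ℝ (Fin (m + 1)))} (hB : IsCompact B) (hD : IsClosed D) {c : ℝ}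
    (hc : 0 < c) (hDc : ∀ ν ∈ D, c ≤ ⟪ν, v⟫) (ε : ℝ) :
    volume {x | 0 < ‖x - π x‖ ∧ ‖x - π x‖ < ε ∧ π x ∈ B ∧ ‖x - π x‖⁻¹ • (x - π x) ∈ D} ≤
      ENNReal.ofReal (ε / c) *
        volume (cthickening ε (A.proj '' {z ∈ B | ∃ ν ∈ unitNormals K z, ν ∈ D})) := by
  have hπm : Measurable π := hπ.lipschitzWith.continuous.measurable
  refine A.volume_le_of_diam_fiber_le hv ?_ isClosed_cthickening.measurableSet ?_ ?_
  · have h1 : Measurable fun x => ‖x - π x‖⁻¹ • (x - π x) := by fun_prop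
    have h2 : Measurable fun x => ‖x - π x‖ := by fun_prop
    exact (measurableSet_lt measurable_const h2).inter ((measurableSet_lt h2
      measurable_const).inter ((hπm hB.measurableSet).inter (h1 hD.measurableSet)))
  · rintro x ⟨h1, h2, h3, h4⟩
    refine mem_cthickening_of_dist_le _ (A.proj (π x)) _ _
      ⟨π x, ⟨h3, _, hπ.normalize_mem_unitNormals h1, h4⟩, rfl⟩ ?_
    calc dist (A.proj x) (A.proj (π x)) ≤ dist x (π x) := by
          simpa using (A.lipschitzWith_proj hv).dist_le_mul x (π x)
      _ ≤ ε := by rw [dist_eq_norm]; exact h2.le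
  · rintro y s t ⟨-, hs2, -, -⟩ ⟨ht1, -, -, ht4⟩
    rw [le_div_iff₀ hc]
    set x := A.lift y + s • v with hx
    set x' := A.lift y + t • v with hx'
    rcases le_total s t with hst | hst
    · nlinarith [norm_nonneg (x - π x)]
    obtain ⟨hn, hν⟩ := hπ.normalize_mem_unitNormals ht1
    have h5 := hν _ (hπ.1 x)
    have h7 : ⟪‖x' - π x'‖⁻¹ • (x' - π x'), x' - π x'⟫ = ‖x' - π x'‖ := by
      rw [inner_smul_left, real_inner_self_eq_norm_sq, conj_trivial]
      field_simp
    have h6 := hDc _ ht4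
    set ν := ‖x' - π x'‖⁻¹ • (x' - π x')
    have h8 : x - π x = (s - t) • v + (x' - π x') - (π x - π x') := by
      rw [hx, hx', sub_smul]; abel
    have h9 : ⟪ν, x - π x⟫ ≤ ‖x - π x‖ := by
      simpa [hn] using real_inner_le_norm ν (x - π x)
    rw [h8, inner_sub_right, inner_add_right, inner_smul_right, ← h8, h7] at h9
    nlinarith

/-- The part of the outer parallel layer of width `ε` over a compact set of boundary points has
volume at most about `ε` times the area of that set. -/
theorem eventually_volume_layer_le {m : ℕ} {K : Set (EuclideanSpace ℝ (Fin (m + 1)))}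
    {π : EuclideanSpace ℝ (Fin (m + 1)) → EuclideanSpace ℝ (Fin (m + 1))} (hπ : IsMetricProj K π)
    (hK : IsCompact K) (hKi : (interior K).Nonempty)
    {B : Set (EuclideanSpace ℝ (Fin (m + 1)))} (hB : IsCompact B) (hBK : B ⊆ K) {a : ℝ≥0∞}
    (ha : (μHE[m] : Measure (EuclideanSpace ℝ (Fin (m + 1)))) B < a) :
    ∀ᶠ ε in nhdsWithin (0 : ℝ) (Ioi 0),
      volume {x | 0 < ‖x - π x‖ ∧ ‖x - π x‖ < ε ∧ π x ∈ B} ≤ ENNReal.ofReal ε * a := by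
  set σ : Measure (EuclideanSpace ℝ (Fin (m + 1))) := μHE[m] with hσ
  obtain ⟨c₀, hc₀, hc₀1, hc₀a⟩ : ∃ c₀ : ℝ, 0 < c₀ ∧ c₀ < 1 ∧
      ∀ c, c₀ < c → ENNReal.ofReal c⁻¹ * σ B < a := by
    have h1 : Filter.Tendsto (fun c : ℝ => ENNReal.ofReal c⁻¹ * σ B) (nhdsWithin 1 (Iio 1))
        (nhds (ENNReal.ofReal 1⁻¹ * σ B)) := by
      refine ENNReal.Tendsto.mul_const ?_ (Or.inr ha.ne_top)
      refine (ENNReal.continuous_ofReal.tendsto _).comp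
        ((tendsto_inv₀ one_ne_zero).mono_left nhdsWithin_le_nhds)
    have h2 := (h1.eventually (gt_mem_nhds (show _ < a by simpa using ha))).and
      (Ioo_mem_nhdsLT (zero_lt_one' ℝ))
    obtain ⟨c, hc, hc'⟩ := h2.exists
    refine ⟨c, hc'.1, hc'.2, fun d hd => lt_of_le_of_lt ?_ hc⟩
    gcongr
    exact hc'.1
  obtain ⟨N, v, hv, hN⟩ := exists_unit_net m (c := (c₀ + 1) / 2) (by linarith)
  obtain ⟨c, hc, hnull⟩ := exists_measure_level_unitNormals_eq_zero K hB (μ := σ) ha.ne_top v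
    (show c₀ < (c₀ + 1) / 2 by linarith)
  have hc0 : 0 < c := hc₀.trans hc.1
  let D : ℕ → Set (EuclideanSpace ℝ (Fin (m + 1))) := fun i =>
    {ν | c ≤ ⟪ν, v i⟫ ∧ ∀ j < i, ⟪ν, v j⟫ ≤ c}
  have hD : ∀ i, IsClosed (D i) := fun i => by
    exact (isClosed_le continuous_const (by fun_prop)).and
      (isClosed_forall_imp fun w _ => isClosed_le (by fun_prop) continuous_const)
  let Z : ℕ → Set (EuclideanSpace ℝ (Fin (m + 1))) := fun i =>
    {z ∈ B | ∃ ν ∈ unitNormals K z, ν ∈ D i}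
  have hZ : ∀ i, IsCompact (Z i) := fun i => isCompact_exists_unitNormals K hB (hD i)
  let A : ∀ i, HyperplaneFrame (v i) := fun i => (HyperplaneFrame.nonempty (hv i)).some
  have hPZ : ∀ i, volume ((A i).proj '' Z i) ≤ σ (disjointed Z i) := by
    intro i
    have hproj : ∀ S : Set (EuclideanSpace ℝ (Fin (m + 1))),
        volume ((A i).proj '' S) ≤ σ S := fun S => by
      have := ((A i).lipschitzWith_proj (hv i)).lipschitzOnWith.euclideanHausdorffMeasure_image_le
        (s := S) m
      rwa [EuclideanSpace.euclideanHausdorffMeasure_eq_volume, ENNReal.coe_one, one_pow,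
        one_mul] at this
    let T : Set (EuclideanSpace ℝ (Fin (m + 1))) :=
      {z ∈ K | ∃ ν₁ ∈ unitNormals K z, ∃ ν₂ ∈ unitNormals K z, ν₁ ≠ ν₂ ∧
      0 < ⟪ν₁, v i⟫}
    let W : ℕ → Set (EuclideanSpace ℝ (Fin (m + 1))) := fun j =>
      {z ∈ B | ∃ ν ∈ unitNormals K z, c ≤ ⟪ν, v j⟫} \
      {z ∈ B | ∃ ν ∈ unitNormals K z, c < ⟪ν, v j⟫}
    have hsub : Z i ⊆ disjointed Z i ∪ (T ∪ ⋃ j, W j) := by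
      intro z hz
      by_cases hzd : z ∈ disjointed Z i
      · exact Or.inl hzd
      right
      have : ∃ j < i, z ∈ Z j := by
        by_contra! hcon
        refine hzd ?_
        rw [disjointed_eq_inter_compl]
        exact ⟨hz, by simpa using hcon⟩
      obtain ⟨j, hji, hzB, ν', hν', hνD'⟩ := this
      obtain ⟨-, ν, hν, hνD⟩ := hz
      have hpos : 0 < ⟪ν, v i⟫ := hc0.trans_le hνD.1
      by_cases hzT : z ∈ T
      · exact Or.inl hzT
      refine Or.inr (mem_iUnion.2 ⟨j, ⟨hzB, ν', hν', hνD'.1⟩, ?_⟩)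
      rintro ⟨-, ν'', hν'', hlt⟩
      refine hzT ⟨hBK hzB, ν, hν, ν'', hν'', ?_, hpos⟩
      rintro rfl
      exact absurd (hνD.2 j hji) (not_le.2 hlt)
    calc volume ((A i).proj '' Z i)
        ≤ volume ((A i).proj '' (disjointed Z i ∪ (T ∪ ⋃ j, W j))) :=
          measure_mono (image_mono hsub)
      _ ≤ volume ((A i).proj '' disjointed Z i) + (volume ((A i).proj '' T) +
          volume ((A i).proj '' ⋃ j, W j)) := by
          rw [image_union, image_union]
          exact (measure_union_le _ _).trans (add_le_add le_rfl (measure_union_le _ _))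
      _ ≤ σ (disjointed Z i) + (0 + 0) := by
          refine add_le_add (hproj _) (add_le_add ?_ ?_)
          · exact (volume_proj_two_normals_eq_zero (hv i) (A i) hK hKi).le
          · exact (hproj _).trans (measure_iUnion_null hnull).le
      _ = _ := by simp
  have hsum : ∑ i ∈ Finset.range N, volume ((A i).proj '' Z i) ≤ σ B := by
    calc _ ≤ ∑ i ∈ Finset.range N, σ (disjointed Z i) := Finset.sum_le_sum fun i _ => hPZ i
      _ = σ (⋃ i ∈ Finset.range N, disjointed Z i) := by
          rw [measure_biUnion_finset]
          · exact fun i _ j _ hij => disjoint_disjointed Z hij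
          · exact fun i _ => MeasurableSet.disjointed (fun i => (hZ i).measurableSet) i
      _ ≤ σ B := measure_mono (iUnion₂_subset fun i _ =>
          (disjointed_subset Z i).trans fun z hz => hz.1)
  have hlim : Filter.Tendsto (fun ε : ℝ => ENNReal.ofReal c⁻¹ * ∑ i ∈ Finset.range N,
      volume (cthickening ε ((A i).proj '' Z i))) (nhdsWithin 0 (Ioi 0))
      (nhds (ENNReal.ofReal c⁻¹ * ∑ i ∈ Finset.range N, volume ((A i).proj '' Z i))) := by
    refine ENNReal.Tendsto.const_mul ?_ (Or.inr ENNReal.ofReal_ne_top)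
    refine tendsto_finsetSum _ fun i _ => ?_
    exact (tendsto_measure_cthickening_of_isCompact
      ((hZ i).image (A i).proj.continuous)).mono_left nhdsWithin_le_nhds
  have hlt : ENNReal.ofReal c⁻¹ * ∑ i ∈ Finset.range N, volume ((A i).proj '' Z i) < a :=
    lt_of_le_of_lt (by gcongr) (hc₀a c hc.1)
  filter_upwards [hlim.eventually (gt_mem_nhds hlt), self_mem_nhdsWithin] with ε hε hε0
  have hcov : {x | 0 < ‖x - π x‖ ∧ ‖x - π x‖ < ε ∧ π x ∈ B} ⊆ ⋃ i ∈ Finset.range N,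
      {x | 0 < ‖x - π x‖ ∧ ‖x - π x‖ < ε ∧ π x ∈ B ∧ ‖x - π x‖⁻¹ • (x - π x) ∈ D i} := by
    rintro x ⟨h1, h2, h3⟩
    obtain ⟨i, hiN, hi⟩ := hN _ (hπ.normalize_mem_unitNormals h1).1
    have hex : ∃ i, c ≤ ⟪‖x - π x‖⁻¹ • (x - π x), v i⟫ := ⟨i, (hc.2.trans hi).le⟩
    classical
    refine mem_iUnion₂.2 ⟨Nat.find hex, ?_, h1, h2, h3, Nat.find_spec hex, fun j hj => ?_⟩
    · exact Finset.mem_range.2 ((Nat.find_min' hex (hc.2.trans hi).le).trans_lt hiN)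
    · exact (not_le.1 (Nat.find_min hex hj)).le
  calc _ ≤ ∑ i ∈ Finset.range N, volume {x | 0 < ‖x - π x‖ ∧ ‖x - π x‖ < ε ∧ π x ∈ B ∧
          ‖x - π x‖⁻¹ • (x - π x) ∈ D i} :=
        (measure_mono hcov).trans (measure_biUnion_finset_le _ _)
    _ ≤ ∑ i ∈ Finset.range N, ENNReal.ofReal (ε / c) *
          volume (cthickening ε ((A i).proj '' Z i)) := Finset.sum_le_sum fun i _ =>
        volume_layer_cap_le (hv i) (A i) hπ hB (hD i) hc0 (fun ν hν => hν.1) ε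
    _ = ENNReal.ofReal ε * (ENNReal.ofReal c⁻¹ * ∑ i ∈ Finset.range N,
          volume (cthickening ε ((A i).proj '' Z i))) := by
        rw [← Finset.mul_sum, div_eq_mul_inv, ENNReal.ofReal_mul (le_of_lt hε0), mul_assoc]
    _ ≤ _ := by gcongr

theorem sum_staircase_le {t : ℝ} (η : ℝ) (ht : 0 ≤ t) (M : ℕ) :
    ∑ j ∈ Finset.range M, (if (j + 1) * η ≤ t then η else 0) ≤ min t (M * η) := by
  induction M with
  | zero => simpa using ht
  | succ M ih =>
    rw [Finset.sum_range_succ]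
    push_cast
    obtain ⟨h1, h2⟩ := le_min_iff.1 ih
    split_ifs with h
    · exact le_min (by nlinarith) (by nlinarith)
    · exact le_min (by linarith) (by nlinarith)

theorem min_le_add_sum_staircase (t η : ℝ) (M : ℕ) :
    min t ((M + 1) * η) ≤ η + ∑ j ∈ Finset.range M, (if (j + 1) * η ≤ t then η else 0) := by
  induction M with
  | zero => simp
  | succ M ih =>
    rw [Finset.sum_range_succ]
    push_cast
    split_ifs with h
    · rw [min_eq_right h] at ih
      exact (min_le_right _ _).trans (by nlinarith)
    · rw [min_eq_left (not_le.1 h).le] at ih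
      exact (min_le_left _ _).trans (by linarith)

theorem exists_pos_sum_mul_add_lt {ι : Type*} (s : Finset ι) (c : ℝ≥0∞) (hc : c ≠ ∞)
    (μ : ι → ℝ≥0∞) {a : ℝ≥0∞} (h : ∑ i ∈ s, c * μ i < a) :
    ∃ δ : ℝ≥0∞, 0 < δ ∧ ∑ i ∈ s, c * (μ i + δ) < a := by
  have ht : Filter.Tendsto (fun δ : ℝ≥0∞ => ∑ i ∈ s, c * (μ i + δ)) (nhdsWithin 0 (Ioi 0))
      (nhds (∑ i ∈ s, c * (μ i + 0))) := by
    refine tendsto_finsetSum _ fun i _ => ENNReal.Tendsto.const_mul ?_ (Or.inr hc)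
    exact (tendsto_const_nhds.add Filter.tendsto_id).mono_left nhdsWithin_le_nhds
  have := (ht.eventually (gt_mem_nhds (by simpa using h))).and self_mem_nhdsWithin
  obtain ⟨δ, h1, h2⟩ := this.exists
  exact ⟨δ, h2, h1⟩

/-- Integrals over thin outer parallel layers are asymptotically bounded by boundary integrals. -/
theorem eventually_lintegral_layer_le {m : ℕ} {K : Set (EuclideanSpace ℝ (Fin (m + 1)))}
    {π : EuclideanSpace ℝ (Fin (m + 1)) → EuclideanSpace ℝ (Fin (m + 1))} (hπ : IsMetricProj K π)
    (hK : IsCompact K) (hKi : (interior K).Nonempty)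
    (hfin : (μHE[m] : Measure (EuclideanSpace ℝ (Fin (m + 1)))) (frontier K) ≠ ∞)
    {g : EuclideanSpace ℝ (Fin (m + 1)) → ℝ} (hg : Continuous g) (hg0 : ∀ x, 0 ≤ g x) {a : ℝ≥0∞}
    (ha : ∫⁻ z in frontier K, ENNReal.ofReal (g z) ∂μHE[m] < a) :
    ∀ᶠ ε in nhdsWithin (0 : ℝ) (Ioi 0),
      ∫⁻ x in {x | 0 < ‖x - π x‖ ∧ ‖x - π x‖ < ε}, ENNReal.ofReal (g (π x)) ≤
        ENNReal.ofReal ε * a := by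
  set σ : Measure (EuclideanSpace ℝ (Fin (m + 1))) := μHE[m] with hσ
  have hFc : IsCompact (frontier K) :=
    hK.of_isClosed_subset isClosed_frontier hK.isClosed.frontier_subset
  have hπc : Continuous π := hπ.lipschitzWith.continuous
  obtain ⟨η, hη0, hη⟩ : ∃ η : ℝ, 0 < η ∧
      ENNReal.ofReal η * σ (frontier K) + ∫⁻ z in frontier K, ENNReal.ofReal (g z) ∂σ < a := by
    have ht : Filter.Tendsto (fun η : ℝ => ENNReal.ofReal η * σ (frontier K) +
        ∫⁻ z in frontier K, ENNReal.ofReal (g z) ∂σ) (nhdsWithin 0 (Ioi 0))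
        (nhds (ENNReal.ofReal 0 * σ (frontier K) +
        ∫⁻ z in frontier K, ENNReal.ofReal (g z) ∂σ)) := by
      refine Filter.Tendsto.add (ENNReal.Tendsto.mul_const ?_ (Or.inr hfin)) tendsto_const_nhds
      exact (ENNReal.continuous_ofReal.tendsto _).mono_left nhdsWithin_le_nhds
    have := (ht.eventually (gt_mem_nhds (by simpa using ha))).and self_mem_nhdsWithin
    obtain ⟨δ, h1, h2⟩ := this.exists
    exact ⟨δ, h2, h1⟩
  obtain ⟨M, hM⟩ : ∃ M : ℕ, ∀ z ∈ frontier K, g z ≤ (M + 1) * η := by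
    obtain ⟨b, hb⟩ := (hFc.image hg).bddAbove
    obtain ⟨M, hM⟩ := exists_nat_ge (b / η)
    refine ⟨M, fun z hz => (hb ⟨z, hz, rfl⟩).trans ?_⟩
    rw [div_le_iff₀ hη0] at hM
    linarith
  let B : ℕ → Set (EuclideanSpace ℝ (Fin (m + 1))) := fun j =>
    frontier K ∩ {z | j * η ≤ g z}
  have hBcl : ∀ j : ℕ, IsClosed {z | j * η ≤ g z} := fun j => isClosed_le continuous_const hg
  have hB : ∀ j, IsCompact (B j) := fun j => hFc.inter_right (hBcl j)
  have hB0 : B 0 = frontier K := by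
    simp only [B, Nat.cast_zero, zero_mul, hg0, ofPred_true, inter_univ]
  have hlow : ∑ j ∈ Finset.range (M + 1), ENNReal.ofReal η * σ (B j) < a := by
    rw [Finset.sum_range_succ', hB0, add_comm]
    refine lt_of_le_of_lt ?_ hη
    gcongr
    calc ∑ j ∈ Finset.range M, ENNReal.ofReal η * σ (B (j + 1))
        = ∑ j ∈ Finset.range M, ∫⁻ z in frontier K,
            {z | ((j + 1 : ℕ) : ℝ) * η ≤ g z}.indicator (fun _ => ENNReal.ofReal η) z ∂σ := by
          refine Finset.sum_congr rfl fun j _ => ?_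
          rw [lintegral_indicator_const (hBcl _).measurableSet,
            Measure.restrict_apply (hBcl _).measurableSet, inter_comm]
      _ = ∫⁻ z in frontier K, ∑ j ∈ Finset.range M,
            {z | ((j + 1 : ℕ) : ℝ) * η ≤ g z}.indicator (fun _ => ENNReal.ofReal η) z ∂σ := by
          rw [lintegral_finsetSum]
          exact fun j _ => measurable_const.indicator (hBcl _).measurableSet
      _ ≤ _ := by
          refine lintegral_mono fun z => ?_
          have h := (sum_staircase_le η (hg0 z) M).trans (min_le_left _ _)
          refine le_trans (le_of_eq ?_) (ENNReal.ofReal_le_ofReal h)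
          rw [ENNReal.ofReal_sum_of_nonneg]
          · refine Finset.sum_congr rfl fun j _ => ?_
            simp only [indicator, mem_ofPred_eq, Nat.cast_add, Nat.cast_one]
            split_ifs <;> simp
          · intro j _
            split_ifs <;> simp [hη0.le]
  obtain ⟨δ, hδ, hδa⟩ := exists_pos_sum_mul_add_lt (Finset.range (M + 1)) (ENNReal.ofReal η)
    ENNReal.ofReal_ne_top (fun j => σ (B j)) hlow
  have hev : ∀ᶠ ε in nhdsWithin (0 : ℝ) (Ioi 0), ∀ j ∈ Finset.range (M + 1),
      volume {x | 0 < ‖x - π x‖ ∧ ‖x - π x‖ < ε ∧ π x ∈ B j} ≤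
        ENNReal.ofReal ε * (σ (B j) + δ) := by
    rw [Filter.eventually_all_finset]
    intro j _
    refine eventually_volume_layer_le hπ hK hKi (hB j)
      (inter_subset_left.trans hK.isClosed.frontier_subset) ?_
    exact ENNReal.lt_add_right (measure_ne_top_of_subset inter_subset_left hfin) hδ.ne'
  filter_upwards [hev] with ε hε
  set L := {x | 0 < ‖x - π x‖ ∧ ‖x - π x‖ < ε} with hL
  have hcl : ∀ j : ℕ, MeasurableSet {x | (j : ℝ) * η ≤ g (π x)} := fun j =>
    (isClosed_le continuous_const (hg.comp hπc)).measurableSet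
  calc ∫⁻ x in L, ENNReal.ofReal (g (π x))
      ≤ ∫⁻ x in L, ∑ j ∈ Finset.range (M + 1),
          {x | (j : ℝ) * η ≤ g (π x)}.indicator (fun _ => ENNReal.ofReal η) x := by
        have hLm : MeasurableSet L := by
          have h2 : Measurable fun x => ‖x - π x‖ := (continuous_id.sub hπc).norm.measurable
          exact (measurableSet_lt measurable_const h2).inter (measurableSet_lt h2
            measurable_const)
        refine setLIntegral_mono' hLm fun x hx => ?_
        have hxF := hπ.mem_frontier (hπ.norm_sub_pos_iff.1 hx.1)
        have h := min_le_add_sum_staircase (g (π x)) η M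
        rw [min_eq_left (hM _ hxF)] at h
        refine (ENNReal.ofReal_le_ofReal h).trans (le_of_eq ?_)
        rw [Finset.sum_range_succ', ENNReal.ofReal_add hη0.le, ENNReal.ofReal_sum_of_nonneg,
          add_comm]
        · congr 1
          · refine Finset.sum_congr rfl fun j _ => ?_
            simp only [indicator, mem_ofPred_eq, Nat.cast_add, Nat.cast_one]
            split_ifs <;> simp
          · simp [hg0]
        · intro j _
          split_ifs <;> simp [hη0.le]
        · refine Finset.sum_nonneg fun j _ => ?_
          split_ifs <;> simp [hη0.le]
    _ = ∑ j ∈ Finset.range (M + 1), ENNReal.ofReal η *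
          volume {x | 0 < ‖x - π x‖ ∧ ‖x - π x‖ < ε ∧ π x ∈ B j} := by
        rw [lintegral_finsetSum _ fun j _ => measurable_const.indicator (hcl j)]
        refine Finset.sum_congr rfl fun j _ => ?_
        rw [lintegral_indicator_const (hcl j), Measure.restrict_apply (hcl j)]
        congr 2
        ext x
        simp only [L, B, mem_inter_iff, mem_ofPred_eq]
        constructor
        · rintro ⟨h1, h2, h3⟩
          exact ⟨h2, h3, hπ.mem_frontier (hπ.norm_sub_pos_iff.1 h2), h1⟩
        · rintro ⟨h1, h2, -, h4⟩
          exact ⟨h4, h1, h2⟩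
    _ ≤ ∑ j ∈ Finset.range (M + 1), ENNReal.ofReal η *
          (ENNReal.ofReal ε * (σ (B j) + δ)) := by
        refine Finset.sum_le_sum fun j hj => ?_
        gcongr
        exact hε j hj
    _ = ENNReal.ofReal ε * ∑ j ∈ Finset.range (M + 1), ENNReal.ofReal η * (σ (B j) + δ) := by
        rw [Finset.mul_sum]
        exact Finset.sum_congr rfl fun j _ => mul_left_comm _ _ _
    _ ≤ _ := by gcongr

/-- The radial solution of `(r ^ m * φ)' = r ^ m * G φ` with `φ 0 = 0`, obtained as a least fixed
point among monotone functions. -/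
theorem exists_monotone_radial_ode (m : ℕ) {G : ℝ → ℝ} {C : ℝ} (hGc : Continuous G)
    (hGm : Monotone G) (hG0 : ∀ x, 0 ≤ G x) (hGC : ∀ x, G x ≤ C) :
    ∃ φ : ℝ → ℝ, Monotone φ ∧ Continuous φ ∧ (∀ r ≤ 0, φ r = 0) ∧
      ∀ r, 0 < r → r ^ m * φ r = ∫ s in 0..r, s ^ m * G (φ s) := by
  classical
  have hC0 : 0 ≤ C := (hG0 0).trans (hGC 0)
  set G' : ℝ≥0∞ → ℝ≥0∞ := fun x ↦ if x = ∞ then ENNReal.ofReal C else ENNReal.ofReal (G x.toReal)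
    with hG'
  have hG'm : Monotone G' := by
    intro x y hxy
    simp only [hG']
    split_ifs with h1 h2 h2
    · exact le_rfl
    · exact absurd (top_le_iff.1 (h1 ▸ hxy)) h2
    · exact ENNReal.ofReal_le_ofReal (hGC _)
    · exact ENNReal.ofReal_le_ofReal (hGm (ENNReal.toReal_mono h2 hxy))
  have hG'C : ∀ x, G' x ≤ ENNReal.ofReal C := by
    intro x
    simp only [hG']
    split_ifs
    · exact le_rfl
    · exact ENNReal.ofReal_le_ofReal (hGC _)
  let T : (ℝ →o ℝ≥0∞) →o (ℝ →o ℝ≥0∞) :=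
    { toFun := fun f ↦
        { toFun := fun r ↦ ENNReal.ofReal r *
            ∫⁻ τ in Ioo (0 : ℝ) 1, ENNReal.ofReal (τ ^ m) * G' (f (r * τ))
          monotone' := by
            intro r s hrs
            refine mul_le_mul' (ENNReal.ofReal_le_ofReal hrs) ?_
            refine setLIntegral_mono' measurableSet_Ioo fun τ hτ ↦ ?_
            exact mul_le_mul_right (hG'm (f.monotone (mul_le_mul_of_nonneg_right hrs hτ.1.le))) _ }
      monotone' := by
        intro f g hfg r
        exact mul_le_mul_right (lintegral_mono fun τ ↦ mul_le_mul_right (hG'm (hfg _)) _) _ }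
  set f : ℝ →o ℝ≥0∞ := OrderHom.lfp T with hf
  have hfix : ∀ r, f r = ENNReal.ofReal r *
      ∫⁻ τ in Ioo (0 : ℝ) 1, ENNReal.ofReal (τ ^ m) * G' (f (r * τ)) := by
    intro r
    conv_lhs => rw [hf, ← OrderHom.map_lfp T]
    rfl
  have hbd : ∀ r, f r ≤ ENNReal.ofReal r * ENNReal.ofReal C := by
    intro r
    rw [hfix]
    refine mul_le_mul_right ?_ _
    calc ∫⁻ τ in Ioo (0 : ℝ) 1, ENNReal.ofReal (τ ^ m) * G' (f (r * τ))
        ≤ ∫⁻ τ in Ioo (0 : ℝ) 1, ENNReal.ofReal C := by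
          refine setLIntegral_mono' measurableSet_Ioo fun τ hτ ↦ ?_
          calc _ ≤ 1 * ENNReal.ofReal C := mul_le_mul' (by
                rw [← ENNReal.ofReal_one]
                exact ENNReal.ofReal_le_ofReal (pow_le_one₀ hτ.1.le hτ.2.le)) (hG'C _)
            _ = _ := one_mul _
      _ = _ := by simp
  have hne : ∀ r, f r ≠ ∞ := fun r ↦ ne_top_of_le_ne_top (by finiteness) (hbd r)
  set φ : ℝ → ℝ := fun r ↦ (f r).toReal with hφ
  have hφm : Monotone φ := fun r s h ↦ ENNReal.toReal_mono (hne s) (f.monotone h)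
  have hφ0 : ∀ r ≤ 0, φ r = 0 := by
    intro r hr
    simp only [hφ]
    rw [hfix, ENNReal.ofReal_of_nonpos hr]
    simp
  have hφnn : ∀ r, 0 ≤ φ r := fun r ↦ ENNReal.toReal_nonneg
  have hφC : ∀ r, 0 ≤ r → φ r ≤ r * C := by
    intro r hr
    have := ENNReal.toReal_mono (by finiteness) (hbd r)
    rwa [ENNReal.toReal_mul, ENNReal.toReal_ofReal hr, ENNReal.toReal_ofReal hC0] at this
  have hGφ : ∀ r, G' (f r) = ENNReal.ofReal (G (φ r)) := by
    intro r
    simp only [hG', hφ, if_neg (hne r)]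
  have hmeas : Measurable fun s ↦ G (φ s) := hGc.measurable.comp hφm.measurable
  have hint : ∀ r, 0 < r → r ^ m * φ r = ∫ s in 0..r, s ^ m * G (φ s) := by
    intro r hr
    have h1 : φ r = r * ∫ τ in (0 : ℝ)..1, τ ^ m * G (φ (r * τ)) := by
      rw [intervalIntegral.integral_of_le zero_le_one, integral_Ioc_eq_integral_Ioo,
        integral_eq_lintegral_of_nonneg_ae]
      · simp only [hφ]
        rw [hfix, ENNReal.toReal_mul, ENNReal.toReal_ofReal hr.le]
        congr 2
        refine setLIntegral_congr_fun measurableSet_Ioo fun τ hτ ↦ ?_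
        rw [ENNReal.ofReal_mul (pow_nonneg hτ.1.le m), hGφ]
      · refine (ae_restrict_iff' measurableSet_Ioo).2 (.of_forall fun τ hτ ↦ ?_)
        exact mul_nonneg (pow_nonneg hτ.1.le m) (hG0 _)
      · exact ((measurable_id.pow_const m).mul
          (hmeas.comp (measurable_const_mul r))).aestronglyMeasurable
    have h2 := intervalIntegral.integral_comp_mul_left (a := 0) (b := 1)
      (fun s ↦ s ^ m * G (φ s)) hr.ne'
    simp only [mul_zero, mul_one, smul_eq_mul] at h2
    have h3 : ∫ s in 0..r, s ^ m * G (φ s) =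
        r * ∫ τ in (0 : ℝ)..1, (r * τ) ^ m * G (φ (r * τ)) := by
      rw [h2]; field_simp
    have h4 : ∫ τ in (0 : ℝ)..1, (r * τ) ^ m * G (φ (r * τ)) =
        r ^ m * ∫ τ in (0 : ℝ)..1, τ ^ m * G (φ (r * τ)) := by
      rw [← intervalIntegral.integral_const_mul]
      simp_rw [mul_pow, mul_assoc]
    rw [h3, h4, h1]
    ring
  have hii : ∀ a b : ℝ, IntervalIntegrable (fun s ↦ s ^ m * G (φ s)) volume a b := by
    intro a b
    have : IntervalIntegrable (fun s ↦ G (φ s)) volume a b :=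
      (hGm.comp hφm).intervalIntegrable
    exact this.continuousOn_mul (continuous_pow m).continuousOn
  have hprim : Continuous fun r ↦ ∫ s in (0 : ℝ)..r, s ^ m * G (φ s) :=
    intervalIntegral.continuous_primitive hii 0
  refine ⟨φ, hφm, ?_, hφ0, hint⟩
  rw [continuous_iff_continuousAt]
  intro r
  rcases lt_trichotomy r 0 with hr | rfl | hr
  · refine (continuousAt_const (y := (0 : ℝ))).congr ?_
    filter_upwards [Iio_mem_nhds hr] with s hs using (hφ0 s (le_of_lt hs)).symm
  · have h0 : φ 0 = 0 := hφ0 0 le_rfl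
    rw [ContinuousAt, h0]
    refine squeeze_zero (g := fun r ↦ |r| * C) hφnn (fun r ↦ ?_) ?_
    · rcases le_total r 0 with h | h
      · rw [hφ0 r h]; positivity
      · rw [abs_of_nonneg h]; exact hφC r h
    · have : ContinuousAt (fun r : ℝ ↦ |r| * C) 0 := by fun_prop
      simpa [ContinuousAt] using this
  · have : ContinuousAt (fun r ↦ (∫ s in (0 : ℝ)..r, s ^ m * G (φ s)) / r ^ m) r :=
      hprim.continuousAt.div (by fun_prop) (by positivity)
    refine this.congr ?_
    filter_upwards [Ioi_mem_nhds hr] with s hs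
    have hs' : (0 : ℝ) < s := hs
    rw [← hint s hs]
    field_simp

theorem setIntegral_ball_fun_norm (m : ℕ) {R : ℝ} (hR : 0 ≤ R) (f : ℝ → ℝ) :
    ∫ x in ball (0 : EuclideanSpace ℝ (Fin (m + 1))) R, f ‖x‖ =
      (m + 1) * volume.real (ball (0 : EuclideanSpace ℝ (Fin (m + 1))) 1) *
        ∫ s in 0..R, s ^ m * f s := by
  have h1 : ∫ x in ball (0 : EuclideanSpace ℝ (Fin (m + 1))) R, f ‖x‖ =
      ∫ x : EuclideanSpace ℝ (Fin (m + 1)), (Iio R).indicator f ‖x‖ := by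
    rw [← integral_indicator measurableSet_ball]
    congr 1 with x
    simp [indicator]
  rw [h1, integral_fun_norm_addHaar volume]
  simp only [finrank_euclideanSpace, Fintype.card_fin, Nat.add_sub_cancel, smul_eq_mul,
    nsmul_eq_mul, Nat.cast_add, Nat.cast_one]
  rw [intervalIntegral.integral_of_le hR, integral_Ioc_eq_integral_Ioo, mul_assoc]
  congr 2
  rw [← integral_indicator measurableSet_Ioi, ← integral_indicator measurableSet_Ioo]
  congr 1 with s
  by_cases h1 : 0 < s <;> by_cases h2 : s < R <;> simp [indicator, h1, h2]

/-- A positive function `exp (-∫ φ ^ (1 / (p - 1)))` built from a solution of the radial Riccati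
equation satisfies the radial energy identity. -/
theorem radial_energy_identity {m : ℕ} {p lam r₀ : ℝ} (hp : 1 < p) (hr₀ : 0 < r₀)
    {φ : ℝ → ℝ} (hφc : Continuous φ) (hφ0 : ∀ s, 0 ≤ φ s)
    (hφ : ∀ r, 0 < r → r ≤ r₀ →
      r ^ m * φ r = ∫ s in 0..r, s ^ m * (lam + (p - 1) * φ s ^ (p / (p - 1)))) :
    r₀ ^ m * φ r₀ * Real.exp (-∫ s in 0..r₀, φ s ^ (1 / (p - 1))) ^ p +
      ∫ r in 0..r₀, r ^ m * (φ r ^ (p / (p - 1)) *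
        Real.exp (-∫ s in 0..r, φ s ^ (1 / (p - 1))) ^ p) =
      lam * ∫ r in 0..r₀, r ^ m * Real.exp (-∫ s in 0..r, φ s ^ (1 / (p - 1))) ^ p := by
  have hp1 : 0 < p - 1 := by linarith
  set ψ : ℝ → ℝ := fun s ↦ φ s ^ (1 / (p - 1)) with hψ
  set q := p / (p - 1) with hq
  have hq0 : 0 ≤ q := by positivity
  have hψc : Continuous ψ := hφc.rpow_const fun _ ↦ .inr (by positivity)
  have hφq : Continuous fun s ↦ φ s ^ q := hφc.rpow_const fun _ ↦ .inr hq0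
  have hw : ∀ r, Real.exp (-∫ s in 0..r, ψ s) ^ p = Real.exp (-p * ∫ s in 0..r, ψ s) := by
    intro r
    rw [← Real.exp_mul]; ring_nf
  change r₀ ^ m * φ r₀ * Real.exp (-∫ s in 0..r₀, ψ s) ^ p +
      ∫ r in 0..r₀, r ^ m * (φ r ^ q * Real.exp (-∫ s in 0..r, ψ s) ^ p) =
      lam * ∫ r in 0..r₀, r ^ m * Real.exp (-∫ s in 0..r, ψ s) ^ p
  simp_rw [hw]
  set w : ℝ → ℝ := fun r ↦ Real.exp (-p * ∫ s in 0..r, ψ s) with hwdef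
  have hwd : ∀ r, HasDerivAt w (w r * (-p * ψ r)) r := fun r ↦
    ((hψc.integral_hasStrictDerivAt 0 r).hasDerivAt.const_mul (-p)).exp
  have hwc : Continuous w := continuous_iff_continuousAt.2 fun r ↦ (hwd r).continuousAt
  set H : ℝ → ℝ := fun s ↦ s ^ m * (lam + (p - 1) * φ s ^ q) with hH
  have hHc : Continuous H := by fun_prop
  have hPd : ∀ r, HasDerivAt (fun r ↦ ∫ s in 0..r, H s) (H r) r := fun r ↦
    (hHc.integral_hasStrictDerivAt 0 r).hasDerivAt
  have hPc : Continuous fun r ↦ ∫ s in 0..r, H s :=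
    continuous_iff_continuousAt.2 fun r ↦ (hPd r).continuousAt
  have hFTC := intervalIntegral.integral_eq_sub_of_hasDerivAt (a := 0) (b := r₀)
    (fun r _ ↦ (hPd r).mul (hwd r))
    (Continuous.intervalIntegrable (by fun_prop) _ _)
  simp only [Pi.mul_apply, intervalIntegral.integral_same, zero_mul, sub_zero] at hFTC
  rw [← hφ r₀ hr₀ le_rfl] at hFTC
  have hcongr : ∫ r in 0..r₀, (H r * w r + (∫ s in 0..r, H s) * (w r * (-p * ψ r))) =
      ∫ r in 0..r₀, (lam * (r ^ m * w r) - r ^ m * (φ r ^ q * w r)) := by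
    rw [intervalIntegral.integral_of_le hr₀.le, intervalIntegral.integral_of_le hr₀.le]
    refine setIntegral_congr_fun measurableSet_Ioc fun r hr ↦ ?_
    rw [← hφ r hr.1 hr.2]
    have : φ r * ψ r = φ r ^ q := by
      have hexp : q = 1 + 1 / (p - 1) := by rw [hq]; field_simp; ring
      simp only [hψ]
      rw [hexp, Real.rpow_add_of_nonneg (hφ0 r) zero_le_one (by positivity), Real.rpow_one]
    simp only [hH]
    linear_combination (-p * r ^ m * w r) * this
  rw [hcongr, intervalIntegral.integral_sub (Continuous.intervalIntegrable (by fun_prop) _ _)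
    (Continuous.intervalIntegrable (by fun_prop) _ _), intervalIntegral.integral_const_mul] at hFTC
  linarith

theorem rayleigh_nonneg {n : ℕ} {p β : ℝ} (hβ : 0 ≤ β) (Ω : Set (EuclideanSpace ℝ (Fin n)))
    (u : EuclideanSpace ℝ (Fin n) → ℝ) : 0 ≤ rayleigh n p β Ω u := by
  unfold rayleigh
  have h1 : 0 ≤ ∫ x in Ω, ‖fderiv ℝ u x‖ ^ p := integral_nonneg fun x ↦ by positivity
  have h2 : 0 ≤ ∫ x in frontier Ω, |u x| ^ p ∂(μH[(n : ℝ) - 1]) :=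
    integral_nonneg fun x ↦ by positivity
  have h3 : 0 ≤ ∫ x in Ω, |u x| ^ p := integral_nonneg fun x ↦ by positivity
  positivity

theorem robinEig_nonneg {n : ℕ} {p β : ℝ} (hβ : 0 ≤ β) (Ω : Set (EuclideanSpace ℝ (Fin n))) :
    0 ≤ robinEig n p β Ω := by
  refine Real.sInf_nonneg ?_
  rintro r ⟨u, -, -, rfl⟩
  exact rayleigh_nonneg hβ Ω u

theorem robinEig_le_rayleigh {n : ℕ} {p β : ℝ} (hβ : 0 ≤ β) {Ω : Set (EuclideanSpace ℝ (Fin n))}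
    {u : EuclideanSpace ℝ (Fin n) → ℝ} {K : ℝ≥0} (hu : LipschitzOnWith K u (closure Ω))
    (hpos : 0 < ∫ x in Ω, |u x| ^ p) : robinEig n p β Ω ≤ rayleigh n p β Ω u := by
  refine csInf_le ⟨0, ?_⟩ ⟨u, ⟨K, hu⟩, hpos, rfl⟩
  rintro r ⟨u, -, -, rfl⟩
  exact rayleigh_nonneg hβ Ω u

theorem norm_fderiv_comp_mul_norm_le {E : Type*} [NormedAddCommGroup E] [InnerProductSpace ℝ E]
    {v : ℝ → ℝ} {k v' : ℝ} (hk : 0 ≤ k) {x : E} (hx : x ≠ 0)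
    (hv : HasDerivAt v v' (k * ‖x‖)) : ‖fderiv ℝ (fun y ↦ v (k * ‖y‖)) x‖ ≤ k * |v'| := by
  have hn : DifferentiableAt ℝ (fun y : E ↦ ‖y‖) x := differentiableAt_id.norm ℝ hx
  have h1 : HasFDerivAt (fun y : E ↦ k * ‖y‖) (k • fderiv ℝ (fun y : E ↦ ‖y‖) x) x :=
    hn.hasFDerivAt.const_mul k
  have h2 := hv.comp_hasFDerivAt x h1
  have h3 : fderiv ℝ (fun y ↦ v (k * ‖y‖)) x = v' • k • fderiv ℝ (fun y : E ↦ ‖y‖) x := h2.fderiv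
  have h4 : ‖fderiv ℝ (fun y : E ↦ ‖y‖) x‖ ≤ 1 := by
    simpa using norm_fderiv_le_of_lipschitz ℝ (lipschitzWith_one_norm (E := E)) (x₀ := x)
  rw [h3, norm_smul, norm_smul, Real.norm_eq_abs, Real.norm_eq_abs, abs_of_nonneg hk]
  nlinarith [mul_nonneg (abs_nonneg v') hk]

/-- A solution of the radial Riccati equation reaching the Robin boundary value before radius `R`
produces a test function with Rayleigh quotient below `lam`. -/
theorem robinEig_ball_lt {m : ℕ} {p β R M lam r₀ : ℝ} (hp : 1 < p) (hβ : 0 ≤ β)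
    (hr₀ : 0 < r₀) (hrR : r₀ < R) (hlam : 0 < lam)
    (hM : β * ((μH[((m + 1 : ℕ) : ℝ) - 1] : Measure (EuclideanSpace ℝ (Fin (m + 1)))).real
      (sphere 0 R)) = M * ((m + 1) *
        volume.real (ball (0 : EuclideanSpace ℝ (Fin (m + 1))) 1) * R ^ m))
    {φ : ℝ → ℝ} (hφc : Continuous φ) (hφm : Monotone φ) (hφ0 : ∀ s, 0 ≤ φ s) (hφM : φ r₀ = M)
    (hφ : ∀ r, 0 < r → r ≤ r₀ →
      r ^ m * φ r = ∫ s in 0..r, s ^ m * (lam + (p - 1) * φ s ^ (p / (p - 1)))) :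
    robinEig (m + 1) p β (ball 0 R) < lam := by
  have hp1 : 0 < p - 1 := by linarith
  have hR : 0 < R := hr₀.trans hrR
  set ω := volume.real (ball (0 : EuclideanSpace ℝ (Fin (m + 1))) 1) with hω
  have hω0 : 0 < ω := by
    rw [hω, measureReal_def]
    exact ENNReal.toReal_pos (measure_ball_pos _ _ one_pos).ne' measure_ball_lt_top.ne
  set k := r₀ / R with hk
  have hk0 : 0 < k := by positivity
  have hk1 : k < 1 := (div_lt_one hR).2 hrR
  have hkR : k * R = r₀ := by rw [hk]; field_simp
  set q := p / (p - 1) with hq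
  have hq0 : 0 ≤ q := by positivity
  have hid := radial_energy_identity hp hr₀ hφc hφ0 hφ
  rw [hφM, ← hq] at hid
  set ψ : ℝ → ℝ := fun s ↦ φ s ^ (1 / (p - 1)) with hψ
  have hψc : Continuous ψ := hφc.rpow_const fun _ ↦ .inr (by positivity)
  have hψ0 : ∀ s, 0 ≤ ψ s := fun s ↦ Real.rpow_nonneg (hφ0 s) _
  have hφq : Continuous fun s ↦ φ s ^ q := hφc.rpow_const fun _ ↦ .inr hq0
  set v : ℝ → ℝ := fun r ↦ Real.exp (-∫ s in 0..r, ψ s) with hv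
  have hv0 : ∀ r, 0 < v r := fun r ↦ Real.exp_pos _
  have hvd : ∀ r, HasDerivAt v (v r * -ψ r) r := fun r ↦
    (hψc.integral_hasStrictDerivAt 0 r).hasDerivAt.fun_neg.exp
  have hvc : Continuous v := continuous_iff_continuousAt.2 fun r ↦ (hvd r).continuousAt
  have hvp : Continuous fun r ↦ v r ^ p := hvc.rpow_const fun _ ↦ .inr (by linarith)
  change r₀ ^ m * M * v r₀ ^ p + ∫ r in 0..r₀, r ^ m * (φ r ^ q * v r ^ p) =
      lam * ∫ r in 0..r₀, r ^ m * v r ^ p at hid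
  set A := ∫ r in 0..r₀, r ^ m * (φ r ^ q * v r ^ p) with hA
  set D := ∫ r in 0..r₀, r ^ m * v r ^ p with hD
  have hA0 : 0 ≤ A := by
    refine intervalIntegral.integral_nonneg hr₀.le fun r hr ↦ ?_
    have := hr.1
    have := hφ0 r
    have := hv0 r
    positivity
  have hD0 : 0 < D := by
    refine intervalIntegral.intervalIntegral_pos_of_pos_on
      (Continuous.intervalIntegrable (by fun_prop) _ _) (fun r hr ↦ ?_) hr₀
    have := hr.1
    have := hv0 r
    positivity
  have hscale : ∀ f : ℝ → ℝ, k ^ (m + 1) * ∫ s in 0..R, s ^ m * f (k * s) =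
      ∫ r in 0..r₀, r ^ m * f r := by
    intro f
    have := intervalIntegral.integral_comp_mul_left (a := 0) (b := R)
      (fun r ↦ r ^ m * f r) hk0.ne'
    simp only [mul_zero, smul_eq_mul, hkR] at this
    rw [eq_inv_mul_iff_mul_eq₀ hk0.ne'] at this
    rw [← this, pow_succ', mul_assoc, ← intervalIntegral.integral_const_mul]
    simp_rw [mul_pow, mul_assoc]
  set u : EuclideanSpace ℝ (Fin (m + 1)) → ℝ := fun x ↦ v (k * ‖x‖) with hu
  have hden : k ^ (m + 1) * ∫ x in ball (0 : EuclideanSpace ℝ (Fin (m + 1))) R, |u x| ^ p =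
      (m + 1) * ω * D := by
    have : ∀ x, |u x| ^ p = (fun s ↦ v (k * s) ^ p) ‖x‖ := fun x ↦ by
      simp only [hu]; rw [abs_of_pos (hv0 _)]
    simp_rw [this]
    rw [setIntegral_ball_fun_norm m hR.le fun s ↦ v (k * s) ^ p, mul_left_comm,
      hscale fun r ↦ v r ^ p]
  have hgrad : k ^ (m + 1) * ∫ x in ball (0 : EuclideanSpace ℝ (Fin (m + 1))) R,
      ‖fderiv ℝ u x‖ ^ p ≤ k ^ p * ((m + 1) * ω * A) := by
    have hle : ∫ x in ball (0 : EuclideanSpace ℝ (Fin (m + 1))) R, ‖fderiv ℝ u x‖ ^ p ≤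
        ∫ x in ball (0 : EuclideanSpace ℝ (Fin (m + 1))) R,
          k ^ p * (φ (k * ‖x‖) ^ q * v (k * ‖x‖) ^ p) := by
      refine integral_mono_of_nonneg (.of_forall fun x ↦ by positivity) ?_ ?_
      · have hc : Continuous fun x : EuclideanSpace ℝ (Fin (m + 1)) ↦
            k ^ p * (φ (k * ‖x‖) ^ q * v (k * ‖x‖) ^ p) := by
          have h1 : Continuous fun x : EuclideanSpace ℝ (Fin (m + 1)) ↦ φ (k * ‖x‖) ^ q :=
            hφq.comp (by fun_prop : Continuous fun x : EuclideanSpace ℝ (Fin (m + 1)) ↦ k * ‖x‖)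
          have h2 : Continuous fun x : EuclideanSpace ℝ (Fin (m + 1)) ↦ v (k * ‖x‖) ^ p :=
            hvp.comp (by fun_prop : Continuous fun x : EuclideanSpace ℝ (Fin (m + 1)) ↦ k * ‖x‖)
          fun_prop
        exact (hc.continuousOn.integrableOn_compact (isCompact_closedBall 0 R)).mono_set
          ball_subset_closedBall
      · have : ∀ᵐ x : EuclideanSpace ℝ (Fin (m + 1)), x ≠ 0 := by
          simp [ae_iff]
        refine ae_restrict_of_ae (this.mono fun x hx ↦ ?_)
        have h1 := norm_fderiv_comp_mul_norm_le hk0.le hx (hvd (k * ‖x‖))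
        rw [abs_mul, abs_neg, abs_of_pos (hv0 _), abs_of_nonneg (hψ0 _)] at h1
        refine (Real.rpow_le_rpow (norm_nonneg _) h1 (by linarith)).trans_eq ?_
        rw [Real.mul_rpow hk0.le (mul_nonneg (hv0 _).le (hψ0 _)), Real.mul_rpow (hv0 _).le (hψ0 _)]
        simp only [hψ]
        rw [← Real.rpow_mul (hφ0 _), show 1 / (p - 1) * p = q by rw [hq]; ring]
        ring
    rw [integral_const_mul, setIntegral_ball_fun_norm m hR.le
      (fun s ↦ φ (k * s) ^ q * v (k * s) ^ p)] at hle
    calc _ ≤ k ^ (m + 1) * _ := mul_le_mul_of_nonneg_left hle (by positivity)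
      _ = k ^ p * ((m + 1) * ω * (k ^ (m + 1) * ∫ s in 0..R, s ^ m *
          (fun r ↦ φ r ^ q * v r ^ p) (k * s))) := by ring
      _ = _ := by rw [hscale fun r ↦ φ r ^ q * v r ^ p]
  have hbdry : k ^ (m + 1) * (β * ∫ x in frontier (ball (0 : EuclideanSpace ℝ (Fin (m + 1))) R),
      |u x| ^ p ∂μH[((m + 1 : ℕ) : ℝ) - 1]) = k * ((m + 1) * ω * (r₀ ^ m * M * v r₀ ^ p)) := by
    rw [frontier_ball _ hR.ne']
    have : ∫ x in sphere (0 : EuclideanSpace ℝ (Fin (m + 1))) R,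
        |u x| ^ p ∂μH[((m + 1 : ℕ) : ℝ) - 1] =
        ∫ x in sphere (0 : EuclideanSpace ℝ (Fin (m + 1))) R,
        v r₀ ^ p ∂μH[((m + 1 : ℕ) : ℝ) - 1] := by
      refine setIntegral_congr_fun isClosed_sphere.measurableSet fun x hx ↦ ?_
      simp only [hu]
      rw [mem_sphere_zero_iff_norm.1 hx, hkR, abs_of_pos (hv0 _)]
    rw [this, setIntegral_const, smul_eq_mul, ← mul_assoc β, hM, ← hkR, mul_pow]
    ring
  have hpos : 0 < ∫ x in ball (0 : EuclideanSpace ℝ (Fin (m + 1))) R, |u x| ^ p := by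
    have : 0 < k ^ (m + 1) * ∫ x in ball (0 : EuclideanSpace ℝ (Fin (m + 1))) R, |u x| ^ p := by
      rw [hden]; positivity
    exact pos_of_mul_pos_right this (by positivity)
  have hlip : LipschitzOnWith (φ r₀ ^ (1 / (p - 1))).toNNReal v (Icc 0 r₀) := by
    refine (convex_Icc 0 r₀).lipschitzOnWith_of_nnnorm_hasDerivWithin_le
      (fun r _ ↦ (hvd r).hasDerivWithinAt) fun r hr ↦ ?_
    rw [← NNReal.coe_le_coe, coe_nnnorm, Real.norm_eq_abs, abs_mul, abs_neg, abs_of_pos (hv0 _),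
      abs_of_nonneg (hψ0 _), Real.coe_toNNReal _ (hψ0 _)]
    have h1 : v r ≤ 1 := Real.exp_le_one_iff.2
      (neg_nonpos.2 (intervalIntegral.integral_nonneg hr.1 fun s _ ↦ hψ0 s))
    calc v r * ψ r ≤ 1 * ψ r₀ := mul_le_mul h1
          (Real.rpow_le_rpow (hφ0 _) (hφm hr.2) (by positivity)) (hψ0 _) zero_le_one
      _ = _ := one_mul _
  have hlip2 : LipschitzWith k.toNNReal fun x : EuclideanSpace ℝ (Fin (m + 1)) ↦ k * ‖x‖ := by
    refine LipschitzWith.of_dist_le_mul fun x y ↦ ?_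
    rw [Real.dist_eq, ← mul_sub, abs_mul, abs_of_pos hk0, Real.coe_toNNReal _ hk0.le]
    exact mul_le_mul_of_nonneg_left ((abs_norm_sub_norm_le x y).trans_eq (dist_eq_norm x y).symm)
      hk0.le
  have hulip := hlip.comp (hlip2.lipschitzOnWith (s := closure (ball 0 R))) (by
    intro x hx
    rw [closure_ball _ hR.ne', mem_closedBall_zero_iff] at hx
    refine ⟨by positivity, ?_⟩
    rw [← hkR]
    exact mul_le_mul_of_nonneg_left hx hk0.le)
  refine (robinEig_le_rayleigh hβ hulip hpos).trans_lt ?_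
  change rayleigh (m + 1) p β (ball 0 R) u < lam
  unfold rayleigh
  rw [div_lt_iff₀ hpos]
  have hkp : k ^ p ≤ k := by
    simpa using Real.rpow_le_rpow_of_exponent_ge hk0 hk1.le hp.le
  refine lt_of_mul_lt_mul_left (a := k ^ (m + 1)) ?_ (by positivity)
  rw [mul_add, hbdry, mul_left_comm (k ^ (m + 1)) lam, hden]
  have hnω : 0 < (m + 1) * ω := by positivity
  calc _ ≤ k ^ p * ((m + 1) * ω * A) + k * ((m + 1) * ω * (r₀ ^ m * M * v r₀ ^ p)) := by gcongr
    _ ≤ k * ((m + 1) * ω * A) + k * ((m + 1) * ω * (r₀ ^ m * M * v r₀ ^ p)) := by gcongr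
    _ = k * ((m + 1) * ω * (r₀ ^ m * M * v r₀ ^ p + A)) := by ring
    _ = k * (lam * ((m + 1) * ω * D)) := by rw [hid]; ring
    _ < 1 * (lam * ((m + 1) * ω * D)) := by
      refine mul_lt_mul_of_pos_right hk1 (by positivity)
    _ = _ := one_mul _

theorem exists_radial_le {m : ℕ} {p β R M lam : ℝ} (hp : 1 < p) (hβ : 0 ≤ β) (hR : 0 < R)
    (hlam : 0 < lam) (hM0 : 0 < M) (hlam' : lam ≤ robinEig (m + 1) p β (ball 0 R))
    (hM : β * ((μH[((m + 1 : ℕ) : ℝ) - 1] : Measure (EuclideanSpace ℝ (Fin (m + 1)))).real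
      (sphere 0 R)) = M * ((m + 1) *
        volume.real (ball (0 : EuclideanSpace ℝ (Fin (m + 1))) 1) * R ^ m)) :
    ∃ φ : ℝ → ℝ, Monotone φ ∧ Continuous φ ∧ φ 0 = 0 ∧ (∀ r, 0 ≤ φ r) ∧ φ R ≤ M ∧
      ∀ r, 0 < r → r ≤ R →
        r ^ m * φ r = ∫ s in 0..r, s ^ m * (lam + (p - 1) * φ s ^ (p / (p - 1))) := by
  have hp1 : 0 < p - 1 := by linarith
  have hq0 : 0 ≤ p / (p - 1) := by positivity
  obtain ⟨φ, hφm, hφc, hφz, hφ⟩ := exists_monotone_radial_ode m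
    (G := fun x ↦ lam + (p - 1) * (min (max x 0) M) ^ (p / (p - 1)))
    (C := lam + (p - 1) * M ^ (p / (p - 1)))
    (by
      have : Continuous fun x : ℝ ↦ (min (max x 0) M) ^ (p / (p - 1)) :=
        Continuous.rpow_const (by fun_prop) fun _ ↦ .inr hq0
      fun_prop)
    (by
      intro x y hxy
      have : 0 ≤ min (max x 0) M := le_min (le_max_right _ _) hM0.le
      simp only
      gcongr)
    (by
      intro x
      have : 0 ≤ min (max x 0) M := le_min (le_max_right _ _) hM0.le
      positivity)
    (by
      intro x
      have : 0 ≤ min (max x 0) M := le_min (le_max_right _ _) hM0.le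
      have := min_le_right (max x 0) M
      gcongr)
  have hφ0 : ∀ s, 0 ≤ φ s := by
    intro s
    rcases le_total s 0 with h | h
    · exact (hφz s h).ge
    · exact (hφz 0 le_rfl).ge.trans (hφm h)
  have hode : ∀ r₀, φ r₀ ≤ M → ∀ r, 0 < r → r ≤ r₀ →
      r ^ m * φ r = ∫ s in 0..r, s ^ m * (lam + (p - 1) * φ s ^ (p / (p - 1))) := by
    intro r₀ hr₀ r hr hrr
    rw [hφ r hr]
    refine intervalIntegral.integral_congr fun s hs ↦ ?_
    rw [uIcc_of_le hr.le] at hs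
    rw [max_eq_left (hφ0 s), min_eq_left ((hφm (hs.2.trans hrr)).trans hr₀)]
  have hcase : φ R ≤ M := by
    by_contra! hcase
    obtain ⟨r₀, hr₀, h_eq⟩ := intermediate_value_Icc hR.le hφc.continuousOn
      ⟨(hφz 0 le_rfl).le.trans hM0.le, hcase.le⟩
    have hr₀0 : 0 < r₀ := by
      refine lt_of_le_of_ne hr₀.1 ?_
      rintro rfl
      rw [hφz 0 le_rfl] at h_eq
      exact hM0.ne h_eq
    have hr₀R : r₀ < R := by
      refine lt_of_le_of_ne hr₀.2 ?_
      rintro rfl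
      exact hcase.ne h_eq.symm
    exact (robinEig_ball_lt hp hβ hr₀0 hr₀R hlam hM hφc hφm hφ0 h_eq
      (hode r₀ h_eq.le)).not_ge hlam'
  exact ⟨φ, hφm, hφc, hφz 0 le_rfl, hφ0, hcase, hode R hcase⟩

/-- The part of a superlevel set whose own superlevel sets are larger than `a` misses mass `a`. -/
theorem measure_lt_measure_superlevel_add_le {α : Type*} [MeasurableSpace α] {ν : Measure α}
    {f : α → ℝ} (hf : Measurable f) {W t : ℝ} (hW : ∀ x, f x ≤ W) {a : ℝ≥0∞}
    (ha : a ≤ ν {y | t < f y}) :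
    ν {x | t < f x ∧ a < ν {y | f x < f y}} + a ≤ ν {y | t < f y} := by
  set T : Set ℝ := {τ | t ≤ τ ∧ a < ν {y | τ < f y}} with hT
  rcases T.eq_empty_or_nonempty with hTe | hTne
  · have : {x | t < f x ∧ a < ν {y | f x < f y}} = ∅ := by
      ext x
      simp only [mem_ofPred_eq, mem_empty_iff_false, iff_false]
      rintro ⟨h1, h2⟩
      have : f x ∈ T := ⟨h1.le, h2⟩
      simp [hTe] at this
    rw [this]
    simpa using ha
  have hTb : BddAbove T := by
    refine ⟨W, fun τ hτ ↦ ?_⟩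
    by_contra! h
    have : {y | τ < f y} = ∅ := by
      ext y
      simpa using (hW y).trans h.le
    have h2 := hτ.2
    rw [this] at h2
    simp at h2
  have hpart : ∀ τ ∈ T, ν {x | t < f x ∧ f x ≤ τ} + a ≤ ν {y | t < f y} := by
    rintro τ ⟨hτ1, hτ2⟩
    calc ν {x | t < f x ∧ f x ≤ τ} + a ≤ ν {x | t < f x ∧ f x ≤ τ} + ν {y | τ < f y} := by gcongr
      _ = ν ({x | t < f x ∧ f x ≤ τ} ∪ {y | τ < f y}) := by
        rw [measure_union _ (measurableSet_lt measurable_const hf)]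
        exact disjoint_left.2 fun x h1 h2 ↦ h1.2.not_gt h2
      _ ≤ _ := measure_mono (by
        rintro x (h | h)
        · exact h.1
        · exact hτ1.trans_lt h)
  by_cases hmem : sSup T ∈ T
  · refine le_trans ?_ (hpart _ hmem)
    gcongr with x h1
    exact fun h2 ↦ le_csSup hTb ⟨h1.le, h2⟩
  · obtain ⟨s, hs1, -, hs3, hs4⟩ := exists_seq_tendsto_sSup hTne hTb |>.imp
      fun s h ↦ (⟨h.1, trivial, h.2.1, h.2.2⟩ : Monotone s ∧ True ∧ _ ∧ _)
    calc ν {x | t < f x ∧ a < ν {y | f x < f y}} + a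
        ≤ ν (⋃ k, {x | t < f x ∧ f x ≤ s k}) + a := by
          gcongr
          rintro x ⟨h1, h2⟩
          have hx : f x ∈ T := ⟨h1.le, h2⟩
          have : f x < sSup T := lt_of_le_of_ne (le_csSup hTb hx) fun h ↦ hmem (h ▸ hx)
          obtain ⟨k, hk⟩ := (hs3.eventually (lt_mem_nhds this)).exists
          exact mem_iUnion.2 ⟨k, h1, hk.le⟩
      _ = (⨆ k, ν {x | t < f x ∧ f x ≤ s k}) + a := by
          rw [Monotone.measure_iUnion]
          exact fun i j hij x hx ↦ ⟨hx.1, hx.2.trans (hs1 hij)⟩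
      _ ≤ _ := by
          rw [ENNReal.iSup_add]
          exact iSup_le fun k ↦ hpart _ (hs4 k)

/-- The radius of a Euclidean ball of volume `a`. -/
def ballRadius (m : ℕ) (a : ℝ≥0∞) : ℝ :=
  (a.toReal / volume.real (ball (0 : EuclideanSpace ℝ (Fin (m + 1))) 1)) ^ ((1 : ℝ) / (m + 1))

theorem ballRadius_nonneg (m : ℕ) (a : ℝ≥0∞) : 0 ≤ ballRadius m a :=
  Real.rpow_nonneg (by positivity) _

theorem volume_real_unitBall_pos (m : ℕ) :
    0 < volume.real (ball (0 : EuclideanSpace ℝ (Fin (m + 1))) 1) := by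
  rw [measureReal_def]
  exact ENNReal.toReal_pos (measure_ball_pos _ _ one_pos).ne' measure_ball_lt_top.ne

theorem volume_ball_eq_ofReal (m : ℕ) {r : ℝ} (hr : 0 ≤ r) :
    volume (ball (0 : EuclideanSpace ℝ (Fin (m + 1))) r) = ENNReal.ofReal
      (r ^ (m + 1) * volume.real (ball (0 : EuclideanSpace ℝ (Fin (m + 1))) 1)) := by
  rw [Measure.addHaar_ball _ _ hr, ENNReal.ofReal_mul (by positivity), measureReal_def,
    ENNReal.ofReal_toReal measure_ball_lt_top.ne]
  simp

theorem volume_ball_ballRadius (m : ℕ) {a : ℝ≥0∞} (ha : a ≠ ∞) :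
    volume (ball (0 : EuclideanSpace ℝ (Fin (m + 1))) (ballRadius m a)) = a := by
  rw [volume_ball_eq_ofReal m (ballRadius_nonneg m a), ballRadius, ← Real.rpow_mul_natCast
    (by positivity)]
  have h := volume_real_unitBall_pos m
  have : (1 : ℝ) / (m + 1) * ((m + 1 : ℕ) : ℝ) = 1 := by push_cast; field_simp
  rw [this, Real.rpow_one, div_mul_cancel₀ _ h.ne', ENNReal.ofReal_toReal ha]

theorem ballRadius_mono (m : ℕ) {a b : ℝ≥0∞} (hb : b ≠ ∞) (hab : a ≤ b) :
    ballRadius m a ≤ ballRadius m b := by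
  have := ENNReal.toReal_mono hb hab
  unfold ballRadius
  gcongr

theorem ballRadius_le_of_volume_ball_le (m : ℕ) {a : ℝ≥0∞} {r : ℝ} (hr : 0 ≤ r)
    (h : a ≤ volume (ball (0 : EuclideanSpace ℝ (Fin (m + 1))) r)) : ballRadius m a ≤ r := by
  have hω := volume_real_unitBall_pos m
  rw [volume_ball_eq_ofReal m hr] at h
  have h1 := ENNReal.toReal_mono ENNReal.ofReal_ne_top h
  rw [ENNReal.toReal_ofReal (by positivity)] at h1
  unfold ballRadius
  refine (Real.rpow_le_rpow (by positivity) ((div_le_iff₀ hω).2 h1) (by positivity)).trans_eq ?_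
  have h2 := Real.pow_rpow_inv_natCast hr (Nat.succ_ne_zero m)
  rw [one_div]
  exact_mod_cast h2

theorem measurable_ballRadius (m : ℕ) : Measurable (ballRadius m) :=
  (ENNReal.measurable_toReal.div_const _).pow_const _

theorem measurable_ballRadius_superlevel (m : ℕ) {α : Type*} [MeasurableSpace α] (ν : Measure α)
    (w : α → ℝ) : Measurable fun τ ↦ ballRadius m (ν {y | τ < w y}) := by
  have : Antitone fun τ ↦ ν {y | τ < w y} :=
    fun a b hab ↦ measure_mono fun y (hy : b < w y) ↦ hab.trans_lt hy
  exact (measurable_ballRadius m).comp this.measurable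

theorem lintegral_superlevel_le_lintegral_ball {m : ℕ} {α : Type*} [MeasurableSpace α]
    {ν : Measure α} {w : α → ℝ} (hw : Measurable w) {W t : ℝ} (hW : ∀ x, w x ≤ W)
    (hfin : ν {y | t < w y} ≠ ∞) {F : ℝ → ℝ} (hF : Continuous F) (hFm : Monotone F)
    (hF0 : F 0 = 0) :
    ∫⁻ x in {x | t < w x}, ENNReal.ofReal (F (ballRadius m (ν {y | w x < w y}))) ∂ν ≤
      ∫⁻ y in ball (0 : EuclideanSpace ℝ (Fin (m + 1))) (ballRadius m (ν {y | t < w y})),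
        ENNReal.ofReal (F ‖y‖) := by
  set r := ballRadius m (ν {y | t < w y}) with hr
  have hr0 : 0 ≤ r := ballRadius_nonneg _ _
  have hUt : MeasurableSet {x | t < w x} := measurableSet_lt measurable_const hw
  have hFnn : ∀ ρ, 0 ≤ ρ → 0 ≤ F ρ := fun ρ h ↦ hF0 ▸ hFm h
  rw [lintegral_eq_lintegral_meas_lt _ (.of_forall fun x ↦ hFnn _ (ballRadius_nonneg _ _))
    (hF.measurable.comp ((measurable_ballRadius_superlevel m ν w).comp hw)).aemeasurable,
    lintegral_eq_lintegral_meas_lt _ (.of_forall fun x ↦ hFnn _ (norm_nonneg _))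
    (hF.measurable.comp measurable_norm).aemeasurable]
  refine setLIntegral_mono' measurableSet_Ioi fun s (hs : 0 < s) ↦ ?_
  set S : Set ℝ := Icc 0 r ∩ F ⁻¹' Iic s with hS
  have hSc : IsCompact S := by
    refine isCompact_Icc.of_isClosed_subset ?_ inter_subset_left
    exact isClosed_Icc.inter (isClosed_Iic.preimage hF)
  have h0S : (0 : ℝ) ∈ S := ⟨⟨le_rfl, hr0⟩, by simpa [hF0] using hs.le⟩
  set ρ := sSup S with hρ
  have hρS : ρ ∈ S := hSc.sSup_mem ⟨0, h0S⟩
  have hρ0 : 0 ≤ ρ := hρS.1.1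
  set a := volume (ball (0 : EuclideanSpace ℝ (Fin (m + 1))) ρ) with ha
  have ha_le : a ≤ ν {y | t < w y} := by
    rw [← volume_ball_ballRadius m hfin]
    exact measure_mono (ball_subset_ball hρS.1.2)
  have ha_fin : a ≠ ∞ := measure_ball_lt_top.ne
  have hlow := measure_lt_measure_superlevel_add_le hw hW ha_le
  rw [Measure.restrict_apply' hUt, Measure.restrict_apply' measurableSet_ball]
  have hsub1 : {x | s < F (ballRadius m (ν {y | w x < w y}))} ∩ {x | t < w x} ⊆
      {x | t < w x ∧ a < ν {y | w x < w y}} := by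
    rintro x ⟨h1, h2⟩
    refine ⟨h2, ?_⟩
    by_contra! h3
    have h4 := ballRadius_le_of_volume_ball_le m hρ0 h3
    have h5 := hFm h4
    exact absurd (h5.trans hρS.2) (not_le.2 h1)
  have hsub2 : ball (0 : EuclideanSpace ℝ (Fin (m + 1))) r \ closedBall 0 ρ ⊆
      {y | s < F ‖y‖} ∩ ball 0 r := by
    rintro y ⟨h1, h2⟩
    refine ⟨?_, h1⟩
    simp only [mem_ofPred_eq]
    by_contra! h3
    rw [mem_ball_zero_iff] at h1
    rw [mem_closedBall_zero_iff] at h2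
    exact h2 (le_csSup hSc.bddAbove ⟨⟨norm_nonneg _, h1.le⟩, h3⟩)
  have hball : ν {y | t < w y} ≤
      volume (ball (0 : EuclideanSpace ℝ (Fin (m + 1))) r \ closedBall 0 ρ) + a := by
    have hc : a = volume (closedBall (0 : EuclideanSpace ℝ (Fin (m + 1))) ρ) :=
      (Measure.addHaar_closedBall_eq_addHaar_ball _ _ _).symm
    rw [← volume_ball_ballRadius m hfin, hc]
    refine (measure_mono ?_).trans (measure_union_le _ _)
    intro y hy
    by_cases h : y ∈ closedBall (0 : EuclideanSpace ℝ (Fin (m + 1))) ρ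
    · exact .inr h
    · exact .inl ⟨hy, h⟩
  refine (measure_mono hsub1).trans (le_trans ?_ (measure_mono hsub2))
  exact (ENNReal.add_le_add_iff_right ha_fin).1 (hlow.trans hball)

theorem lintegral_ball_radial_ode {m : ℕ} {c q R lam : ℝ} (hc : 0 ≤ c) (hq : 0 ≤ q)
    (hlam : 0 ≤ lam) {φ : ℝ → ℝ} (hφc : Continuous φ) (hφ0 : ∀ r, 0 ≤ φ r) (hφz : φ 0 = 0)
    (hφ : ∀ r, 0 < r → r ≤ R → r ^ m * φ r = ∫ s in 0..r, s ^ m * (lam + c * φ s ^ q))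
    {r : ℝ} (hr : 0 ≤ r) (hrR : r ≤ R) :
    ∫⁻ y in ball (0 : EuclideanSpace ℝ (Fin (m + 1))) r, ENNReal.ofReal (lam + c * φ ‖y‖ ^ q) =
      ENNReal.ofReal ((m + 1) * volume.real (ball (0 : EuclideanSpace ℝ (Fin (m + 1))) 1) *
        (r ^ m * φ r)) := by
  have hφq : Continuous fun s ↦ φ s ^ q := hφc.rpow_const fun _ ↦ .inr hq
  have h1 : r ^ m * φ r = ∫ s in 0..r, s ^ m * (lam + c * φ s ^ q) := by
    rcases hr.eq_or_lt with rfl | h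
    · simp [hφz]
    · exact hφ r h hrR
  rw [h1, ← setIntegral_ball_fun_norm m hr fun s ↦ lam + c * φ s ^ q,
    ofReal_integral_eq_lintegral_ofReal]
  · have hc : Continuous fun y : EuclideanSpace ℝ (Fin (m + 1)) ↦ lam + c * φ ‖y‖ ^ q := by
      have := hφq.comp (continuous_norm (E := EuclideanSpace ℝ (Fin (m + 1))))
      exact continuous_const.add (continuous_const.mul this)
    exact (hc.continuousOn.integrableOn_compact (isCompact_closedBall 0 r)).mono_set
      ball_subset_closedBall
  · refine .of_forall fun y ↦ ?_
    have := Real.rpow_nonneg (hφ0 ‖y‖) q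
    simp only [Pi.zero_apply]
    positivity

theorem le_lintegral_superlevel_radial {m : ℕ} {c q R lam : ℝ} (hc : 0 ≤ c) (hq : 0 < q)
    (hlam : 0 ≤ lam) (hR : 0 ≤ R) {φ : ℝ → ℝ} (hφm : Monotone φ) (hφc : Continuous φ)
    (hφ0 : ∀ r, 0 ≤ φ r) (hφz : φ 0 = 0)
    (hφ : ∀ r, 0 < r → r ≤ R → r ^ m * φ r = ∫ s in 0..r, s ^ m * (lam + c * φ s ^ q))
    {w : EuclideanSpace ℝ (Fin (m + 1)) → ℝ} (hw : Measurable w) (hw0 : ∀ x, 0 ≤ w x) {W : ℝ}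
    (hW : ∀ x, w x ≤ W)
    (hvol : ∀ t, 0 ≤ t →
      volume {y | t < w y} ≤ volume (ball (0 : EuclideanSpace ℝ (Fin (m + 1))) R)) :
    ENNReal.ofReal lam * (∫⁻ x, ENNReal.ofReal (w x)) + ENNReal.ofReal c * ∫⁻ x,
        ENNReal.ofReal (φ (ballRadius m (volume {y | w x < w y})) ^ q) * ENNReal.ofReal (w x) ≤
      ∫⁻ t in Ioi (0 : ℝ), ENNReal.ofReal ((m + 1) *
        volume.real (ball (0 : EuclideanSpace ℝ (Fin (m + 1))) 1) *
        (ballRadius m (volume {y | t < w y}) ^ m * φ (ballRadius m (volume {y | t < w y})))) := by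
  set ρ : ℝ → ℝ := fun t ↦ ballRadius m (volume {y | t < w y}) with hρ
  have hρm : Measurable ρ := measurable_ballRadius_superlevel m volume w
  set F : ℝ → ℝ := fun s ↦ φ s ^ q with hF
  have hFc : Continuous F := hφc.rpow_const fun _ ↦ .inr hq.le
  have hFm : Monotone F := fun a b h ↦ Real.rpow_le_rpow (hφ0 a) (hφm h) hq.le
  have hF0 : F 0 = 0 := by simp [hF, hφz, hq.ne']
  have hfm : Measurable fun x ↦ ENNReal.ofReal (F (ρ (w x))) :=
    (hFc.measurable.comp (hρm.comp hw)).ennreal_ofReal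
  have hU : ∀ t, MeasurableSet {y | t < w y} := fun t ↦ measurableSet_lt measurable_const hw
  have h1 : ∫⁻ x, ENNReal.ofReal (w x) = ∫⁻ t in Ioi (0 : ℝ), volume {y | t < w y} :=
    lintegral_eq_lintegral_meas_lt _ (.of_forall hw0) hw.aemeasurable
  have h2 : ∫⁻ x, ENNReal.ofReal (F (ρ (w x))) * ENNReal.ofReal (w x) =
      ∫⁻ t in Ioi (0 : ℝ), ∫⁻ x in {y | t < w y}, ENNReal.ofReal (F (ρ (w x))) := by
    have := lintegral_withDensity_eq_lintegral_mul
      (volume : Measure (EuclideanSpace ℝ (Fin (m + 1))))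
      hfm hw.ennreal_ofReal
    simp only [Pi.mul_apply] at this
    rw [← this, lintegral_eq_lintegral_meas_lt _ (.of_forall hw0) hw.aemeasurable]
    simp_rw [withDensity_apply _ (hU _)]
  change _ * _ + _ * ∫⁻ x, ENNReal.ofReal (F (ρ (w x))) * ENNReal.ofReal (w x) ≤ _
  have hm1 : Measurable fun t ↦ volume {y | t < w y} :=
    Antitone.measurable fun a b hab ↦ measure_mono fun y (hy : b < w y) ↦ hab.trans_lt hy
  rw [h1, h2, ← lintegral_const_mul _ hm1, ← lintegral_const_mul' _ _ ENNReal.ofReal_ne_top,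
    ← lintegral_add_left (hm1.const_mul _)]
  refine setLIntegral_mono' measurableSet_Ioi fun t (ht : 0 < t) ↦ ?_
  have hfin : volume {y | t < w y} ≠ ∞ := ne_top_of_le_ne_top measure_ball_lt_top.ne (hvol t ht.le)
  have hρ0 : 0 ≤ ρ t := ballRadius_nonneg _ _
  have hρR : ρ t ≤ R := ballRadius_le_of_volume_ball_le m hR (hvol t ht.le)
  change _ ≤ ENNReal.ofReal (_ * (ρ t ^ m * φ (ρ t)))
  rw [← lintegral_ball_radial_ode hc hq.le hlam hφc hφ0 hφz hφ hρ0 hρR]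
  have hFnn : ∀ s, 0 ≤ F s := fun s ↦ Real.rpow_nonneg (hφ0 s) q
  have h3 : ∀ y : EuclideanSpace ℝ (Fin (m + 1)), ENNReal.ofReal (lam + c * φ ‖y‖ ^ q) =
      ENNReal.ofReal lam + ENNReal.ofReal c * ENNReal.ofReal (F ‖y‖) := fun y ↦ by
    rw [ENNReal.ofReal_add hlam (mul_nonneg hc (hFnn _)), ENNReal.ofReal_mul hc]
  simp_rw [h3]
  rw [lintegral_add_left measurable_const, setLIntegral_const,
    lintegral_const_mul' _ _ ENNReal.ofReal_ne_top, volume_ball_ballRadius m hfin]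
  gcongr _ + _ * ?_
  exact lintegral_superlevel_le_lintegral_ball hw hW hfin hFc hFm hF0

theorem one_add_mul_le_pow_add {m : ℕ} {r ε : ℝ} (hr : 0 ≤ r) (hε : 0 ≤ ε) :
    r ^ (m + 1) + ε * ((m + 1) * r ^ m) ≤ (r + ε) ^ (m + 1) := by
  induction m with
  | zero => simp
  | succ m ih =>
    have h1 : 0 ≤ r ^ m := by positivity
    have h2 := mul_le_mul_of_nonneg_right ih (add_nonneg hr hε)
    rw [← pow_succ] at h2
    refine le_trans ?_ h2
    push_cast
    have h3 : 0 ≤ ε * ε * ((m + 1) * r ^ m) := by positivity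
    simp only [pow_succ]
    nlinarith

theorem volume_ball_add_le_volume_ball_add (m : ℕ) {r ε : ℝ} (hr : 0 ≤ r) (hε : 0 ≤ ε) :
    volume (ball (0 : EuclideanSpace ℝ (Fin (m + 1))) r) + ENNReal.ofReal ε * ENNReal.ofReal
        ((m + 1) * volume.real (ball (0 : EuclideanSpace ℝ (Fin (m + 1))) 1) * r ^ m) ≤
      volume (ball (0 : EuclideanSpace ℝ (Fin (m + 1))) (r + ε)) := by
  have hω := volume_real_unitBall_pos m
  rw [volume_ball_eq_ofReal m hr, volume_ball_eq_ofReal m (add_nonneg hr hε),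
    ← ENNReal.ofReal_mul hε, ← ENNReal.ofReal_add (by positivity) (by positivity)]
  refine ENNReal.ofReal_le_ofReal ?_
  have := mul_le_mul_of_nonneg_right (one_add_mul_le_pow_add (m := m) hr hε) hω.le
  linarith

theorem le_euclideanHausdorffMeasure_frontier {m : ℕ} {K : Set (EuclideanSpace ℝ (Fin (m + 1)))}
    (hK : IsCompact K) (hKc : Convex ℝ K) (hKi : (interior K).Nonempty) {r : ℝ} (hr : 0 < r)
    (h : volume K = volume (ball (0 : EuclideanSpace ℝ (Fin (m + 1))) r)) :
    ENNReal.ofReal ((m + 1) * volume.real (ball (0 : EuclideanSpace ℝ (Fin (m + 1))) 1) * r ^ m) ≤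
      μHE[m] (frontier K) := by
  obtain ⟨π, hπ⟩ := IsMetricProj.exists_of_isCompact hK hKc (hKi.mono interior_subset)
  refine le_of_forall_gt_imp_ge_of_dense fun a ha ↦ ?_
  obtain ⟨ε, hε, hε0⟩ := ((eventually_lintegral_layer_le hπ hK hKi (ne_top_of_lt ha)
    (continuous_const (y := (1 : ℝ))) (fun _ ↦ zero_le_one) (by simpa using ha)).and
      self_mem_nhdsWithin).exists
  replace hε0 : 0 < ε := hε0
  simp only [ENNReal.ofReal_one, lintegral_const, one_mul, Measure.restrict_apply_univ] at hε
  have h1 := volume_ball_add_le_volume_thickening hK.measurableSet hr hε0 h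
  have h2 : volume (thickening ε K) ≤ volume K + ENNReal.ofReal ε * a := by
    refine (measure_mono ?_).trans ((measure_union_le _ _).trans (by gcongr))
    intro x hx
    by_cases hxK : x ∈ K
    · exact .inl hxK
    · obtain ⟨z, hz, hxz⟩ := mem_thickening_iff.1 hx
      rw [dist_eq_norm] at hxz
      exact .inr ⟨hπ.norm_sub_pos_iff.2 hxK, (hπ.norm_sub_le x hz).trans_lt hxz⟩
  have h3 := (volume_ball_add_le_volume_ball_add m hr.le hε0.le).trans (h1.trans h2)
  rw [h] at h3
  have h4 := (ENNReal.add_le_add_iff_left measure_ball_lt_top.ne).1 h3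
  exact (ENNReal.mul_le_mul_iff_right (by simpa using hε0) ENNReal.ofReal_ne_top).1 h4

theorem euclideanHausdorffMeasure_sphere_eq (m : ℕ) {R : ℝ} (hR : 0 < R) :
    (μHE[m] : Measure (EuclideanSpace ℝ (Fin (m + 1)))) (sphere 0 R) = ENNReal.ofReal
      ((m + 1) * volume.real (ball (0 : EuclideanSpace ℝ (Fin (m + 1))) 1) * R ^ m) := by
  refine le_antisymm ((euclideanHausdorffMeasure_sphere_radius_le m hR).trans_eq ?_) ?_
  · rw [mul_comm (_ * _ : ℝ), ENNReal.ofReal_mul (by positivity),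
      ENNReal.ofReal_mul (by positivity),
      measureReal_def, ENNReal.ofReal_toReal measure_ball_lt_top.ne]
    congr 2
    rw [ENNReal.ofReal_add (by positivity) zero_le_one]
    simp
  · rw [← frontier_closedBall _ hR.ne']
    refine le_euclideanHausdorffMeasure_frontier (isCompact_closedBall _ _) (convex_closedBall _ _)
      ?_ hR (Measure.addHaar_closedBall_eq_addHaar_ball _ _ _)
    rw [interior_closedBall _ hR.ne']
    exact ⟨0, mem_ball_self hR⟩

theorem volume_le_volume_ball_of_frontier_le {m : ℕ} (hm : m ≠ 0)
    {K : Set (EuclideanSpace ℝ (Fin (m + 1)))} (hK : IsCompact K) (hKc : Convex ℝ K)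
    (hKi : (interior K).Nonempty) {R : ℝ} (hR : 0 < R)
    (h : (μHE[m] : Measure (EuclideanSpace ℝ (Fin (m + 1)))) (frontier K) ≤
      μHE[m] (sphere (0 : EuclideanSpace ℝ (Fin (m + 1))) R)) :
    volume K ≤ volume (ball (0 : EuclideanSpace ℝ (Fin (m + 1))) R) := by
  have hω := volume_real_unitBall_pos m
  set r := ballRadius m (volume K) with hr
  have hball := volume_ball_ballRadius m (hK.measure_lt_top (μ := volume)).ne
  rw [← hball]
  refine measure_mono (ball_subset_ball ?_)
  have hr0 : 0 < r := by
    refine (ballRadius_nonneg _ _).lt_of_ne fun h0 ↦ ?_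
    rw [← h0, ball_zero, measure_empty] at hball
    have := (isOpen_interior.measure_pos volume hKi).trans_le (measure_mono interior_subset)
    exact this.ne hball
  have h1 := (le_euclideanHausdorffMeasure_frontier hK hKc hKi hr0 hball.symm).trans h
  rw [euclideanHausdorffMeasure_sphere_eq m hR, ENNReal.ofReal_le_ofReal_iff (by positivity)] at h1
  exact (pow_le_pow_iff_left₀ hr0.le hR.le hm).1 (le_of_mul_le_mul_left h1 (by positivity))

section BallSup

variable {X : Type*} [PseudoMetricSpace X] {w : X → ℝ} {W ε : ℝ}

/-- The supremum of `w` over balls of radius `ε`. -/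
def ballSup (w : X → ℝ) (ε : ℝ) (x : X) : ℝ := sSup (w '' ball x ε)

theorem lt_ballSup_iff (hW : ∀ x, w x ≤ W) (hε : 0 < ε) {t : ℝ} {x : X} :
    t < ballSup w ε x ↔ x ∈ thickening ε {y | t < w y} := by
  rw [ballSup, lt_csSup_iff ⟨W, by rintro _ ⟨y, -, rfl⟩; exact hW y⟩
    ((nonempty_ball.2 hε).image w), mem_thickening_iff]
  constructor
  · rintro ⟨_, ⟨y, hy, rfl⟩, h⟩
    exact ⟨y, h, by rwa [dist_comm]⟩
  · rintro ⟨y, h, hy⟩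
    exact ⟨w y, ⟨y, by rwa [mem_ball, dist_comm], rfl⟩, h⟩

theorem measurable_ballSup [MeasurableSpace X] [OpensMeasurableSpace X] (hW : ∀ x, w x ≤ W)
    (hε : 0 < ε) : Measurable (ballSup w ε) := by
  refine measurable_of_Ioi fun t ↦ ?_
  have : ballSup w ε ⁻¹' Ioi t = thickening ε {y | t < w y} := by
    ext x
    exact lt_ballSup_iff hW hε
  rw [this]
  exact isOpen_thickening.measurableSet

theorem le_ballSup (hW : ∀ x, w x ≤ W) (hε : 0 < ε) (x : X) : w x ≤ ballSup w ε x :=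
  le_csSup ⟨W, by rintro _ ⟨y, -, rfl⟩; exact hW y⟩ ⟨x, mem_ball_self hε, rfl⟩

theorem ballSup_le (hε : 0 < ε) {x : X} {c : ℝ} (h : ∀ y ∈ ball x ε, w y ≤ c) :
    ballSup w ε x ≤ c :=
  csSup_le ((nonempty_ball.2 hε).image w) (by rintro _ ⟨y, hy, rfl⟩; exact h y hy)

end BallSup

theorem eventually_ballSup_sub_le {E : Type*} [NormedAddCommGroup E] [NormedSpace ℝ E]
    {w h : E → ℝ} {x : E} {h' : E →L[ℝ] ℝ} (hd : HasFDerivAt h h' x) (hwx : w x = h x)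
    (hwh : ∀ y, w y ≤ h y) {δ : ℝ} (hδ : 0 < δ) :
    ∀ᶠ ε in nhdsWithin (0 : ℝ) (Ioi 0), (ballSup w ε x - w x) / ε ≤ ‖h'‖ + δ := by
  have h1 := (hasFDerivAt_iff_isLittleO.1 hd).def hδ
  obtain ⟨ε₀, hε₀, h2⟩ := Metric.eventually_nhds_iff.1 h1
  filter_upwards [Ioo_mem_nhdsGT hε₀] with ε hε
  rw [div_le_iff₀ hε.1, sub_le_iff_le_add']
  refine ballSup_le hε.1 fun y hy ↦ ?_
  have h3 := h2 (lt_trans hy hε.2)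
  rw [mem_ball, dist_eq_norm] at hy
  have h4 := (le_abs_self _).trans h3
  have h5 := (le_abs_self _).trans (h'.le_opNorm (y - x))
  have h6 := mul_le_mul_of_nonneg_left hy.le (add_nonneg (norm_nonneg h') hδ.le)
  rw [hwx]
  linarith [hwh y]

theorem integral_antitoneOn_sub_le {g : ℝ → ℝ} (hg : AntitoneOn g (Ici 0)) {a b : ℝ} (ha : 0 ≤ a)
    (hab : a ≤ b) : ∫ t in 0..b, g t ≤ (∫ t in 0..a, g t) + g a * (b - a) := by
  have hii : ∀ c d, 0 ≤ c → 0 ≤ d → IntervalIntegrable g volume c d := fun c d hc hd ↦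
    (hg.mono fun x hx ↦ (le_min hc hd).trans hx.1).intervalIntegrable
  have hb := ha.trans hab
  rw [← intervalIntegral.integral_add_adjacent_intervals (hii 0 a le_rfl ha) (hii a b ha hb)]
  have := intervalIntegral.integral_mono_on hab (hii a b ha hb)
    (_root_.intervalIntegrable_const (c := g a)) fun t ht ↦ hg ha (ha.trans ht.1) ht.1
  rw [intervalIntegral.integral_const, smul_eq_mul] at this
  linarith

/-- The Brunn-Minkowski inequality integrated over the superlevel sets of `w`. -/
theorem lintegral_add_le_lintegral_ballSup {m : ℕ} {w : EuclideanSpace ℝ (Fin (m + 1)) → ℝ}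
    (hw : Measurable w) (hw0 : ∀ x, 0 ≤ w x) {W : ℝ} (hW : ∀ x, w x ≤ W)
    (hfin : ∀ t, 0 ≤ t → volume {y | t < w y} ≠ ∞) {φ : ℝ → ℝ} (hφm : Monotone φ)
    (hφ0 : ∀ r, 0 ≤ φ r) (hφz : φ 0 = 0) {g : ℝ → ℝ}
    (hgφ : g = fun t ↦ φ (ballRadius m (volume {y | t < w y}))) (hg : AntitoneOn g (Ici 0))
    {ε : ℝ} (hε : 0 < ε) :
    (∫⁻ x, ENNReal.ofReal (∫ t in 0..w x, g t)) + ENNReal.ofReal ε *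
        ∫⁻ t in Ioi (0 : ℝ), ENNReal.ofReal ((m + 1) *
          volume.real (ball (0 : EuclideanSpace ℝ (Fin (m + 1))) 1) *
          (ballRadius m (volume {y | t < w y}) ^ m * φ (ballRadius m (volume {y | t < w y})))) ≤
      ∫⁻ x, ENNReal.ofReal (∫ t in 0..ballSup w ε x, g t) := by
  set ρ : ℝ → ℝ := fun t ↦ ballRadius m (volume {y | t < w y}) with hρ
  have hω := volume_real_unitBall_pos m
  have hρm : Measurable ρ := measurable_ballRadius_superlevel m volume w
  have hgm : Measurable g := by rw [hgφ]; exact hφm.measurable.comp hρm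
  have hg0 : ∀ t, 0 ≤ g t := fun t ↦ by rw [hgφ]; exact hφ0 _
  have hii : ∀ t > 0, IntervalIntegrable g volume 0 t := fun t ht ↦
    (hg.mono fun x hx ↦ (le_min le_rfl ht.le).trans hx.1).intervalIntegrable
  have hm1 : Measurable fun t ↦ volume {y | t < w y} :=
    Antitone.measurable fun a b hab ↦ measure_mono fun y (hy : b < w y) ↦ hab.trans_lt hy
  have hm2 : Measurable fun t ↦ volume {y | t < w y} * ENNReal.ofReal (g t) :=
    hm1.mul hgm.ennreal_ofReal
  rw [lintegral_comp_eq_lintegral_meas_lt_mul _ (.of_forall hw0) hw.aemeasurable hii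
      (.of_forall hg0),
    lintegral_comp_eq_lintegral_meas_lt_mul _
      (.of_forall fun x ↦ (hw0 x).trans (le_ballSup hW hε x))
      (measurable_ballSup hW hε).aemeasurable hii (.of_forall hg0),
    ← lintegral_const_mul' _ _ ENNReal.ofReal_ne_top,
    ← lintegral_add_left hm2]
  refine setLIntegral_mono' measurableSet_Ioi fun t (ht : 0 < t) ↦ ?_
  have hsup : {a | t < ballSup w ε a} = thickening ε {y | t < w y} := by
    ext x
    exact lt_ballSup_iff hW hε
  rw [hsup]
  have hgt : g t = φ (ρ t) := by rw [hgφ]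
  change _ + _ * ENNReal.ofReal (_ * (ρ t ^ m * φ (ρ t))) ≤ _
  rw [← hgt]
  have hvol : volume {y | t < w y} = volume (ball (0 : EuclideanSpace ℝ (Fin (m + 1))) (ρ t)) :=
    (volume_ball_ballRadius m (hfin t ht.le)).symm
  rcases (ballRadius_nonneg m (volume {y | t < w y})).eq_or_lt with h0 | hpos
  · have : g t = 0 := by rw [hgt, hρ]; simp only; rw [← h0, hφz]
    simp [this]
  · have h1 := volume_ball_add_le_volume_thickening (measurableSet_lt measurable_const hw)
      hpos hε hvol
    have h2 := (volume_ball_add_le_volume_ball_add m hpos.le hε.le).trans h1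
    change volume (ball _ (ρ t)) + _ * ENNReal.ofReal (_ * ρ t ^ m) ≤ _ at h2
    rw [← hvol] at h2
    refine le_trans (le_of_eq ?_) (mul_le_mul_left h2 (ENNReal.ofReal (g t)))
    have hρt : 0 ≤ ρ t := hpos.le
    rw [add_mul (volume _), mul_assoc (ENNReal.ofReal ε),
      ← ENNReal.ofReal_mul (by positivity) (q := g t), mul_assoc _ _ (g t)]

section

variable {m : ℕ} {K : Set (EuclideanSpace ℝ (Fin (m + 1)))}
  {π : EuclideanSpace ℝ (Fin (m + 1)) → EuclideanSpace ℝ (Fin (m + 1))}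
  {h : EuclideanSpace ℝ (Fin (m + 1)) → ℝ} {L : ℝ}

theorem ballSup_indicator_le_of_notMem (hπ : IsMetricProj K π) (h0 : ∀ x, 0 ≤ h x) (hL0 : 0 ≤ L)
    (hL : ∀ x ∈ K, ∀ y ∈ K, |h x - h y| ≤ L * ‖x - y‖) {ε : ℝ} (hε : 0 < ε)
    (x : EuclideanSpace ℝ (Fin (m + 1))) : ballSup (K.indicator h) ε x ≤ h (π x) + L * ε := by
  refine ballSup_le hε fun y hy ↦ ?_
  by_cases hyK : y ∈ K
  · rw [indicator_of_mem hyK]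
    have h1 := hπ.lipschitzWith.dist_le_mul y x
    rw [hπ.eq_self hyK, NNReal.coe_one, one_mul, dist_eq_norm] at h1
    have h2 := (le_abs_self _).trans (hL y hyK _ (hπ.1 x))
    have h3 := mul_le_mul_of_nonneg_left (h1.trans (mem_ball.1 hy).le) hL0
    linarith
  · rw [indicator_of_notMem hyK]
    exact add_nonneg (h0 _) (mul_nonneg hL0 hε.le)

theorem ballSup_indicator_nonpos (hπ : IsMetricProj K π) {ε : ℝ} (hε : 0 < ε)
    {x : EuclideanSpace ℝ (Fin (m + 1))} (hx : ε ≤ ‖x - π x‖) :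
    ballSup (K.indicator h) ε x ≤ 0 := by
  refine ballSup_le hε fun y hy ↦ ?_
  rw [indicator_of_notMem fun hyK ↦ ?_]
  have h1 := hx.trans (hπ.norm_sub_le x hyK)
  rw [mem_ball, dist_comm, dist_eq_norm] at hy
  exact hy.not_ge h1

theorem ballSup_indicator_sub_le (h0 : ∀ x, 0 ≤ h x) (hL0 : 0 ≤ L)
    (hL : ∀ x ∈ K, ∀ y ∈ K, |h x - h y| ≤ L * ‖x - y‖) {ε : ℝ} (hε : 0 < ε)
    {x : EuclideanSpace ℝ (Fin (m + 1))} (hx : x ∈ K) :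
    ballSup (K.indicator h) ε x ≤ h x + L * ε := by
  refine ballSup_le hε fun y hy ↦ ?_
  by_cases hyK : y ∈ K
  · rw [indicator_of_mem hyK]
    have h2 := (le_abs_self _).trans (hL y hyK _ hx)
    rw [mem_ball, dist_eq_norm] at hy
    have h3 := mul_le_mul_of_nonneg_left hy.le hL0
    linarith
  · rw [indicator_of_notMem hyK]
    exact add_nonneg (h0 _) (mul_nonneg hL0 hε.le)

theorem integral_zero_le_mul {g : ℝ → ℝ} {M b : ℝ} (hg : AntitoneOn g (Ici 0))
    (hgM : ∀ t, g t ≤ M) (hb : 0 ≤ b) : ∫ t in 0..b, g t ≤ M * b := by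
  have := integral_antitoneOn_sub_le hg le_rfl hb
  rw [intervalIntegral.integral_same, zero_add, sub_zero] at this
  exact this.trans (mul_le_mul_of_nonneg_right (hgM 0) hb)

theorem eventually_le_lintegral_ballSup_sub_add (hπ : IsMetricProj K π)
    (hK : IsCompact K) (hKi : (interior K).Nonempty)
    (hfin : (μHE[m] : Measure (EuclideanSpace ℝ (Fin (m + 1)))) (frontier K) ≠ ∞)
    (hh : Continuous h) (h0 : ∀ x, 0 ≤ h x) (hL0 : 0 ≤ L)
    (hL : ∀ x ∈ K, ∀ y ∈ K, |h x - h y| ≤ L * ‖x - y‖) {W : ℝ} (hW : ∀ x ∈ K, h x ≤ W)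
    {g : ℝ → ℝ} {M : ℝ} (hg : AntitoneOn g (Ici 0)) (hgm : Measurable g) (hg0 : ∀ t, 0 ≤ g t)
    (hgM : ∀ t, g t ≤ M) {C : ℝ≥0∞}
    (hC : ∀ ε > 0, (∫⁻ x, ENNReal.ofReal (∫ t in 0..K.indicator h x, g t)) + ENNReal.ofReal ε * C ≤
      ∫⁻ x, ENNReal.ofReal (∫ t in 0..ballSup (K.indicator h) ε x, g t))
    {δ : ℝ} (hδ : 0 < δ) {a : ℝ≥0∞}
    (ha : ∫⁻ z in frontier K, ENNReal.ofReal (M * (h z + δ)) ∂μHE[m] < a) :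
    ∀ᶠ ε in nhdsWithin (0 : ℝ) (Ioi 0), C ≤ (∫⁻ x in K, ENNReal.ofReal
      (g (K.indicator h x) * ((ballSup (K.indicator h) ε x - K.indicator h x) / ε))) + a := by
  set w := K.indicator h with hwdef
  have hM0 : 0 ≤ M := (hg0 0).trans (hgM 0)
  have hw0 : ∀ x, 0 ≤ w x := fun x ↦ indicator_nonneg (fun x _ ↦ h0 x) x
  have hwW : ∀ x, w x ≤ max W 0 := fun x ↦ by
    by_cases hx : x ∈ K
    · rw [hwdef, indicator_of_mem hx]; exact (hW x hx).trans (le_max_left _ _)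
    · rw [hwdef, indicator_of_notMem hx]; exact le_max_right _ _
  have hKm : MeasurableSet K := hK.isClosed.measurableSet
  have hw : Measurable w := hh.measurable.indicator hKm
  have hcg : Continuous fun x ↦ M * (h x + δ) := by fun_prop
  have hG0 : ∀ b, 0 ≤ b → 0 ≤ ∫ t in 0..b, g t := fun b hb ↦
    intervalIntegral.integral_nonneg hb fun t _ ↦ hg0 t
  have hAfin : ∫⁻ x in K, ENNReal.ofReal (∫ t in 0..w x, g t) ≠ ∞ := by
    refine ((setLIntegral_mono' hKm fun x _ ↦ ENNReal.ofReal_le_ofReal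
      ((integral_zero_le_mul hg hgM (hw0 x)).trans
        (mul_le_mul_of_nonneg_left (hwW x) hM0))).trans_lt ?_).ne
    rw [setLIntegral_const]
    exact ENNReal.mul_lt_top ENNReal.ofReal_lt_top hK.measure_lt_top
  have hAK : ∫⁻ x, ENNReal.ofReal (∫ t in 0..w x, g t) =
      ∫⁻ x in K, ENNReal.ofReal (∫ t in 0..w x, g t) := by
    refine (setLIntegral_eq_of_support_subset fun x hx ↦ ?_).symm
    by_contra hxK
    refine hx ?_
    simp [hwdef, hxK]
  have hδL : ∀ᶠ ε in nhdsWithin (0 : ℝ) (Ioi 0), L * ε ≤ δ := by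
    have : Filter.Tendsto (fun ε : ℝ ↦ L * ε) (nhdsWithin 0 (Ioi 0)) (nhds 0) := by
      have : Continuous fun ε : ℝ ↦ L * ε := by fun_prop
      exact (this.tendsto' 0 0 (mul_zero L)).mono_left nhdsWithin_le_nhds
    exact (this.eventually_lt_const hδ).mono fun _ h ↦ h.le
  filter_upwards [eventually_lintegral_layer_le hπ hK hKi hfin hcg
    (fun x ↦ mul_nonneg hM0 (add_nonneg (h0 x) hδ.le)) ha, hδL, self_mem_nhdsWithin]
    with ε hlayer hεδ (hε : 0 < ε)
  have hεK := hC ε hε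
  have hs0 : ∀ x, w x ≤ ballSup w ε x := le_ballSup hwW hε
  have hsm : Measurable (ballSup w ε) := measurable_ballSup hwW hε
  rw [hAK, ← lintegral_add_compl
    (fun x ↦ ENNReal.ofReal (∫ t in 0..ballSup w ε x, g t)) hKm] at hεK
  have hout : ∫⁻ x in Kᶜ, ENNReal.ofReal (∫ t in 0..ballSup w ε x, g t) ≤ ENNReal.ofReal ε * a := by
    refine le_trans ?_ hlayer
    rw [← lintegral_indicator hKm.compl]
    refine le_trans (lintegral_mono fun x ↦ ?_) (lintegral_indicator_le _ _)
    by_cases hx : x ∈ K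
    · rw [indicator_of_notMem (notMem_compl_iff.2 hx)]
      exact zero_le
    rw [indicator_of_mem (mem_compl hx)]
    by_cases hxε : ‖x - π x‖ < ε
    · rw [indicator_of_mem (show x ∈ {x | 0 < ‖x - π x‖ ∧ ‖x - π x‖ < ε} from
        ⟨hπ.norm_sub_pos_iff.2 hx, hxε⟩)]
      refine ENNReal.ofReal_le_ofReal ((integral_zero_le_mul hg hgM ((hw0 x).trans (hs0 x))).trans
        (mul_le_mul_of_nonneg_left ?_ hM0))
      exact (ballSup_indicator_le_of_notMem hπ h0 hL0 hL hε x).trans (by linarith)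
    · have h1 : ballSup w ε x = 0 :=
        le_antisymm (ballSup_indicator_nonpos hπ hε (not_lt.1 hxε)) ((hw0 x).trans (hs0 x))
      rw [h1, intervalIntegral.integral_same, ENNReal.ofReal_zero]
      exact zero_le
  have hin : ∫⁻ x in K, ENNReal.ofReal (∫ t in 0..ballSup w ε x, g t) ≤
      (∫⁻ x in K, ENNReal.ofReal (∫ t in 0..w x, g t)) + ENNReal.ofReal ε *
        ∫⁻ x in K, ENNReal.ofReal (g (w x) * ((ballSup w ε x - w x) / ε)) := by
    have hm1 : Measurable fun x ↦ ENNReal.ofReal (g (w x) * ((ballSup w ε x - w x) / ε)) :=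
      ((hgm.comp hw).mul ((hsm.sub hw).div_const ε)).ennreal_ofReal
    rw [← lintegral_const_mul _ hm1, ← lintegral_add_right _ (hm1.const_mul _)]
    refine lintegral_mono fun x ↦ ?_
    rw [← ENNReal.ofReal_mul hε.le, ← ENNReal.ofReal_add (hG0 _ (hw0 x))
      (mul_nonneg hε.le (mul_nonneg (hg0 _) (div_nonneg (sub_nonneg.2 (hs0 x)) hε.le)))]
    refine ENNReal.ofReal_le_ofReal ((integral_antitoneOn_sub_le hg (hw0 x) (hs0 x)).trans ?_)
    apply le_of_eq
    field_simp
  have hfinal := hεK.trans (add_le_add hin hout)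
  rw [add_assoc, ENNReal.add_le_add_iff_left hAfin, ← mul_add,
    ENNReal.mul_le_mul_iff_right (ENNReal.ofReal_pos.2 hε).ne' ENNReal.ofReal_ne_top] at hfinal
  exact hfinal

theorem le_lintegral_fderiv_add_boundary (hK : IsCompact K) (hKc : Convex ℝ K)
    (hKi : (interior K).Nonempty)
    (hfin : (μHE[m] : Measure (EuclideanSpace ℝ (Fin (m + 1)))) (frontier K) ≠ ∞)
    (hh : Continuous h) (h0 : ∀ x, 0 ≤ h x) (hL0 : 0 ≤ L)
    (hL : ∀ x ∈ K, ∀ y ∈ K, |h x - h y| ≤ L * ‖x - y‖) {W : ℝ} (hW : ∀ x ∈ K, h x ≤ W)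
    (hd : ∀ᵐ x ∂volume.restrict K, DifferentiableAt ℝ h x)
    {g : ℝ → ℝ} {M : ℝ} (hg : AntitoneOn g (Ici 0)) (hgm : Measurable g) (hg0 : ∀ t, 0 ≤ g t)
    (hgM : ∀ t, g t ≤ M) {C : ℝ≥0∞}
    (hC : ∀ ε > 0, (∫⁻ x, ENNReal.ofReal (∫ t in 0..K.indicator h x, g t)) + ENNReal.ofReal ε * C ≤
      ∫⁻ x, ENNReal.ofReal (∫ t in 0..ballSup (K.indicator h) ε x, g t)) :
    C ≤ (∫⁻ x in K, ENNReal.ofReal (g (h x) * ‖fderiv ℝ h x‖)) +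
      ENNReal.ofReal M * ∫⁻ z in frontier K, ENNReal.ofReal (h z) ∂μHE[m] := by
  obtain ⟨π, hπ⟩ := IsMetricProj.exists_of_isCompact hK hKc (hKi.mono interior_subset)
  have hM0 : 0 ≤ M := (hg0 0).trans (hgM 0)
  have hKm : MeasurableSet K := hK.isClosed.measurableSet
  set w := K.indicator h with hwdef
  have hw : Measurable w := hh.measurable.indicator hKm
  have hwW : ∀ x, w x ≤ max W 0 := fun x ↦ by
    by_cases hx : x ∈ K
    · rw [hwdef, indicator_of_mem hx]; exact (hW x hx).trans (le_max_left _ _)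
    · rw [hwdef, indicator_of_notMem hx]; exact le_max_right _ _
  have hwh : ∀ x, w x ≤ h x := indicator_le_self' fun x _ ↦ h0 x
  obtain ⟨ε, -, hεpos, hεlim⟩ := exists_seq_strictAnti_tendsto (0 : ℝ)
  have hεt : Filter.Tendsto ε Filter.atTop (nhdsWithin 0 (Ioi 0)) :=
    tendsto_nhdsWithin_iff.2 ⟨hεlim, .of_forall hεpos⟩
  set F : ℕ → EuclideanSpace ℝ (Fin (m + 1)) → ℝ≥0∞ := fun k x ↦
    ENNReal.ofReal (g (w x) * ((ballSup w (ε k) x - w x) / ε k)) with hF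
  have hFm : ∀ k, Measurable (F k) := fun k ↦ ((hgm.comp hw).mul
    (((measurable_ballSup hwW (hεpos k)).sub hw).div_const (ε k))).ennreal_ofReal
  have hFle : ∀ k, F k ≤ᵐ[volume.restrict K] fun _ ↦ ENNReal.ofReal (M * L) := fun k ↦ by
    filter_upwards [ae_restrict_mem hKm] with x hx
    refine ENNReal.ofReal_le_ofReal (mul_le_mul (hgM _) ?_ (div_nonneg (sub_nonneg.2
      (le_ballSup hwW (hεpos k) x)) (hεpos k).le) hM0)
    rw [div_le_iff₀ (hεpos k), sub_le_iff_le_add', hwdef, indicator_of_mem hx]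
    exact ballSup_indicator_sub_le h0 hL0 hL (hεpos k) hx
  have hlim : Filter.limsup (fun k ↦ ∫⁻ x in K, F k x) Filter.atTop ≤
      ∫⁻ x in K, ENNReal.ofReal (g (h x) * ‖fderiv ℝ h x‖) := by
    refine (limsup_lintegral_le _ hFm hFle ?_).trans (lintegral_mono_ae ?_)
    · rw [setLIntegral_const]
      exact (ENNReal.mul_lt_top ENNReal.ofReal_lt_top hK.measure_lt_top).ne
    filter_upwards [ae_restrict_mem hKm, hd] with x hx hdx
    have hwx : w x = h x := indicator_of_mem hx h
    refine ENNReal.le_of_forall_pos_le_add fun η hη _ ↦ ?_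
    obtain ⟨δ, hδ, hδη⟩ : ∃ δ > 0, M * δ ≤ η := ⟨η / (M + 1), by positivity, by
      rw [mul_div_assoc', div_le_iff₀ (by positivity)]
      nlinarith [NNReal.coe_pos.2 hη]⟩
    refine Filter.limsup_le_of_le (by isBoundedDefault)
      ((hεt.eventually (eventually_ballSup_sub_le hdx.hasFDerivAt hwx hwh hδ)).mono fun k hk ↦ ?_)
    rw [← ENNReal.ofReal_coe_nnreal, ← ENNReal.ofReal_add
      (mul_nonneg (hg0 (h x)) (norm_nonneg (fderiv ℝ h x))) (NNReal.coe_nonneg η)]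
    refine ENNReal.ofReal_le_ofReal ?_
    rw [← hwx]
    have h1 := mul_le_mul_of_nonneg_left hk (hg0 (w x))
    have h2 := mul_le_mul_of_nonneg_right (hgM (w x)) hδ.le
    linarith
  have key : ∀ δ > 0, C ≤ (∫⁻ x in K, ENNReal.ofReal (g (h x) * ‖fderiv ℝ h x‖)) +
      ∫⁻ z in frontier K, ENNReal.ofReal (M * (h z + δ)) ∂μHE[m] := fun δ hδ ↦ by
    rw [← tsub_le_iff_left]
    refine le_of_forall_gt_imp_ge_of_dense fun a ha ↦ ?_
    rw [tsub_le_iff_left, ← tsub_le_iff_right]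
    refine le_trans (Filter.le_limsup_of_frequently_le (Filter.Eventually.frequently ?_)) hlim
    filter_upwards [hεt.eventually (eventually_le_lintegral_ballSup_sub_add hπ hK hKi hfin hh h0 hL0
      hL hW hg hgm hg0 hgM hC hδ ha)] with k hk
    exact tsub_le_iff_right.2 hk
  refine ENNReal.le_of_forall_pos_le_add fun η hη _ ↦ ?_
  set s := (μHE[m] : Measure (EuclideanSpace ℝ (Fin (m + 1)))) (frontier K)
  obtain ⟨δ, hδ, hδη⟩ : ∃ δ > 0, M * δ * s.toReal ≤ η :=
    ⟨η / (M * s.toReal + 1), by positivity, by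
      have : 0 ≤ M * s.toReal := by positivity
      rw [mul_div_assoc', div_mul_eq_mul_div, div_le_iff₀ (by positivity)]
      nlinarith [NNReal.coe_pos.2 hη]⟩
  refine (key δ hδ).trans ?_
  rw [add_assoc]
  gcongr
  rw [← lintegral_const_mul _ hh.measurable.ennreal_ofReal]
  calc ∫⁻ z in frontier K, ENNReal.ofReal (M * (h z + δ)) ∂μHE[m]
      = ∫⁻ z in frontier K, (ENNReal.ofReal M * ENNReal.ofReal (h z) + ENNReal.ofReal (M * δ))
          ∂μHE[m] := by
        refine lintegral_congr fun z ↦ ?_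
        rw [← ENNReal.ofReal_mul hM0, ← ENNReal.ofReal_add (mul_nonneg hM0 (h0 z)) (by positivity),
          mul_add]
    _ = (∫⁻ z in frontier K, ENNReal.ofReal M * ENNReal.ofReal (h z) ∂μHE[m]) +
          ENNReal.ofReal (M * δ) * s := by
        rw [lintegral_add_right _ measurable_const, setLIntegral_const]
    _ ≤ _ := by
        gcongr
        rw [← ENNReal.ofReal_toReal hfin, ← ENNReal.ofReal_mul (by positivity),
          ← ENNReal.ofReal_coe_nnreal]
        exact ENNReal.ofReal_le_ofReal hδη

end

theorem abs_deriv_abs_rpow {p : ℝ} (hp : 1 < p) (s : ℝ) :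
    |p * |s| ^ (p - 2) * s| = p * |s| ^ (p - 1) := by
  rw [abs_mul, abs_mul, abs_of_pos (zero_lt_one.trans hp), mul_assoc,
    abs_of_nonneg (Real.rpow_nonneg (abs_nonneg s) _)]
  rcases eq_or_ne s 0 with rfl | hs
  · rw [abs_zero, mul_zero, Real.zero_rpow (by linarith)]
  · rw [← Real.rpow_add_one (abs_ne_zero.2 hs)]
    ring_nf

theorem mul_deriv_rpow_le_add {p g s a : ℝ} (hp : 1 < p) (hg : 0 ≤ g) (hs : 0 ≤ s) (ha : 0 ≤ a) :
    g * (p * s ^ (p - 1) * a) ≤ a ^ p + (p - 1) * (g ^ (p / (p - 1)) * s ^ p) := by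
  have hp0 : 0 < p := zero_lt_one.trans hp
  have hp1 : 0 < p - 1 := sub_pos.2 hp
  have hb : 0 ≤ g * s ^ (p - 1) := mul_nonneg hg (Real.rpow_nonneg hs _)
  have h1 := Real.young_inequality_of_nonneg ha hb (Real.HolderConjugate.conjExponent hp)
  rw [Real.conjExponent, Real.mul_rpow hg (Real.rpow_nonneg hs _), ← Real.rpow_mul hs,
    mul_div_cancel₀ _ hp1.ne'] at h1
  have h2 := mul_le_mul_of_nonneg_left h1 hp0.le
  calc _ = p * (a * (g * s ^ (p - 1))) := by ring
    _ ≤ _ := h2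
    _ = _ := by field_simp

theorem exists_abs_rpow_sub_le {p : ℝ} (hp : 1 < p) (B : ℝ) :
    ∃ C, 0 ≤ C ∧ ∀ s t : ℝ, |s| ≤ B → |t| ≤ B → |(|s| ^ p) - |t| ^ p| ≤ C * |s - t| := by
  refine ⟨p * |B| ^ (p - 1), by positivity, fun s t hs ht ↦ ?_⟩
  refine Convex.norm_image_sub_le_of_norm_hasDerivWithin_le (f := fun x : ℝ ↦ |x| ^ p)
    (s := Icc (-B) B) (fun x _ ↦ (hasDerivAt_abs_rpow x hp).hasDerivWithinAt) (fun x hx ↦ ?_)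
    (convex_Icc _ _) (abs_le.1 ht) (abs_le.1 hs)
  rw [Real.norm_eq_abs, abs_deriv_abs_rpow hp]
  have h1 : |x| ^ (p - 1) ≤ |B| ^ (p - 1) :=
    Real.rpow_le_rpow (abs_nonneg x) ((abs_le.2 hx).trans (le_abs_self B)) (by linarith)
  exact mul_le_mul_of_nonneg_left h1 (by linarith)

/-- The comparison inequality obtained by using the radial solution `φ`, transplanted to the
superlevel sets of `|u| ^ p`, as a test field. -/
theorem mul_lintegral_le_lintegral_fderiv_add {m : ℕ} {K : Set (EuclideanSpace ℝ (Fin (m + 1)))}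
    (hK : IsCompact K) (hKc : Convex ℝ K) (hKi : (interior K).Nonempty)
    (hfin : (μHE[m] : Measure (EuclideanSpace ℝ (Fin (m + 1)))) (frontier K) ≠ ∞)
    {p lam R M : ℝ} (hp : 1 < p) (hlam : 0 ≤ lam) (hR : 0 ≤ R)
    (hKR : volume K ≤ volume (ball (0 : EuclideanSpace ℝ (Fin (m + 1))) R))
    {φ : ℝ → ℝ} (hφm : Monotone φ) (hφc : Continuous φ) (hφ0 : ∀ r, 0 ≤ φ r) (hφz : φ 0 = 0)
    (hφM : φ R ≤ M)
    (hφ : ∀ r, 0 < r → r ≤ R → r ^ m * φ r =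
      ∫ s in 0..r, s ^ m * (lam + (p - 1) * φ s ^ (p / (p - 1))))
    {u : EuclideanSpace ℝ (Fin (m + 1)) → ℝ} {L : ℝ≥0} (hu : LipschitzWith L u) :
    ENNReal.ofReal lam * (∫⁻ x in K, ENNReal.ofReal (|u x| ^ p)) ≤
      (∫⁻ x in K, ENNReal.ofReal (‖fderiv ℝ u x‖ ^ p)) +
        ENNReal.ofReal M * ∫⁻ z in frontier K, ENNReal.ofReal (|u z| ^ p) ∂μHE[m] := by
  have hp0 : 0 < p := zero_lt_one.trans hp
  have hp1 : 0 < p - 1 := sub_pos.2 hp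
  have hKm : MeasurableSet K := hK.isClosed.measurableSet
  set h : EuclideanSpace ℝ (Fin (m + 1)) → ℝ := fun x ↦ |u x| ^ p with hh
  have hhc : Continuous h := hu.continuous.abs.rpow_const fun _ ↦ .inr hp0.le
  have h0 : ∀ x, 0 ≤ h x := fun x ↦ Real.rpow_nonneg (abs_nonneg _) _
  obtain ⟨B, hB⟩ := hK.exists_bound_of_continuousOn hu.continuous.continuousOn
  obtain ⟨W, hW'⟩ := hK.exists_bound_of_continuousOn hhc.continuousOn
  have hW : ∀ x ∈ K, h x ≤ W := fun x hx ↦ (le_abs_self _).trans (hW' x hx)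
  obtain ⟨A, hA0, hA⟩ := exists_abs_rpow_sub_le hp B
  have hL : ∀ x ∈ K, ∀ y ∈ K, |h x - h y| ≤ A * L * ‖x - y‖ := fun x hx y hy ↦ by
    refine (hA _ _ (hB x hx) (hB y hy)).trans ?_
    rw [mul_assoc]
    have := hu.dist_le_mul x y
    rw [dist_eq_norm, dist_eq_norm] at this
    exact mul_le_mul_of_nonneg_left this hA0
  have hfd : ∀ x, DifferentiableAt ℝ u x →
      HasFDerivAt h ((p * |u x| ^ (p - 2) * u x) • fderiv ℝ u x) x := fun x hx ↦
    (hasDerivAt_abs_rpow (u x) hp).comp_hasFDerivAt x hx.hasFDerivAt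
  have hdu : ∀ᵐ x ∂volume.restrict K, DifferentiableAt ℝ u x :=
    ae_restrict_of_ae hu.ae_differentiableAt
  set w := K.indicator h with hwdef
  have hw : Measurable w := hhc.measurable.indicator hKm
  have hw0 : ∀ x, 0 ≤ w x := fun x ↦ indicator_nonneg (fun x _ ↦ h0 x) x
  have hwK : ∀ x ∈ K, w x = h x := fun x hx ↦ indicator_of_mem hx h
  have hwW : ∀ x, w x ≤ max W 0 := fun x ↦ by
    by_cases hx : x ∈ K
    · rw [hwK x hx]; exact (hW x hx).trans (le_max_left _ _)
    · rw [hwdef, indicator_of_notMem hx]; exact le_max_right _ _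
  have hsub : ∀ t, 0 ≤ t → volume {y | t < w y} ≤ volume K := fun t ht ↦
    measure_mono fun y (hy : t < w y) ↦ by
      by_contra hyK
      rw [hwdef, indicator_of_notMem hyK] at hy
      exact hy.not_ge ht
  have hwfin : ∀ t, 0 ≤ t → volume {y | t < w y} ≠ ∞ := fun t ht ↦
    ((hsub t ht).trans_lt hK.measure_lt_top).ne
  have hball : ∀ t, 0 ≤ t →
      volume {y | t < w y} ≤ volume (ball (0 : EuclideanSpace ℝ (Fin (m + 1))) R) :=
    fun t ht ↦ (hsub t ht).trans hKR
  have hM0 : 0 ≤ M := (hφ0 R).trans hφM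
  set g : ℝ → ℝ := fun t ↦ φ (ballRadius m (volume {y | t < w y})) with hg
  have hgm : Measurable g := hφm.measurable.comp (measurable_ballRadius_superlevel m volume w)
  have hga : AntitoneOn g (Ici 0) := fun a ha b _ hab ↦
    hφm (ballRadius_mono m (hwfin a ha) (measure_mono fun y (hy : b < w y) ↦ hab.trans_lt hy))
  have hgM : ∀ t, g t ≤ M := fun t ↦ by
    rcases lt_or_ge t 0 with ht | ht
    · have h1 : volume {y | t < w y} = ∞ := by
        rw [show {y | t < w y} = univ from eq_univ_of_forall fun y ↦ ht.trans_le (hw0 y)]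
        exact measure_univ_of_isAddLeftInvariant volume
      have h2 : ballRadius m ∞ = 0 := by
        rw [ballRadius, ENNReal.toReal_top, zero_div, Real.zero_rpow (by positivity)]
      change φ (ballRadius m (volume {y | t < w y})) ≤ M
      rw [h1, h2, hφz]
      exact hM0
    · exact (hφm (ballRadius_le_of_volume_ball_le m hR (hball t ht))).trans hφM
  have hC := fun ε (hε : (0 : ℝ) < ε) ↦
    lintegral_add_le_lintegral_ballSup hw hw0 hwW hwfin hφm hφ0 hφz hg hga hε
  have key := le_lintegral_fderiv_add_boundary hK hKc hKi hfin hhc h0 (by positivity) hL hW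
    (hdu.mono fun x hx ↦ (hfd x hx).differentiableAt) hga hgm (fun t ↦ hφ0 _) hgM hC
  have hD := (le_lintegral_superlevel_radial hp1.le (div_pos hp0 hp1) hlam hR hφm hφc hφ0 hφz hφ
    hw hw0 hwW hball).trans key
  set T := ∫⁻ x in K, ENNReal.ofReal (g (h x) ^ (p / (p - 1)) * h x) with hT
  have hTfin : ENNReal.ofReal (p - 1) * T ≠ ∞ := by
    refine ENNReal.mul_ne_top ENNReal.ofReal_ne_top
      ((setLIntegral_mono' hKm fun x hx ↦ ENNReal.ofReal_le_ofReal (mul_le_mul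
        (Real.rpow_le_rpow (hφ0 _) (hgM _) (div_pos hp0 hp1).le) (hW x hx) (h0 x)
        (Real.rpow_nonneg hM0 _))).trans_lt ?_).ne
    rw [setLIntegral_const]
    exact ENNReal.mul_lt_top ENNReal.ofReal_lt_top hK.measure_lt_top
  have h1 : ∫⁻ x in K, ENNReal.ofReal (h x) ≤ ∫⁻ x, ENNReal.ofReal (w x) := by
    refine le_trans (le_of_eq (setLIntegral_congr_fun hKm fun x hx ↦ ?_))
      (setLIntegral_le_lintegral K _)
    rw [hwK x hx]
  have h2 : T ≤ ∫⁻ x, ENNReal.ofReal (φ (ballRadius m (volume {y | w x < w y})) ^ (p / (p - 1))) *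
      ENNReal.ofReal (w x) := by
    refine le_trans (le_of_eq (setLIntegral_congr_fun hKm fun x hx ↦ ?_))
      (setLIntegral_le_lintegral K _)
    rw [← hwK x hx, ENNReal.ofReal_mul (Real.rpow_nonneg (hφ0 _) _)]
  have h3 : ∫⁻ x in K, ENNReal.ofReal (g (h x) * ‖fderiv ℝ h x‖) ≤
      (∫⁻ x in K, ENNReal.ofReal (‖fderiv ℝ u x‖ ^ p)) + ENNReal.ofReal (p - 1) * T := by
    have hTm : Measurable fun x ↦ ENNReal.ofReal (g (h x) ^ (p / (p - 1)) * h x) :=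
      (((hgm.comp hhc.measurable).pow_const _).mul hhc.measurable).ennreal_ofReal
    rw [hT, ← lintegral_const_mul _ hTm, ← lintegral_add_right _ (hTm.const_mul _)]
    refine lintegral_mono_ae (hdu.mono fun x hx ↦ ?_)
    rw [(hfd x hx).fderiv, norm_smul, Real.norm_eq_abs, abs_deriv_abs_rpow hp,
      ← ENNReal.ofReal_mul hp1.le, ← ENNReal.ofReal_add (by positivity)
        (mul_nonneg hp1.le (mul_nonneg (Real.rpow_nonneg (hφ0 _) _) (h0 x)))]
    exact ENNReal.ofReal_le_ofReal
      (mul_deriv_rpow_le_add hp (hφ0 _) (abs_nonneg _) (norm_nonneg _))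
  have h4 := (add_le_add (mul_le_mul_right h1 (ENNReal.ofReal lam))
    (mul_le_mul_right h2 (ENNReal.ofReal (p - 1)))).trans (hD.trans (add_le_add_left h3 _))
  rw [add_right_comm, ENNReal.add_le_add_iff_right hTfin] at h4
  exact h4

theorem exists_euclideanHausdorffMeasure_eq_smul (m : ℕ) (X : Type*) [EMetricSpace X]
    [MeasurableSpace X] [BorelSpace X] : ∃ κ : ℝ≥0, 0 < κ ∧
      (μHE[m] : Measure X) = κ • μH[((m + 1 : ℕ) : ℝ) - 1] := by
  refine ⟨_, pos_iff_ne_zero.2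
    (Measure.addHaarScalarFactor_volume_hausdorffMeasure_ne_zero m), ?_⟩
  rw [Measure.euclideanHausdorffMeasure_def, Nat.cast_add, Nat.cast_one, add_sub_cancel_right]

/-- The integral inequality bounding `lam` by the Rayleigh quotients of `Ω`. -/
theorem le_rayleigh_of_lintegral_le {m : ℕ} {p β M lam : ℝ} (hp : 0 < p) (hβ : 0 ≤ β)
    (hM0 : 0 ≤ M) (hlam : 0 ≤ lam) {κ : ℝ≥0} (hκ : M * κ = β)
    {Ω : Set (EuclideanSpace ℝ (Fin (m + 1)))} (hΩo : IsOpen Ω) (hΩb : IsBounded Ω)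
    (hΩc : Convex ℝ Ω)
    (hE : (μHE[m] : Measure (EuclideanSpace ℝ (Fin (m + 1)))) =
      κ • μH[((m + 1 : ℕ) : ℝ) - 1])
    (hfin : (μH[((m + 1 : ℕ) : ℝ) - 1] : Measure (EuclideanSpace ℝ (Fin (m + 1)))) (frontier Ω) ≠ ∞)
    {u v : EuclideanSpace ℝ (Fin (m + 1)) → ℝ} {L : ℝ≥0} (hv : LipschitzWith L v)
    (huv : EqOn u v (closure Ω)) (hpos : 0 < ∫ x in Ω, |u x| ^ p)
    (h : ENNReal.ofReal lam * (∫⁻ x in closure Ω, ENNReal.ofReal (|v x| ^ p)) ≤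
      (∫⁻ x in closure Ω, ENNReal.ofReal (‖fderiv ℝ v x‖ ^ p)) +
        ENNReal.ofReal M * ∫⁻ z in frontier Ω, ENNReal.ofReal (|v z| ^ p) ∂μHE[m]) :
    lam ≤ rayleigh (m + 1) p β Ω u := by
  have hK : IsCompact (closure Ω) := hΩb.isCompact_closure
  have hvc : Continuous fun x ↦ |v x| ^ p := hv.continuous.abs.rpow_const fun _ ↦ .inr hp.le
  have hres : volume.restrict (closure Ω) = volume.restrict Ω := by
    refine Measure.restrict_congr_set ?_
    rw [closure_eq_self_union_frontier]
    exact union_ae_eq_left_of_ae_eq_empty (ae_eq_empty.2 (hΩc.addHaar_frontier volume))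
  have hΩfin : volume Ω ≠ ∞ := hΩb.measure_lt_top.ne
  have hu1 : ∫ x in Ω, |u x| ^ p = ∫ x in Ω, |v x| ^ p :=
    setIntegral_congr_fun hΩo.measurableSet fun x hx ↦ by
      simp only [huv (subset_closure hx)]
  have hu2 : ∫ x in Ω, ‖fderiv ℝ u x‖ ^ p = ∫ x in Ω, ‖fderiv ℝ v x‖ ^ p :=
    setIntegral_congr_fun hΩo.measurableSet fun x hx ↦ by
      have : u =ᶠ[nhds x] v := by
        filter_upwards [hΩo.mem_nhds hx] with y hy using huv (subset_closure hy)
      simp only [this.fderiv_eq]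
  have hu3 : ∫ x in frontier Ω, |u x| ^ p ∂(μH[((m + 1 : ℕ) : ℝ) - 1]) =
      ∫ x in frontier Ω, |v x| ^ p ∂(μH[((m + 1 : ℕ) : ℝ) - 1]) :=
    setIntegral_congr_fun isClosed_frontier.measurableSet fun x hx ↦ by
      simp only [huv (frontier_subset_closure hx)]
  have hi1 : IntegrableOn (fun x ↦ |v x| ^ p) Ω :=
    (hvc.continuousOn.integrableOn_compact hK).mono_set subset_closure
  have hi2 : IntegrableOn (fun x ↦ ‖fderiv ℝ v x‖ ^ p) Ω := by
    refine Measure.integrableOn_of_bounded hΩfin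
      ((measurable_fderiv ℝ v).norm.pow_const p).aestronglyMeasurable (M := (L : ℝ) ^ p)
      (.of_forall fun x ↦ ?_)
    rw [Real.norm_of_nonneg (by positivity)]
    exact Real.rpow_le_rpow (norm_nonneg _) (norm_fderiv_le_of_lipschitz ℝ hv) hp.le
  obtain ⟨B, hB⟩ := hK.exists_bound_of_continuousOn hvc.continuousOn
  have hi3 : IntegrableOn (fun x ↦ |v x| ^ p) (frontier Ω) μH[((m + 1 : ℕ) : ℝ) - 1] := by
    refine Measure.integrableOn_of_bounded hfin hvc.aestronglyMeasurable (M := B) ?_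
    filter_upwards [ae_restrict_mem isClosed_frontier.measurableSet] with x hx
    exact hB x (frontier_subset_closure hx)
  rw [hres, hE, Measure.restrict_smul, lintegral_smul_measure, ENNReal.smul_def, smul_eq_mul,
    ← mul_assoc, ← ENNReal.ofReal_coe_nnreal, ← ENNReal.ofReal_mul hM0, hκ,
    ← ofReal_integral_eq_lintegral_ofReal hi1 (.of_forall fun x ↦ by positivity),
    ← ofReal_integral_eq_lintegral_ofReal hi2 (.of_forall fun x ↦ by positivity),
    ← ofReal_integral_eq_lintegral_ofReal hi3 (.of_forall fun x ↦ by positivity),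
    ← ENNReal.ofReal_mul hlam, ← ENNReal.ofReal_mul hβ] at h
  have hg0 : 0 ≤ ∫ x in Ω, ‖fderiv ℝ v x‖ ^ p := integral_nonneg fun x ↦ by positivity
  have hb0 : 0 ≤ ∫ x in frontier Ω, |v x| ^ p ∂(μH[((m + 1 : ℕ) : ℝ) - 1]) :=
    integral_nonneg fun x ↦ by positivity
  rw [← ENNReal.ofReal_add hg0 (mul_nonneg hβ hb0),
    ENNReal.ofReal_le_ofReal_iff (add_nonneg hg0 (mul_nonneg hβ hb0))] at h
  rw [rayleigh, le_div_iff₀ hpos, hu1, hu2, hu3]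
  exact h

/-- **Faber–Krahn inequality under a perimeter constraint (β > 0):** the ball of the same
perimeter minimizes the first Robin eigenvalue of the `p`-Laplacian. -/
theorem stmt15 {n : ℕ} (hn : 2 ≤ n) (p β : ℝ) (hp1 : 1 < p) (hβ : 0 < β)
    (Ω : Set (EuclideanSpace ℝ (Fin n))) (hΩo : IsOpen Ω) (hΩb : IsBounded Ω)
    (hΩc : Convex ℝ Ω) (hΩne : Ω.Nonempty)
    (R : ℝ) (hR : 0 < R)
    (Ωstar : Set (EuclideanSpace ℝ (Fin n)))
    (hstar : Ωstar = ball (0 : EuclideanSpace ℝ (Fin n)) R)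
    (hper : perim n Ωstar = perim n Ω) :
    robinEig n p β Ωstar ≤ robinEig n p β Ω := by
  obtain ⟨m, rfl⟩ : ∃ m, n = m + 1 := ⟨n - 1, by omega⟩
  have hm : m ≠ 0 := by omega
  subst hstar
  rcases (robinEig_nonneg (p := p) hβ.le
    (ball (0 : EuclideanSpace ℝ (Fin (m + 1))) R)).eq_or_lt with hlam0 | hlam
  · rw [← hlam0]
    exact robinEig_nonneg hβ.le Ω
  obtain ⟨κ, hκ, hE⟩ :=
    exists_euclideanHausdorffMeasure_eq_smul m (EuclideanSpace ℝ (Fin (m + 1)))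
  have hω := volume_real_unitBall_pos m
  have hκR : (0 : ℝ) < κ := hκ
  set ν : Measure (EuclideanSpace ℝ (Fin (m + 1))) := μH[((m + 1 : ℕ) : ℝ) - 1] with hν
  have hsph := euclideanHausdorffMeasure_sphere_eq m hR
  have hκν : ∀ s, (μHE[m] : Measure (EuclideanSpace ℝ (Fin (m + 1)))) s = κ * ν s := fun s ↦ by
    rw [hE]; rfl
  rw [hκν] at hsph
  have hsphR : κ * ν.real (sphere 0 R) = (m + 1) *
      volume.real (ball (0 : EuclideanSpace ℝ (Fin (m + 1))) 1) * R ^ m := by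
    have := congrArg ENNReal.toReal hsph
    rwa [ENNReal.toReal_mul, ENNReal.coe_toReal, ENNReal.toReal_ofReal (by positivity)] at this
  have hsph0 : 0 < ν.real (sphere 0 R) := by
    rw [← mul_pos_iff_of_pos_left hκR]
    rw [hsphR]
    positivity
  have hperR : ν.real (sphere 0 R) = ν.real (frontier Ω) := by
    rw [perim, perim, frontier_ball _ hR.ne'] at hper
    exact hper
  have hfin : ν (frontier Ω) ≠ ∞ := fun h ↦ by
    rw [hperR, measureReal_def, h, ENNReal.toReal_top] at hsph0
    exact hsph0.false
  have hsfin : ν (sphere 0 R) ≠ ∞ := fun h ↦ by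
    rw [measureReal_def, h, ENNReal.toReal_top] at hsph0
    exact hsph0.false
  have hνeq : ν (frontier Ω) = ν (sphere 0 R) :=
    (ENNReal.toReal_eq_toReal_iff' hfin hsfin).1 hperR.symm
  have hM0 : 0 < β / κ := div_pos hβ hκR
  obtain ⟨φ, hφm, hφc, hφz, hφ0, hφM, hφ⟩ := exists_radial_le hp1 hβ.le hR hlam hM0 le_rfl
    (by rw [← hsphR, ← mul_assoc, div_mul_cancel₀ _ hκR.ne'])
  have hK : IsCompact (closure Ω) := hΩb.isCompact_closure
  have hint : (interior Ω).Nonempty := by rwa [hΩo.interior_eq]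
  have hKi : (interior (closure Ω)).Nonempty := hint.mono (interior_mono subset_closure)
  have hfr : frontier (closure Ω) = frontier Ω := by
    rw [frontier, closure_closure, hΩc.interior_closure_eq_interior_of_nonempty_interior hint,
      frontier]
  have hKR : volume (closure Ω) ≤ volume (ball (0 : EuclideanSpace ℝ (Fin (m + 1))) R) :=
    volume_le_volume_ball_of_frontier_le hm hK hΩc.closure hKi hR
      (by rw [hfr, hκν, hκν, hνeq])
  have hEfin : (μHE[m] : Measure (EuclideanSpace ℝ (Fin (m + 1)))) (frontier (closure Ω)) ≠ ∞ := by
    rw [hfr, hκν]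
    exact ENNReal.mul_ne_top ENNReal.coe_ne_top hfin
  refine le_csInf ⟨_, fun _ ↦ 1, ⟨0, LipschitzWith.const' 1 |>.lipschitzOnWith⟩, ?_, rfl⟩ ?_
  · have : 0 < volume.real Ω :=
      ENNReal.toReal_pos (hΩo.measure_pos volume hΩne).ne' hΩb.measure_lt_top.ne
    simpa using this
  rintro _ ⟨u, ⟨L, hu⟩, hpos, rfl⟩
  obtain ⟨v, hv, hvu⟩ := hu.extend_real
  have key := mul_lintegral_le_lintegral_fderiv_add hK hΩc.closure hKi hEfin hp1 hlam.le hR.le hKR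
    hφm hφc hφ0 hφz hφM hφ hv
  rw [hfr] at key
  exact le_rayleigh_of_lintegral_le (zero_lt_one.trans hp1) hβ.le hM0.le hlam.le
    (div_mul_cancel₀ _ hκR.ne') hΩo hΩb hΩc hE hfin hv hvu hpos key
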